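/- Let P be a smooth Fano n-polytope with n+3 vertices. If P is F-isolated, then there exist integers a ≥ 2 and b ≥ 2 with n = a + 2b − 1 and a labeling V(P) = {v_1, …, v_a, y_1, …, y_b, z, t, u_1, …, u_b} of the vertices of P such that the primitive relations of P are exactly: v_1+⋯+v_a+y_1+⋯+y_b = (a+b−1)t; y_1+⋯+y_b+z = u_1+⋯+u_b; z+t = 0; t+u_1+⋯+u_b = y_1+⋯+y_b; and u_1+⋯+u_b+v_1+⋯+v_a = (a+b−2)t. -/

import Mathlib

/-! ## Basic definitions: lattice polytopes, smooth Fano polytopes,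
unimodular equivalence, F- and I-equivalence, primitive collections. -/

/-- A point of `ℝ^n` all of whose coordinates are integers. -/
def IsLatticePoint {n : ℕ} (x : Fin n → ℝ) : Prop := ∀ i, ∃ m : ℤ, x i = (m : ℝ)

/-- The vertex set of a polytope: its extreme points. -/
def vertexSet {n : ℕ} (P : Set (Fin n → ℝ)) : Set (Fin n → ℝ) :=
  Set.extremePoints ℝ P

/-- A lattice `n`-polytope: the convex hull of finitely many lattice points,
of full dimension `n`. -/
def IsLatticePolytope {n : ℕ} (P : Set (Fin n → ℝ)) : Prop :=
  (∃ S : Finset (Fin n → ℝ), (∀ x ∈ S, IsLatticePoint x) ∧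
    P = convexHull ℝ (S : Set (Fin n → ℝ))) ∧
  affineSpan ℝ P = ⊤

/-- A face of `P`: an exposed subset of `P`. -/
def IsFaceOf {n : ℕ} (F P : Set (Fin n → ℝ)) : Prop := IsExposed ℝ P F

/-- A facet of `P`: a face of affine dimension `n - 1`. -/
def IsFacetOf {n : ℕ} (F P : Set (Fin n → ℝ)) : Prop :=
  IsFaceOf F P ∧ Module.finrank ℝ (vectorSpan ℝ F) + 1 = n

/-- A set `S` of points of `ℝ^n` forms a `ℤ`-basis of `ℤ^n`:
it consists of `n` lattice points whose matrix has determinant `±1`. -/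
def IsUnimodularBasis {n : ℕ} (S : Set (Fin n → ℝ)) : Prop :=
  ∃ b : Fin n → (Fin n → ℝ), Function.Injective b ∧ Set.range b = S ∧
    (∀ i, IsLatticePoint (b i)) ∧ |(Matrix.of b).det| = 1

/-- A smooth Fano `n`-polytope: a lattice `n`-polytope with the origin in its
interior such that the vertex set of every facet is a `ℤ`-basis of `ℤ^n`. -/
def IsSmoothFano {n : ℕ} (P : Set (Fin n → ℝ)) : Prop :=
  IsLatticePolytope P ∧ (0 : Fin n → ℝ) ∈ interior P ∧
    ∀ F : Set (Fin n → ℝ), IsFacetOf F P → IsUnimodularBasis (vertexSet P ∩ F)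

/-- Two subsets of `ℝ^n` are unimodularly equivalent if an affine map of `ℝ^n`
mapping `ℤ^n` onto `ℤ^n` maps one onto the other. -/
def UnimodularEquiv {n : ℕ} (Q Q' : Set (Fin n → ℝ)) : Prop :=
  ∃ φ : (Fin n → ℝ) →ᵃ[ℝ] (Fin n → ℝ),
    φ '' {x | IsLatticePoint x} = {x | IsLatticePoint x} ∧ φ '' Q = Q'

/-- One step of an I-sequence: the vertex set of one polytope is obtained from
the vertex set of the other by adding one new lattice point. -/
def IStep {n : ℕ} (P Q : Set (Fin n → ℝ)) : Prop :=
  (∃ w : Fin n → ℝ, IsLatticePoint w ∧ w ∉ vertexSet P ∧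
    vertexSet Q = vertexSet P ∪ {w}) ∨
  (∃ w : Fin n → ℝ, IsLatticePoint w ∧ w ∉ vertexSet Q ∧
    vertexSet P = vertexSet Q ∪ {w})

/-- I-equivalence of smooth Fano `n`-polytopes. -/
def IEquiv {n : ℕ} (P Q : Set (Fin n → ℝ)) : Prop :=
  ∃ (k : ℕ) (c : Fin (k + 1) → Set (Fin n → ℝ)),
    (∀ i, IsSmoothFano (c i)) ∧
    UnimodularEquiv P (c 0) ∧ UnimodularEquiv Q (c (Fin.last k)) ∧
    ∀ i : Fin k, IStep (c i.castSucc) (c i.succ)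

/-- `Q` is the stellar subdivision of `P` at the new vertex `w`: `w` is the sum
of the vertices of a proper face `F` of `P`, and the facets of `Q` containing
`w` are exactly the sets `conv({w} ∪ (V(F') \ {v}))` for `F'` a facet of `P`
containing `F` and `v` a vertex of `F`. -/
def IsStellarSubdivisionAt {n : ℕ} (P Q : Set (Fin n → ℝ)) (w : Fin n → ℝ) : Prop :=
  ∃ F : Set (Fin n → ℝ), IsFaceOf F P ∧ F.Nonempty ∧ F ≠ P ∧
    w = ∑ᶠ v ∈ vertexSet P ∩ F, v ∧
    {G : Set (Fin n → ℝ) | IsFacetOf G Q ∧ w ∈ G} =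
      {G : Set (Fin n → ℝ) | ∃ F' v, IsFacetOf F' P ∧ F ⊆ F' ∧
        v ∈ vertexSet P ∩ F ∧
        G = convexHull ℝ (insert w ((vertexSet P ∩ F') \ {v}))}

/-- One step of an F-sequence: an I-step which moreover is a stellar
subdivision (or its inverse). -/
def FStep {n : ℕ} (P Q : Set (Fin n → ℝ)) : Prop :=
  (∃ w : Fin n → ℝ, IsLatticePoint w ∧ w ∉ vertexSet P ∧
    vertexSet Q = vertexSet P ∪ {w} ∧ IsStellarSubdivisionAt P Q w) ∨
  (∃ w : Fin n → ℝ, IsLatticePoint w ∧ w ∉ vertexSet Q ∧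
    vertexSet P = vertexSet Q ∪ {w} ∧ IsStellarSubdivisionAt Q P w)

/-- F-equivalence of smooth Fano `n`-polytopes. -/
def FEquiv {n : ℕ} (P Q : Set (Fin n → ℝ)) : Prop :=
  ∃ (k : ℕ) (c : Fin (k + 1) → Set (Fin n → ℝ)),
    (∀ i, IsSmoothFano (c i)) ∧
    UnimodularEquiv P (c 0) ∧ UnimodularEquiv Q (c (Fin.last k)) ∧
    ∀ i : Fin k, FStep (c i.castSucc) (c i.succ)

/-- A smooth Fano polytope is F-isolated if every smooth Fano polytope
F-equivalent to it is unimodularly equivalent to it. -/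
def FIsolated {n : ℕ} (P : Set (Fin n → ℝ)) : Prop :=
  ∀ Q : Set (Fin n → ℝ), IsSmoothFano Q → FEquiv Q P → UnimodularEquiv Q P

/-- A smooth Fano polytope is I-isolated if every smooth Fano polytope
I-equivalent to it is unimodularly equivalent to it. -/
def IIsolated {n : ℕ} (P : Set (Fin n → ℝ)) : Prop :=
  ∀ Q : Set (Fin n → ℝ), IsSmoothFano Q → IEquiv Q P → UnimodularEquiv Q P

/-- A primitive collection of a smooth Fano polytope `P`: a nonempty set `A` of
vertices such that `conv(A)` is not a face of `P` but `conv(A \ {x})` is a face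
of `P` for every `x ∈ A`. -/
def IsPrimitiveCollection {n : ℕ} (P A : Set (Fin n → ℝ)) : Prop :=
  A.Nonempty ∧ A ⊆ vertexSet P ∧ ¬ IsFaceOf (convexHull ℝ A) P ∧
    ∀ x ∈ A, IsFaceOf (convexHull ℝ (A \ {x})) P

/-- The standard basis vector `e_i` of `ℝ^n`. -/
def stdBasis {n : ℕ} (i : Fin n) : Fin n → ℝ := fun q => if q = i then 1 else 0

/-- The polytope `T^n = conv{e_1, …, e_n, -(e_1 + ⋯ + e_n)}`,
corresponding to projective `n`-space. -/
def Tpoly (n : ℕ) : Set (Fin n → ℝ) :=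
  convexHull ℝ (Set.range (stdBasis (n := n)) ∪ {fun _ => (-1 : ℝ)})

/-- `P` has the vertex labeling `v_1, …, v_a, y_1, …, y_b, z, t, u_1, …, u_b`
and its primitive collections and primitive relations are exactly:
`v_1+⋯+v_a+y_1+⋯+y_b = (a+b-1)t`; `y_1+⋯+y_b+z = u_1+⋯+u_b`; `z+t = 0`;
`t+u_1+⋯+u_b = y_1+⋯+y_b`; `u_1+⋯+u_b+v_1+⋯+v_a = (a+b-2)t`. -/
def HasIsolatedStructure {n : ℕ} (P : Set (Fin n → ℝ)) (a b : ℕ)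
    (v : Fin a → Fin n → ℝ) (y : Fin b → Fin n → ℝ) (z t : Fin n → ℝ)
    (u : Fin b → Fin n → ℝ) : Prop :=
  vertexSet P = Set.range v ∪ Set.range y ∪ {z, t} ∪ Set.range u ∧
  (∀ A : Set (Fin n → ℝ), IsPrimitiveCollection P A ↔
    (A = Set.range v ∪ Set.range y ∨ A = Set.range y ∪ {z} ∨ A = {z, t} ∨
     A = insert t (Set.range u) ∨ A = Set.range u ∪ Set.range v)) ∧
  (∑ i, v i) + (∑ j, y j) = ((a : ℝ) + (b : ℝ) - 1) • t ∧
  (∑ j, y j) + z = (∑ j, u j) ∧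
  z + t = 0 ∧
  t + (∑ j, u j) = (∑ j, y j) ∧
  (∑ j, u j) + (∑ i, v i) = ((a : ℝ) + (b : ℝ) - 2) • t

theorem isUnimodularBasis_iff {n : ℕ} (F : Finset (Fin n → ℝ)) :
    IsUnimodularBasis (F : Set (Fin n → ℝ)) ↔
      F.card = n ∧ (∀ w ∈ F, IsLatticePoint w) ∧
        ∀ x, IsLatticePoint x → ∃ c : (Fin n → ℝ) → ℤ, ∑ w ∈ F, (c w : ℝ) • w = x := by
  constructor
  · rintro ⟨b, hb, hF, hl, hdet⟩
    have hFi : F = Finset.univ.image b := by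
      apply Finset.coe_injective; rw [← hF]; simp
    choose M hM using hl
    have hbM : Matrix.of b = (Matrix.of M).map (Int.castRingHom ℝ) := by
      ext i j; simp [hM]
    have hu : IsUnit (Matrix.of M).det := by
      rw [hbM, ← RingHom.mapMatrix_apply, ← RingHom.map_det] at hdet
      rw [Int.isUnit_iff_abs_eq]
      have : ((|(Matrix.of M).det| : ℤ) : ℝ) = 1 := by simpa using hdet
      exact_mod_cast this
    refine ⟨by rw [hFi, Finset.card_image_of_injective _ hb]; simp, ?_, ?_⟩
    · intro w hw i
      have : w ∈ Set.range b := by rw [hF]; exact hw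
      obtain ⟨j, rfl⟩ := this
      exact ⟨_, hM j i⟩
    · intro x hx
      choose X hX using hx
      refine ⟨Function.extend b (Matrix.vecMul X (Matrix.of M)⁻¹) 0, ?_⟩
      rw [hFi, Finset.sum_image hb.injOn]
      have h1 : Matrix.vecMul (Matrix.vecMul X (Matrix.of M)⁻¹) (Matrix.of M) = X := by
        rw [Matrix.vecMul_vecMul, Matrix.nonsing_inv_mul _ hu, Matrix.vecMul_one]
      ext j
      have h2 := congrFun h1 j
      rw [Matrix.vecMul, dotProduct] at h2
      rw [hX, ← h2]
      simp [hb.extend_apply, hM]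
  · rintro ⟨hc, hl, hs⟩
    let e := (F.equivFinOfCardEq hc).symm
    have hl' : ∀ i j, ∃ m : ℤ, (e i : Fin n → ℝ) j = m := fun i j => hl _ (e i).2 j
    choose M hM using hl'
    have hs' : ∀ j : Fin n, ∃ c : (Fin n → ℝ) → ℤ, ∑ w ∈ F, (c w : ℝ) • w = Pi.single j 1 := by
      intro j
      refine hs _ fun i => ?_
      by_cases h : i = j
      · subst h; exact ⟨1, by simp⟩
      · exact ⟨0, by simp [h]⟩
    choose c hcs using hs'
    let N : Matrix (Fin n) (Fin n) ℤ := Matrix.of fun j i => c j (e i)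
    have hNM : N * Matrix.of M = 1 := by
      ext j k
      have h := congrFun (hcs j) k
      rw [Finset.sum_apply, ← Finset.sum_coe_sort, ← Equiv.sum_comp e] at h
      have h2 : ((∑ i, c j (e i) * M i k : ℤ) : ℝ) = (Pi.single j 1 : Fin n → ℝ) k := by
        rw [← h]; simp [hM]
      rw [Matrix.mul_apply, Matrix.one_apply]
      simp only [N, Matrix.of_apply]
      rw [Pi.single_apply] at h2
      by_cases hjk : j = k
      · subst hjk; simp at h2 ⊢; exact_mod_cast h2
      · rw [if_neg (Ne.symm hjk)] at h2
        rw [if_neg hjk]; exact_mod_cast h2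
    have hu : IsUnit (Matrix.of M).det := by
      have := congrArg Matrix.det hNM
      rw [Matrix.det_mul, Matrix.det_one] at this
      exact IsUnit.of_mul_eq_one_right _ this
    refine ⟨fun i => e i, fun i j h => e.injective (Subtype.ext h), ?_, fun i => hl _ (e i).2, ?_⟩
    · ext w; constructor
      · rintro ⟨i, rfl⟩; exact (e i).2
      · intro hw; exact ⟨e.symm ⟨w, hw⟩, by simp⟩
    · have hbM : (Matrix.of fun i => (e i : Fin n → ℝ)) =
          (Matrix.of M).map (Int.castRingHom ℝ) := by
        ext i j; simp [hM]
      rw [hbM, ← RingHom.mapMatrix_apply, ← RingHom.map_det]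
      rw [Int.isUnit_iff_abs_eq] at hu
      have : ((|(Matrix.of M).det| : ℤ) : ℝ) = 1 := by rw [hu]; simp
      simpa using this

theorem mem_span_of_isUnimodularBasis {n : ℕ} {F : Finset (Fin n → ℝ)}
    (hF : IsUnimodularBasis (F : Set (Fin n → ℝ))) :
    Submodule.span ℝ (F : Set (Fin n → ℝ)) = ⊤ := by
  obtain ⟨-, -, h⟩ := (isUnimodularBasis_iff F).1 hF
  rw [eq_top_iff, ← (Pi.basisFun ℝ (Fin n)).span_eq, Submodule.span_le]
  rintro _ ⟨j, rfl⟩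
  obtain ⟨c, hc⟩ := h (Pi.single j 1) (fun i => by
    by_cases h : i = j
    · subst h; exact ⟨1, by simp⟩
    · exact ⟨0, by simp [h]⟩)
  rw [Pi.basisFun_apply, ← hc]
  exact Submodule.sum_mem _ fun w hw => Submodule.smul_mem _ _ (Submodule.subset_span hw)

theorem linearIndepOn_of_isUnimodularBasis {n : ℕ} {F : Finset (Fin n → ℝ)}
    (hF : IsUnimodularBasis (F : Set (Fin n → ℝ))) :
    LinearIndependent ℝ (fun w : F => (w : Fin n → ℝ)) := by
  apply linearIndependent_of_top_le_span_of_card_eq_finrank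
  · rw [Subtype.range_coe_subtype]
    exact (mem_span_of_isUnimodularBasis hF).ge
  · simp [((isUnimodularBasis_iff F).1 hF).1]
 
/-- A linear functional with prescribed values on a unimodular basis. -/
theorem exists_dual_of_isUnimodularBasis {n : ℕ} {F : Finset (Fin n → ℝ)}
    (hF : IsUnimodularBasis (F : Set (Fin n → ℝ))) (f : (Fin n → ℝ) → ℝ) :
    ∃ g : Module.Dual ℝ (Fin n → ℝ), ∀ w ∈ F, g w = f w := by
  have hli := linearIndepOn_of_isUnimodularBasis hF
  let B := Module.Basis.mk hli (by
    rw [Subtype.range_coe_subtype]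
    exact (mem_span_of_isUnimodularBasis hF).ge)
  refine ⟨B.constr ℝ fun w => f w, fun w hw => ?_⟩
  have := B.constr_basis ℝ (fun w : F => f w) ⟨w, hw⟩
  simpa [B] using this

theorem sum_smul_inj_of_isUnimodularBasis {n : ℕ} {F : Finset (Fin n → ℝ)}
    (hF : IsUnimodularBasis (F : Set (Fin n → ℝ))) {c d : (Fin n → ℝ) → ℝ}
    (h : ∑ w ∈ F, c w • w = ∑ w ∈ F, d w • w) : ∀ w ∈ F, c w = d w := by
  intro w hw
  obtain ⟨g, hg⟩ := exists_dual_of_isUnimodularBasis hF (fun v => if v = w then 1 else 0)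
  have h2 := congrArg g h
  simp only [map_sum, map_smul, smul_eq_mul] at h2
  have key : ∀ e : (Fin n → ℝ) → ℝ, ∑ v ∈ F, e v * g v = e w := by
    intro e
    have h3 : ∀ v ∈ F, e v * g v = e v * if v = w then 1 else 0 := fun v hv => by rw [hg v hv]
    rw [Finset.sum_congr rfl h3]
    simp [hw]
  rwa [key, key] at h2

theorem le_of_mem_convexHull {E : Type*} [AddCommGroup E] [Module ℝ E] (g : Module.Dual ℝ E)
    {S : Set E} {r : ℝ} (h : ∀ w ∈ S, g w ≤ r) {x : E} (hx : x ∈ convexHull ℝ S) : g x ≤ r :=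
  convexHull_min (t := {x | g x ≤ r}) h (convex_halfSpace_le g.isLinear r) hx

theorem mem_convexHull_of_eq {E : Type*} [AddCommGroup E] [Module ℝ E]
    (g : Module.Dual ℝ E) {W F : Finset E} {r : ℝ}
    (hlt : ∀ w ∈ W, w ∉ F → g w < r) (hle : ∀ w ∈ W, g w ≤ r) (hFW : F ⊆ W)
    {x : E} (hx : x ∈ convexHull ℝ (W : Set E))
    (hgx : g x = r) : x ∈ convexHull ℝ (F : Set E) := by
  classical
  rw [Finset.mem_convexHull'] at hx ⊢
  obtain ⟨c, hc0, hc1, rfl⟩ := hx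
  have hz : ∑ w ∈ W, c w * (r - g w) = 0 := by
    simp only [mul_sub, Finset.sum_sub_distrib, ← Finset.sum_mul, hc1]
    simp only [map_sum, map_smul, smul_eq_mul] at hgx
    rw [hgx]; ring
  rw [Finset.sum_eq_zero_iff_of_nonneg
    (fun w hw => mul_nonneg (hc0 w hw) (sub_nonneg.2 (hle w hw)))] at hz
  have hcz : ∀ w ∈ W, w ∉ F → c w = 0 := fun w hw hwF => by
    rcases mul_eq_zero.1 (hz w hw) with h | h
    · exact h
    · linarith [hlt w hw hwF]
  refine ⟨c, fun w hw => hc0 w (hFW hw), ?_, ?_⟩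
  · rw [← hc1]; exact Finset.sum_subset hFW hcz
  · exact Finset.sum_subset hFW fun w hw hwF => by rw [hcz w hw hwF, zero_smul]

theorem isFaceOf_convexHull {n : ℕ} (g : Module.Dual ℝ (Fin n → ℝ)) {W F : Finset (Fin n → ℝ)}
    {r : ℝ} (heq : ∀ w ∈ F, g w = r) (hlt : ∀ w ∈ W, w ∉ F → g w < r) (hFW : F ⊆ W) :
    IsFaceOf (convexHull ℝ (F : Set (Fin n → ℝ))) (convexHull ℝ (W : Set (Fin n → ℝ))) := by
  have hle : ∀ w ∈ W, g w ≤ r := fun w hw => by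
    by_cases h : w ∈ F
    · exact (heq w h).le
    · exact (hlt w hw h).le
  intro hne
  obtain ⟨w₀, hw₀⟩ : F.Nonempty := by
    rw [convexHull_nonempty_iff] at hne; exact_mod_cast hne
  refine ⟨LinearMap.toContinuousLinearMap g, ?_⟩
  ext x
  simp only [LinearMap.coe_toContinuousLinearMap']
  constructor
  · intro hx
    refine ⟨convexHull_mono (by exact_mod_cast hFW) hx, fun y hy => ?_⟩
    have h1 := le_of_mem_convexHull g (S := W) hle hy
    have h2 := le_of_mem_convexHull (-g) (S := F) (r := -r)
      (fun w hw => by simp [heq w hw]) hx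
    simp at h2; linarith
  · rintro ⟨hx, hmax⟩
    refine mem_convexHull_of_eq g hlt hle hFW hx ?_
    have h1 := le_of_mem_convexHull g (S := W) hle hx
    have h2 := hmax w₀ (subset_convexHull ℝ _ (hFW hw₀))
    rw [heq w₀ hw₀] at h2
    exact le_antisymm h1 h2

theorem finrank_vectorSpan_of_span_eq_top {n : ℕ} {S : Set (Fin n → ℝ)}
    (g : Module.Dual ℝ (Fin n → ℝ)) (hg : ∀ w ∈ S, g w = 1) (hS : S.Nonempty)
    (hspan : Submodule.span ℝ S = ⊤) :
    Module.finrank ℝ (vectorSpan ℝ S) + 1 = n := by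
  obtain ⟨p, hp⟩ := hS
  have hle : vectorSpan ℝ S ≤ LinearMap.ker g := by
    rw [vectorSpan_def, Submodule.span_le]
    rintro _ ⟨a, ha, b, hb, rfl⟩
    simp [hg a ha, hg b hb]
  have hlt : vectorSpan ℝ S < ⊤ := by
    refine lt_of_le_of_lt hle (lt_top_iff_ne_top.2 fun h => ?_)
    have : p ∈ LinearMap.ker g := h ▸ Submodule.mem_top
    rw [LinearMap.mem_ker, hg p hp] at this
    exact one_ne_zero this
  have h1 := Submodule.finrank_lt hlt.ne
  have h2 : vectorSpan ℝ S ⊔ Submodule.span ℝ {p} = ⊤ := by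
    rw [eq_top_iff, ← hspan, Submodule.span_le]
    intro w hw
    have : w = (w - p) + p := by simp
    rw [this]
    exact Submodule.add_mem_sup (vsub_mem_vectorSpan ℝ hw hp) (Submodule.mem_span_singleton_self p)
  have h3 := Submodule.finrank_add_le_finrank_add_finrank (vectorSpan ℝ S) (Submodule.span ℝ {p})
  rw [h2, finrank_top] at h3
  have h4 := finrank_span_le_card (R := ℝ) ({p} : Set (Fin n → ℝ))
  simp at h1 h3 h4
  omega

theorem vectorSpan_convexHull_eq {n : ℕ} (S : Set (Fin n → ℝ)) :
    vectorSpan ℝ (convexHull ℝ S) = vectorSpan ℝ S := by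
  rw [← direction_affineSpan, affineSpan_convexHull, direction_affineSpan]

/-- A finite set `W` of lattice points together with a collection `𝓕` of subsets which are
the vertex sets of the facets of a smooth Fano polytope with vertex set `W`. -/
structure FanData {n : ℕ} (W : Finset (Fin n → ℝ)) (𝓕 : Set (Finset (Fin n → ℝ))) : Prop where
  subset : ∀ F ∈ 𝓕, F ⊆ W
  unimodular : ∀ F ∈ 𝓕, IsUnimodularBasis (F : Set (Fin n → ℝ))
  supporting : ∀ F ∈ 𝓕, ∃ g : Module.Dual ℝ (Fin n → ℝ),
    (∀ w ∈ F, g w = 1) ∧ ∀ w ∈ W, w ∉ F → g w < 1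
  cover : ∀ x : Fin n → ℝ, ∃ F ∈ 𝓕, ∃ c : (Fin n → ℝ) → ℝ,
    (∀ w ∈ F, 0 ≤ c w) ∧ ∑ w ∈ F, c w • w = x
  exists_mem : ∀ w ∈ W, ∃ F ∈ 𝓕, w ∈ F

namespace FanData

variable {n : ℕ} {W : Finset (Fin n → ℝ)} {𝓕 : Set (Finset (Fin n → ℝ))}

theorem card_eq (h : FanData W 𝓕) {F : Finset (Fin n → ℝ)} (hF : F ∈ 𝓕) : F.card = n :=
  ((isUnimodularBasis_iff F).1 (h.unimodular F hF)).1

theorem isLatticePoint (h : FanData W 𝓕) {w : Fin n → ℝ} (hw : w ∈ W) : IsLatticePoint w := by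
  obtain ⟨F, hF, hwF⟩ := h.exists_mem w hw
  exact ((isUnimodularBasis_iff F).1 (h.unimodular F hF)).2.1 w hwF

theorem exists_subset (h : FanData W 𝓕) {F : Finset (Fin n → ℝ)} (hFW : F ⊆ W)
    (g : Module.Dual ℝ (Fin n → ℝ)) (hg : ∀ w ∈ F, g w = 1) (hle : ∀ w ∈ W, g w ≤ 1) :
    ∃ F' ∈ 𝓕, F ⊆ F' := by
  obtain ⟨F', hF', c, hc, hx⟩ := h.cover (∑ w ∈ F, w)
  obtain ⟨u, hu1, hu2⟩ := h.supporting F' hF'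
  have hule : ∀ w ∈ W, u w ≤ 1 := fun w hw => by
    by_cases hwF : w ∈ F'
    · exact (hu1 w hwF).le
    · exact (hu2 w hw hwF).le
  have h1 : (F.card : ℝ) ≤ ∑ w ∈ F', c w := by
    have e := congrArg g hx
    simp only [map_sum, map_smul, smul_eq_mul] at e
    rw [Finset.sum_congr rfl hg] at e
    simp only [Finset.sum_const, nsmul_eq_mul, mul_one] at e
    rw [← e]
    exact Finset.sum_le_sum fun w hw =>
      mul_le_of_le_one_right (hc w hw) (hle w (h.subset F' hF' hw))
  have h2 : ∑ w ∈ F', c w = ∑ w ∈ F, u w := by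
    have e := congrArg u hx
    simp only [map_sum, map_smul, smul_eq_mul] at e
    rw [← e]
    exact Finset.sum_congr rfl fun w hw => by rw [hu1 w hw, mul_one]
  refine ⟨F', hF', fun w hw => ?_⟩
  by_contra hwF
  have h3 : ∑ w ∈ F, u w < ∑ w ∈ F, (1 : ℝ) :=
    Finset.sum_lt_sum (fun v hv => hule v (hFW hv)) ⟨w, hw, hu2 w (hFW hw) hwF⟩
  simp at h3
  linarith

theorem mem_of_supporting (h : FanData W 𝓕) {F : Finset (Fin n → ℝ)} (hFW : F ⊆ W)
    (hcard : n ≤ F.card)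
    (g : Module.Dual ℝ (Fin n → ℝ)) (hg : ∀ w ∈ F, g w = 1) (hle : ∀ w ∈ W, g w ≤ 1) :
    F ∈ 𝓕 := by
  obtain ⟨F', hF', hs⟩ := h.exists_subset hFW g hg hle
  rwa [Finset.eq_of_subset_of_card_le hs (by rw [h.card_eq hF']; exact hcard)]

theorem zero_mem_convexHull (h : FanData W 𝓕) (hW : W.Nonempty) :
    (0 : Fin n → ℝ) ∈ convexHull ℝ (W : Set (Fin n → ℝ)) := by
  obtain ⟨F, hF, c, hc, hx⟩ := h.cover (-∑ w ∈ W, w)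
  have hsum : ∑ w ∈ W, (1 + if w ∈ F then c w else 0) • w = 0 := by
    simp only [add_smul, one_smul, Finset.sum_add_distrib, ite_smul, zero_smul]
    rw [Finset.sum_ite_mem, Finset.inter_eq_right.2 (h.subset F hF), hx, add_neg_cancel]
  have hpos : ∀ w ∈ W, (0 : ℝ) < 1 + if w ∈ F then c w else 0 := fun w _ => by
    split_ifs with hwF
    · linarith [hc w hwF]
    · norm_num
  have := Finset.centerMass_id_mem_convexHull (R := ℝ) W (fun w hw => (hpos w hw).le)
    (Finset.sum_pos hpos hW)
  rwa [Finset.centerMass, show (∑ i ∈ W, (1 + if i ∈ F then c i else 0) • id i) = 0 from hsum,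
    smul_zero] at this

theorem nonempty (h : FanData W 𝓕) (hn : 1 ≤ n) : W.Nonempty := by
  obtain ⟨F, hF, -⟩ := h.cover 0
  have := h.card_eq hF
  exact (Finset.card_pos.1 (by omega)).mono (h.subset F hF)

theorem mem_convexHull (h : FanData W 𝓕) (hn : 1 ≤ n) {x : Fin n → ℝ}
    (hx : ∀ F ∈ 𝓕, ∀ g : Module.Dual ℝ (Fin n → ℝ), (∀ w ∈ F, g w = 1) → g x ≤ 1) :
    x ∈ convexHull ℝ (W : Set (Fin n → ℝ)) := by
  obtain ⟨F, hF, c, hc, rfl⟩ := h.cover x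
  obtain ⟨u, hu1, -⟩ := h.supporting F hF
  have h1 := hx F hF u hu1
  simp only [map_sum, map_smul, smul_eq_mul] at h1
  rw [Finset.sum_congr rfl (fun w hw => by rw [hu1 w hw, mul_one])] at h1
  set s := ∑ w ∈ F, c w with hs
  have hs0 : 0 ≤ s := Finset.sum_nonneg hc
  have h0 := h.zero_mem_convexHull (h.nonempty hn)
  rcases hs0.eq_or_lt with hs0 | hs0
  · rw [hs, eq_comm, Finset.sum_eq_zero_iff_of_nonneg hc] at hs0
    rwa [Finset.sum_eq_zero fun w hw => by rw [hs0 w hw, zero_smul]]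
  · have hm := Finset.centerMass_id_mem_convexHull (R := ℝ) F hc hs0
    have hm' := convexHull_mono (𝕜 := ℝ) (Finset.coe_subset.2 (h.subset F hF)) hm
    have := (convex_convexHull ℝ (W : Set (Fin n → ℝ))).smul_mem_of_zero_mem h0 hm'
      (t := s) ⟨hs0.le, h1⟩
    rw [Finset.centerMass, ← hs, smul_smul, mul_inv_cancel₀ hs0.ne', one_smul] at this
    simpa using this

theorem zero_mem_interior (h : FanData W 𝓕) (hn : 1 ≤ n) :
    (0 : Fin n → ℝ) ∈ interior (convexHull ℝ (W : Set (Fin n → ℝ))) := by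
  have hfin : 𝓕.Finite := (W.powerset.finite_toSet).subset fun F hF => by
    simpa using h.subset F hF
  choose! u hu1 hu2 using h.supporting
  have hopen : IsOpen (⋂ F ∈ 𝓕, {x | u F x < 1}) :=
    hfin.isOpen_biInter fun F _ =>
      isOpen_lt (LinearMap.continuous_of_finiteDimensional (u F)) continuous_const
  rw [mem_interior]
  refine ⟨_, ?_, hopen, by simp⟩
  intro x hx
  refine h.mem_convexHull hn fun F hF g hg => ?_
  have : g = u F := by
    refine LinearMap.ext_on (mem_span_of_isUnimodularBasis (h.unimodular F hF)) fun w hw => ?_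
    rw [hg w hw, hu1 F hF w hw]
  rw [this]
  simp only [Set.mem_iInter] at hx
  exact le_of_lt (hx F hF)

/-- Every subset of a facet spans a face. -/
theorem isFaceOf_of_subset (h : FanData W 𝓕) {A F : Finset (Fin n → ℝ)} (hF : F ∈ 𝓕)
    (hA : A ⊆ F) :
    IsFaceOf (convexHull ℝ (A : Set (Fin n → ℝ))) (convexHull ℝ (W : Set (Fin n → ℝ))) := by
  obtain ⟨u, hu1, hu2⟩ := h.supporting F hF
  obtain ⟨g, hg⟩ := exists_dual_of_isUnimodularBasis (h.unimodular F hF)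
    (fun w => if w ∈ A then 0 else -1)
  have : ∃ ε : ℝ, 0 < ε ∧ ∀ w ∈ W, w ∉ F → u w + ε * g w < 1 := by
    have hev : ∀ᶠ ε in nhdsWithin (0 : ℝ) (Set.Ioi 0), ∀ w ∈ W, w ∉ F → u w + ε * g w < 1 := by
      rw [Filter.eventually_all_finset]
      intro w hw
      by_cases hwF : w ∈ F
      · simp [hwF]
      · have hc : Filter.Tendsto (fun ε : ℝ => u w + ε * g w) (nhdsWithin 0 (Set.Ioi 0))
            (nhds (u w + 0 * g w)) := by
          apply Filter.Tendsto.mono_left _ nhdsWithin_le_nhds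
          exact Continuous.tendsto (by fun_prop) 0
        rw [zero_mul, add_zero] at hc
        filter_upwards [hc.eventually_lt_const (hu2 w hw hwF)] with ε hε _ using hε
    obtain ⟨ε, h1, h2⟩ := (hev.and self_mem_nhdsWithin).exists
    exact ⟨ε, h2, h1⟩
  obtain ⟨ε, hε, hlt⟩ := this
  refine isFaceOf_convexHull (u + ε • g) (r := 1) ?_ ?_ (hA.trans (h.subset F hF))
  · intro w hw
    simp [hu1 w (hA hw), hg w (hA hw), hw]
  · intro w hw hwA
    by_cases hwF : w ∈ F
    · simp [hu1 w hwF, hg w hwF, hwA, hε]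
    · simpa using hlt w hw hwF

theorem vertexSet_eq (h : FanData W 𝓕) :
    vertexSet (convexHull ℝ (W : Set (Fin n → ℝ))) = W := by
  apply Set.Subset.antisymm extremePoints_convexHull_subset
  intro w hw
  obtain ⟨F, hF, hwF⟩ := h.exists_mem w hw
  have h1 := h.isFaceOf_of_subset hF (A := {w}) (by simpa using hwF)
  simp only [Finset.coe_singleton, convexHull_singleton] at h1
  exact exposedPoints_subset_extremePoints (mem_exposedPoints_iff_exposed_singleton.2 h1)

theorem mem_of_mem_convexHull (h : FanData W 𝓕) {A : Set (Fin n → ℝ)} (hA : A ⊆ W)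
    {w : Fin n → ℝ} (hw : w ∈ W) (hwA : w ∈ convexHull ℝ A) : w ∈ A := by
  have h1 : w ∈ vertexSet (convexHull ℝ (W : Set (Fin n → ℝ))) := by rw [h.vertexSet_eq]; exact hw
  have h2 := inter_extremePoints_subset_extremePoints_of_subset (𝕜 := ℝ)
    (convexHull_mono hA) ⟨hwA, h1⟩
  exact extremePoints_convexHull_subset h2

theorem vertexSet_inter_convexHull (h : FanData W 𝓕) {A : Finset (Fin n → ℝ)} (hA : A ⊆ W) :
    vertexSet (convexHull ℝ (W : Set (Fin n → ℝ))) ∩ convexHull ℝ (A : Set (Fin n → ℝ)) = A := by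
  rw [h.vertexSet_eq]
  ext w
  exact ⟨fun hw => h.mem_of_mem_convexHull (by exact_mod_cast hA) hw.1 hw.2,
    fun hw => ⟨hA hw, subset_convexHull ℝ _ hw⟩⟩

theorem convexHull_subset_iff (h : FanData W 𝓕) {A F : Finset (Fin n → ℝ)} (hA : A ⊆ W)
    (hF : F ⊆ W) : convexHull ℝ (A : Set (Fin n → ℝ)) ⊆ convexHull ℝ (F : Set (Fin n → ℝ)) ↔
      A ⊆ F :=
  ⟨fun hs w hw => h.mem_of_mem_convexHull (by exact_mod_cast hF) (hA hw)
    (hs (subset_convexHull ℝ _ hw)), fun hs => convexHull_mono (by exact_mod_cast hs)⟩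

theorem isFacetOf (h : FanData W 𝓕) (hn : 1 ≤ n) {F : Finset (Fin n → ℝ)} (hF : F ∈ 𝓕) :
    IsFacetOf (convexHull ℝ (F : Set (Fin n → ℝ))) (convexHull ℝ (W : Set (Fin n → ℝ))) := by
  refine ⟨h.isFaceOf_of_subset hF subset_rfl, ?_⟩
  rw [vectorSpan_convexHull_eq]
  obtain ⟨u, hu1, -⟩ := h.supporting F hF
  refine finrank_vectorSpan_of_span_eq_top u hu1 ?_
    (mem_span_of_isUnimodularBasis (h.unimodular F hF))
  rw [Finset.coe_nonempty, ← Finset.card_pos, h.card_eq hF]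
  omega

end FanData

theorem exists_pos_smul_mem_of_zero_mem_interior {n : ℕ} {P : Set (Fin n → ℝ)}
    (h0 : (0 : Fin n → ℝ) ∈ interior P) (x : Fin n → ℝ) : ∃ ε : ℝ, 0 < ε ∧ ε • x ∈ P := by
  have hc : Filter.Tendsto (fun ε : ℝ => ε • x) (nhdsWithin 0 (Set.Ioi 0))
      (nhds ((0 : ℝ) • x)) := by
    apply Filter.Tendsto.mono_left _ nhdsWithin_le_nhds
    exact Continuous.tendsto (by fun_prop) 0
  rw [zero_smul] at hc
  obtain ⟨ε, h1, h2⟩ :=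
    ((hc.eventually (mem_interior_iff_mem_nhds.1 h0)).and self_mem_nhdsWithin).exists
  exact ⟨ε, h2, h1⟩

theorem eq_zero_of_nonpos_of_zero_mem_interior {n : ℕ} {P : Set (Fin n → ℝ)}
    (h0 : (0 : Fin n → ℝ) ∈ interior P) (g : Module.Dual ℝ (Fin n → ℝ))
    (hg : ∀ x ∈ P, g x ≤ 0) : g = 0 := by
  have key : ∀ x, g x ≤ 0 := fun x => by
    obtain ⟨ε, hε, hx⟩ := exists_pos_smul_mem_of_zero_mem_interior h0 x
    have := hg _ hx
    rw [map_smul, smul_eq_mul] at this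
    by_contra hlt
    nlinarith
  ext x
  have h1 := key (LinearMap.single ℝ (fun _ => ℝ) x 1)
  have h2 := key (-(LinearMap.single ℝ (fun _ => ℝ) x 1))
  rw [map_neg] at h2
  simp only [LinearMap.comp_apply, LinearMap.zero_apply]
  linarith

theorem vectorSpan_eq_top_of_zero_mem_interior {n : ℕ} {P : Set (Fin n → ℝ)}
    (h0 : (0 : Fin n → ℝ) ∈ interior P) : vectorSpan ℝ P = ⊤ := by
  rw [eq_top_iff]
  intro x _
  obtain ⟨ε, hε, hx⟩ := exists_pos_smul_mem_of_zero_mem_interior h0 x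
  have := vsub_mem_vectorSpan ℝ hx (interior_subset h0)
  rw [vsub_eq_sub, sub_zero] at this
  have h2 := (vectorSpan ℝ P).smul_mem ε⁻¹ this
  rwa [smul_smul, inv_mul_cancel₀ hε.ne', one_smul] at h2

/-- A facet is cut out by a linear functional with maximum `1`. -/
theorem exists_dual_of_isFacetOf {n : ℕ} (hn : 2 ≤ n) {P G : Set (Fin n → ℝ)}
    (h0 : (0 : Fin n → ℝ) ∈ interior P) (hG : IsFacetOf G P) :
    ∃ g : Module.Dual ℝ (Fin n → ℝ), (∀ x ∈ P, g x ≤ 1) ∧ G = {x ∈ P | g x = 1} := by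
  have hne : G.Nonempty := by
    rw [Set.nonempty_iff_ne_empty]
    rintro rfl
    have := hG.2
    rw [vectorSpan_empty, finrank_bot] at this
    omega
  obtain ⟨l, hl⟩ := hG.1 hne
  obtain ⟨p, hp⟩ := hne
  have hp' := hp
  rw [hl] at hp'
  have hM : 0 < l p := by
    have h1 := hp'.2 0 (interior_subset h0)
    rw [map_zero] at h1
    refine h1.lt_of_ne fun h2 => ?_
    have h3 := eq_zero_of_nonpos_of_zero_mem_interior h0 (l : (Fin n → ℝ) →ₗ[ℝ] ℝ)
      (fun x hx => by simpa [h2] using hp'.2 x hx)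
    have h4 : G = P := by
      rw [hl]
      ext x
      refine ⟨fun hx => hx.1, fun hx => ⟨hx, fun y _ => ?_⟩⟩
      have hz : ∀ x, l x = 0 := fun x => LinearMap.congr_fun h3 x
      rw [hz, hz]
    have h5 := hG.2
    rw [h4, vectorSpan_eq_top_of_zero_mem_interior h0, finrank_top] at h5
    simp at h5
  refine ⟨(l p)⁻¹ • (l : (Fin n → ℝ) →ₗ[ℝ] ℝ), fun x hx => ?_, ?_⟩
  · simp only [LinearMap.smul_apply, ContinuousLinearMap.coe_coe, smul_eq_mul]
    rw [inv_mul_le_one₀ hM]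
    exact hp'.2 x hx
  · rw [hl]
    ext x
    simp only [LinearMap.smul_apply, ContinuousLinearMap.coe_coe, smul_eq_mul, Set.mem_ofPred_eq]
    refine and_congr_right fun hx => ?_
    rw [inv_mul_eq_one₀ hM.ne']
    exact ⟨fun h => le_antisymm (h p hp'.1) (hp'.2 x hx), fun h y hy => h ▸ hp'.2 y hy⟩

namespace FanData

variable {n : ℕ} {W : Finset (Fin n → ℝ)} {𝓕 : Set (Finset (Fin n → ℝ))}

theorem isFacetOf_iff (h : FanData W 𝓕) (hn : 2 ≤ n) {G : Set (Fin n → ℝ)} :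
    IsFacetOf G (convexHull ℝ (W : Set (Fin n → ℝ))) ↔
      ∃ F ∈ 𝓕, G = convexHull ℝ (F : Set (Fin n → ℝ)) := by
  classical
  refine ⟨fun hG => ?_, ?_⟩
  · obtain ⟨g, hg1, hg2⟩ := exists_dual_of_isFacetOf hn (h.zero_mem_interior (by omega)) hG
    set F := W.filter (fun w => g w = 1) with hF
    have hle : ∀ w ∈ W, g w ≤ 1 := fun w hw => hg1 w (subset_convexHull ℝ _ hw)
    have hGF : G = convexHull ℝ (F : Set (Fin n → ℝ)) := by
      rw [hg2]
      apply Set.Subset.antisymm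
      · rintro x ⟨hx, hgx⟩
        refine mem_convexHull_of_eq g (r := 1) (fun w hw hwF => ?_) hle (Finset.filter_subset _ _)
          hx hgx
        refine (hle w hw).lt_of_ne fun he => hwF ?_
        exact Finset.mem_filter.2 ⟨hw, he⟩
      · intro x hx
        have hxW := convexHull_mono (𝕜 := ℝ)
          (Finset.coe_subset.2 (Finset.filter_subset (fun w => g w = 1) W)) hx
        refine ⟨hxW, le_antisymm (hg1 x hxW) ?_⟩
        have h2 := le_of_mem_convexHull (-g) (S := F) (r := -1)
          (fun w hw => by simp [(Finset.mem_filter.1 hw).2]) hx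
        simp at h2; exact h2
    refine ⟨F, ?_, hGF⟩
    refine h.mem_of_supporting (Finset.filter_subset _ _) ?_ g
      (fun w hw => (Finset.mem_filter.1 hw).2) hle
    have h1 := hG.2
    rw [hGF, vectorSpan_convexHull_eq] at h1
    have h2 := finrank_vectorSpan_image_finset_le (k := ℝ) (id : (Fin n → ℝ) → _) F
      (n := F.card - 1)
    rw [Finset.image_id] at h2
    rcases F.eq_empty_or_nonempty with hFe | hFe
    · rw [hFe, Finset.coe_empty, vectorSpan_empty, finrank_bot] at h1
      omega
    · have := hFe.card_pos
      have := h2 (by omega)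
      omega
  · rintro ⟨F, hF, rfl⟩
    exact h.isFacetOf (by omega) hF

theorem isSmoothFano (h : FanData W 𝓕) (hn : 2 ≤ n) :
    IsSmoothFano (convexHull ℝ (W : Set (Fin n → ℝ))) := by
  have h0 := h.zero_mem_interior (by omega)
  refine ⟨⟨⟨W, fun x hx => h.isLatticePoint hx, rfl⟩,
    affineSpan_eq_top_of_nonempty_interior (by rw [(convex_convexHull ℝ _).convexHull_eq]; exact ⟨0, h0⟩)⟩, h0, ?_⟩
  intro G hG
  obtain ⟨F, hF, rfl⟩ := (h.isFacetOf_iff hn).1 hG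
  rw [h.vertexSet_inter_convexHull (h.subset F hF)]
  exact h.unimodular F hF

theorem isFaceOf_iff (h : FanData W 𝓕) (hn : 1 ≤ n) {A : Finset (Fin n → ℝ)} (hA : A ⊆ W)
    (hAW : A ≠ W) :
    IsFaceOf (convexHull ℝ (A : Set (Fin n → ℝ))) (convexHull ℝ (W : Set (Fin n → ℝ))) ↔
      ∃ F ∈ 𝓕, A ⊆ F := by
  refine ⟨fun hf => ?_, fun ⟨F, hF, hs⟩ => h.isFaceOf_of_subset hF hs⟩
  rcases A.eq_empty_or_nonempty with rfl | hne
  · obtain ⟨F, hF, -⟩ := h.cover 0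
    exact ⟨F, hF, by simp⟩
  obtain ⟨l, hl⟩ := hf (by simpa using hne)
  obtain ⟨p, hp⟩ := hne
  have h0 := h.zero_mem_interior hn
  have hmem : ∀ a ∈ A, a ∈ convexHull ℝ (W : Set (Fin n → ℝ)) ∧
      ∀ y ∈ convexHull ℝ (W : Set (Fin n → ℝ)), l y ≤ l a := fun a ha => by
    have h1 : a ∈ convexHull ℝ (A : Set (Fin n → ℝ)) := subset_convexHull ℝ _ ha
    rw [hl] at h1
    exact h1
  have hp' := hmem p hp
  have hM : 0 < l p := by
    have h1 := hp'.2 0 (interior_subset h0)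
    rw [map_zero] at h1
    refine h1.lt_of_ne fun h2 => ?_
    have h3 := eq_zero_of_nonpos_of_zero_mem_interior h0 (l : (Fin n → ℝ) →ₗ[ℝ] ℝ)
      (fun x hx => by simpa [h2] using hp'.2 x hx)
    have hz : ∀ x, l x = 0 := fun x => LinearMap.congr_fun h3 x
    refine hAW (Finset.Subset.antisymm hA fun w hw => ?_)
    have h4 : w ∈ convexHull ℝ (A : Set (Fin n → ℝ)) := by
      rw [hl]
      exact ⟨subset_convexHull ℝ _ hw, fun y _ => by rw [hz, hz]⟩
    exact h.mem_of_mem_convexHull (by exact_mod_cast hA) hw h4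
  refine h.exists_subset hA ((l p)⁻¹ • (l : (Fin n → ℝ) →ₗ[ℝ] ℝ)) (fun w hw => ?_) fun w hw => ?_
  · simp only [LinearMap.smul_apply, ContinuousLinearMap.coe_coe, smul_eq_mul]
    rw [inv_mul_eq_one₀ hM.ne']
    exact le_antisymm ((hmem w hw).2 p hp'.1) (hp'.2 w (hmem w hw).1)
  · simp only [LinearMap.smul_apply, ContinuousLinearMap.coe_coe, smul_eq_mul]
    rw [inv_mul_le_one₀ hM]
    exact hp'.2 w (subset_convexHull ℝ _ hw)

end FanData

/-- A point with positive gauge can be moved to the boundary of a polytope, where some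
functional is maximal. -/
theorem exists_dual_smul_eq_one {n : ℕ} {P : Set (Fin n → ℝ)} (hconv : Convex ℝ P)
    (hcomp : IsCompact P) (h0 : (0 : Fin n → ℝ) ∈ interior P) {x : Fin n → ℝ} (hx : x ≠ 0) :
    ∃ r : ℝ, 0 < r ∧ r • x ∈ P ∧ ∃ g : Module.Dual ℝ (Fin n → ℝ),
      g (r • x) = 1 ∧ ∀ y ∈ P, g y ≤ 1 := by
  have hnh := mem_interior_iff_mem_nhds.1 h0
  have hpos : 0 < gauge P x :=
    (gauge_pos (absorbent_nhds_zero hnh)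
      (NormedSpace.isVonNBounded_iff ℝ |>.2 hcomp.isBounded)).2 hx
  set p := (gauge P x)⁻¹ • x with hp
  have hg1 : gauge P p = 1 := by
    rw [hp, gauge_smul_of_nonneg (inv_nonneg.2 hpos.le), smul_eq_mul, inv_mul_cancel₀ hpos.ne']
  have hfr := (gauge_eq_one_iff_mem_frontier hconv hnh).1 hg1
  have hpP : p ∈ P := by
    have := hfr.1
    rwa [hcomp.isClosed.closure_eq] at this
  obtain ⟨f, hf⟩ := geometric_hahn_banach_open_point hconv.interior isOpen_interior hfr.2
  have hfp : 0 < f p := by simpa using hf 0 h0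
  have hle : ∀ y ∈ P, f y ≤ f p := by
    have hcl : closure (interior P) = P := by
      rw [hconv.closure_interior_eq_closure_of_nonempty_interior ⟨0, h0⟩,
        hcomp.isClosed.closure_eq]
    intro y hy
    rw [← hcl] at hy
    exact closure_minimal (t := {y | f y ≤ f p}) (fun a ha => (hf a ha).le)
      (isClosed_le f.continuous continuous_const) hy
  refine ⟨(gauge P x)⁻¹, inv_pos.2 hpos, hpP, (f p)⁻¹ • (f : (Fin n → ℝ) →ₗ[ℝ] ℝ), ?_, ?_⟩
  · rw [← hp]
    simp only [LinearMap.smul_apply, ContinuousLinearMap.coe_coe, smul_eq_mul]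
    exact inv_mul_cancel₀ hfp.ne'
  · intro y hy
    simp only [LinearMap.smul_apply, ContinuousLinearMap.coe_coe, smul_eq_mul]
    rw [inv_mul_le_one₀ hfp]
    exact hle y hy

/-- A point of a polytope where some functional attains its maximum `1` lies in a face spanning
the whole space. -/
theorem exists_dual_span_eq_top {n : ℕ} {W : Finset (Fin n → ℝ)}
    (h0 : (0 : Fin n → ℝ) ∈ interior (convexHull ℝ (W : Set (Fin n → ℝ))))
    {p : Fin n → ℝ} (hp : p ∈ convexHull ℝ (W : Set (Fin n → ℝ)))
    (hex : ∃ g : Module.Dual ℝ (Fin n → ℝ), g p = 1 ∧ ∀ w ∈ W, g w ≤ 1) :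
    ∃ F ⊆ W, ∃ g : Module.Dual ℝ (Fin n → ℝ), (∀ w ∈ F, g w = 1) ∧
      (∀ w ∈ W, w ∉ F → g w < 1) ∧ Submodule.span ℝ (F : Set (Fin n → ℝ)) = ⊤ ∧
      p ∈ convexHull ℝ (F : Set (Fin n → ℝ)) := by
  classical
  set T := W.powerset.filter (fun F => ∃ g : Module.Dual ℝ (Fin n → ℝ),
    g p = 1 ∧ (∀ w ∈ W, g w ≤ 1) ∧ F = W.filter (fun w => g w = 1)) with hT
  have hTne : T.Nonempty := by
    obtain ⟨g, hg1, hg2⟩ := hex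
    exact ⟨W.filter (fun w => g w = 1), by
      rw [hT, Finset.mem_filter, Finset.mem_powerset]
      exact ⟨Finset.filter_subset _ _, g, hg1, hg2, rfl⟩⟩
  obtain ⟨F, hFT, hmax⟩ := T.exists_max_image Finset.card hTne
  rw [hT, Finset.mem_filter, Finset.mem_powerset] at hFT
  obtain ⟨hFW, g, hg1, hg2, hF⟩ := hFT
  have hFg : ∀ w ∈ F, g w = 1 := fun w hw => by
    rw [hF] at hw; exact (Finset.mem_filter.1 hw).2
  have hFlt : ∀ w ∈ W, w ∉ F → g w < 1 := fun w hw hwF => by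
    refine (hg2 w hw).lt_of_ne fun he => hwF ?_
    rw [hF]; exact Finset.mem_filter.2 ⟨hw, he⟩
  have hpF := mem_convexHull_of_eq g hFlt hg2 hFW hp hg1
  refine ⟨F, hFW, g, hFg, hFlt, ?_, hpF⟩
  by_contra hspan
  obtain ⟨h, hne, hker⟩ := Submodule.exists_le_ker_of_lt_top _ (lt_top_iff_ne_top.2 hspan)
  have hhF : ∀ w ∈ F, h w = 0 := fun w hw => hker (Submodule.subset_span hw)
  have hhp : h p = 0 := hker (convexHull_min Submodule.subset_span (Submodule.convex _) hpF)
  set U := W.filter (fun w => 0 < h w) with hU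
  have hUne : U.Nonempty := by
    by_contra hemp
    rw [Finset.not_nonempty_iff_eq_empty] at hemp
    refine hne (eq_zero_of_nonpos_of_zero_mem_interior h0 h fun x hx => ?_)
    refine le_of_mem_convexHull h (fun w hw => ?_) hx
    by_contra hlt
    have : w ∈ U := Finset.mem_filter.2 ⟨hw, not_le.1 hlt⟩
    rw [hemp] at this
    simp at this
  obtain ⟨w₀, hw₀, hmin⟩ := U.exists_min_image (fun w => (1 - g w) / h w) hUne
  obtain ⟨hw₀W, hw₀h⟩ := Finset.mem_filter.1 hw₀
  set s := (1 - g w₀) / h w₀ with hs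
  have hs0 : 0 ≤ s := div_nonneg (sub_nonneg.2 (hg2 w₀ hw₀W)) hw₀h.le
  have hmem : W.filter (fun w => (g + s • h) w = 1) ∈ T := by
    rw [hT, Finset.mem_filter, Finset.mem_powerset]
    refine ⟨Finset.filter_subset _ _, g + s • h, by simp [hg1, hhp], fun w hw => ?_, rfl⟩
    simp only [LinearMap.add_apply, LinearMap.smul_apply, smul_eq_mul]
    by_cases hw0 : 0 < h w
    · have h1 := hmin w (Finset.mem_filter.2 ⟨hw, hw0⟩)
      rw [le_div_iff₀ hw0] at h1
      linarith
    · have := mul_nonneg hs0 (neg_nonneg.2 (not_lt.1 hw0))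
      linarith [hg2 w hw]
  have hlt : F.card < (W.filter (fun w => (g + s • h) w = 1)).card := by
    apply Finset.card_lt_card
    rw [Finset.ssubset_iff_of_subset]
    · refine ⟨w₀, Finset.mem_filter.2 ⟨hw₀W, ?_⟩, fun hw => hw₀h.ne' (hhF w₀ hw)⟩
      simp only [LinearMap.add_apply, LinearMap.smul_apply, smul_eq_mul]
      rw [hs, div_mul_cancel₀ _ hw₀h.ne']
      ring
    · intro w hw
      refine Finset.mem_filter.2 ⟨hFW hw, ?_⟩
      simp [hhF w hw, hFg w hw]
  exact absurd (hmax _ hmem) (not_le.2 hlt)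

theorem IsSmoothFano.exists_fanData {n : ℕ} (hn : 1 ≤ n) {P : Set (Fin n → ℝ)}
    (hP : IsSmoothFano P) :
    ∃ (W : Finset (Fin n → ℝ)) (𝓕 : Set (Finset (Fin n → ℝ))), FanData W 𝓕 ∧
      P = convexHull ℝ (W : Set (Fin n → ℝ)) := by
  classical
  obtain ⟨⟨⟨S, hS, hPS⟩, -⟩, h0, hfac⟩ := hP
  have hext : vertexSet P ⊆ S := by rw [hPS]; exact extremePoints_convexHull_subset
  have hfin : (vertexSet P).Finite := S.finite_toSet.subset hext
  have hcomp : IsCompact P := by rw [hPS]; exact S.finite_toSet.isCompact_convexHull ℝ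
  have hconv : Convex ℝ P := by rw [hPS]; exact convex_convexHull ℝ _
  obtain ⟨W, hW⟩ := hfin.exists_finset_coe
  have hPW : P = convexHull ℝ (W : Set (Fin n → ℝ)) := by
    rw [← closure_convexHull_extremePoints hcomp hconv,
      show P.extremePoints ℝ = W from hW.symm, (W.finite_toSet.isClosed_convexHull ℝ).closure_eq]
  set 𝓕 : Set (Finset (Fin n → ℝ)) := {F | F ⊆ W ∧ ∃ g : Module.Dual ℝ (Fin n → ℝ),
    (∀ w ∈ F, g w = 1) ∧ (∀ w ∈ W, w ∉ F → g w < 1) ∧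
      Submodule.span ℝ (F : Set (Fin n → ℝ)) = ⊤} with h𝓕
  have hcov : ∀ x : Fin n → ℝ, x ≠ 0 → ∃ F ∈ 𝓕, ∃ r : ℝ, 0 < r ∧
      r • x ∈ convexHull ℝ (F : Set (Fin n → ℝ)) := by
    intro x hx
    obtain ⟨r, hr, hrP, g, hg1, hg2⟩ := exists_dual_smul_eq_one hconv hcomp h0 hx
    rw [hPW] at hrP h0 hg2
    obtain ⟨F, hFW, g', h1, h2, h3, h4⟩ := exists_dual_span_eq_top h0 hrP
      ⟨g, hg1, fun w hw => hg2 w (subset_convexHull ℝ _ hw)⟩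
    exact ⟨F, ⟨hFW, g', h1, h2, h3⟩, r, hr, h4⟩
  have hx₁ : ∃ x : Fin n → ℝ, x ≠ 0 :=
    ⟨fun _ => 1, fun h => one_ne_zero (congrFun h ⟨0, hn⟩)⟩
  refine ⟨W, 𝓕, ⟨fun F hF => hF.1, ?_, ?_, ?_, ?_⟩, hPW⟩
  · rintro F ⟨hFW, g, hg1, hg2, hsp⟩
    have hne : F.Nonempty := by
      by_contra hemp
      rw [Finset.not_nonempty_iff_eq_empty] at hemp
      rw [hemp, Finset.coe_empty, Submodule.span_empty] at hsp
      obtain ⟨x, hx⟩ := hx₁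
      have : x ∈ (⊥ : Submodule ℝ (Fin n → ℝ)) := hsp ▸ Submodule.mem_top
      exact hx (by simpa using this)
    have hfacet : IsFacetOf (convexHull ℝ (F : Set (Fin n → ℝ))) P := by
      rw [hPW]
      refine ⟨isFaceOf_convexHull g hg1 hg2 hFW, ?_⟩
      rw [vectorSpan_convexHull_eq]
      exact finrank_vectorSpan_of_span_eq_top g hg1 (by exact_mod_cast hne) hsp
    have := hfac _ hfacet
    rw [← hW] at this
    convert this using 1
    ext w
    refine ⟨fun hw => ⟨hFW hw, subset_convexHull ℝ _ hw⟩, fun ⟨hw, hwF⟩ => ?_⟩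
    by_contra hn'
    have h1 := le_of_mem_convexHull (-g) (S := F) (r := -1)
      (fun w hw => by simp [hg1 w hw]) hwF
    have h2 := hg2 w hw hn'
    simp at h1
    linarith
  · rintro F ⟨hFW, g, hg1, hg2, -⟩
    exact ⟨g, hg1, hg2⟩
  · intro x
    by_cases hx : x = 0
    · obtain ⟨x₁, hx₁⟩ := hx₁
      obtain ⟨F, hF, -⟩ := hcov x₁ hx₁
      exact ⟨F, hF, fun _ => 0, by simp, by simp [hx]⟩
    · obtain ⟨F, hF, r, hr, hm⟩ := hcov x hx
      obtain ⟨c, hc0, -, hc⟩ := Finset.mem_convexHull'.1 hm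
      refine ⟨F, hF, fun w => r⁻¹ * c w, fun w hw => mul_nonneg (inv_nonneg.2 hr.le) (hc0 w hw), ?_⟩
      simp only [mul_smul, ← Finset.smul_sum, hc]
      rw [smul_smul, inv_mul_cancel₀ hr.ne', one_smul]
  · intro w hw
    have hwx : w ∈ P.extremePoints ℝ := by
      have : w ∈ (W : Set (Fin n → ℝ)) := hw
      rw [hW] at this; exact this
    have hw0 : w ≠ 0 := by
      rintro rfl
      obtain ⟨x, hx⟩ := hx₁
      obtain ⟨ε, hε, h1⟩ := exists_pos_smul_mem_of_zero_mem_interior h0 x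
      obtain ⟨δ, hδ, h2⟩ := exists_pos_smul_mem_of_zero_mem_interior h0 (-x)
      have := hwx.2 h1 h2 ⟨δ / (ε + δ), ε / (ε + δ), by positivity, by positivity, by
        field_simp; ring, by
        ext i
        simp only [Pi.add_apply, Pi.smul_apply, Pi.neg_apply, smul_eq_mul, Pi.zero_apply]
        field_simp
        ring⟩
      exact hx ((smul_eq_zero.1 this).resolve_left hε.ne')
    obtain ⟨F, hF, r, hr, hm⟩ := hcov w hw0
    refine ⟨F, hF, ?_⟩
    obtain ⟨hFW, g, hg1, hg2, -⟩ := hF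
    have hFP : convexHull ℝ (F : Set (Fin n → ℝ)) ⊆ P := by
      rw [hPW]; exact convexHull_mono (by exact_mod_cast hFW)
    have hgr : g (r • w) = 1 := by
      apply le_antisymm (le_of_mem_convexHull g (fun w hw => (hg1 w hw).le) hm)
      have h1 := le_of_mem_convexHull (-g) (S := F) (r := -1)
        (fun w hw => by simp [hg1 w hw]) hm
      simpa using h1
    have hgw : g w ≤ 1 := by
      by_cases h : w ∈ F
      · exact (hg1 w h).le
      · exact (hg2 w hw h).le
    rw [map_smul, smul_eq_mul] at hgr
    have hr1 : 1 ≤ r := by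
      by_contra hlt
      nlinarith
    have hweq : r • w = w := by
      rcases hr1.eq_or_lt with h | h
      · rw [← h, one_smul]
      · refine hwx.2 (hFP hm) (interior_subset h0)
          ⟨r⁻¹, 1 - r⁻¹, inv_pos.2 hr, sub_pos.2 (inv_lt_one_of_one_lt₀ h), by ring, ?_⟩
        rw [smul_smul, inv_mul_cancel₀ hr.ne', one_smul, smul_zero, add_zero]
    rw [hweq] at hm
    exact extremePoints_convexHull_subset
      (inter_extremePoints_subset_extremePoints_of_subset (𝕜 := ℝ) hFP ⟨hm, hwx⟩)

theorem exists_int_eq_of_isUnimodularBasis {n : ℕ} {F : Finset (Fin n → ℝ)}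
    (hF : IsUnimodularBasis (F : Set (Fin n → ℝ))) {g : Module.Dual ℝ (Fin n → ℝ)}
    (hg : ∀ w ∈ F, g w = 1) {x : Fin n → ℝ} (hx : IsLatticePoint x) : ∃ m : ℤ, g x = m := by
  obtain ⟨c, rfl⟩ := ((isUnimodularBasis_iff F).1 hF).2.2 x hx
  refine ⟨∑ w ∈ F, c w, ?_⟩
  simp only [map_sum, map_smul, smul_eq_mul, Int.cast_sum]
  exact Finset.sum_congr rfl fun w hw => by rw [hg w hw, mul_one]

theorem IsLatticePoint.add {n : ℕ} {x y : Fin n → ℝ} (hx : IsLatticePoint x)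
    (hy : IsLatticePoint y) : IsLatticePoint (x + y) := fun i => by
  obtain ⟨a, ha⟩ := hx i
  obtain ⟨b, hb⟩ := hy i
  exact ⟨a + b, by simp [ha, hb]⟩

open Classical in
theorem sum_insert_add_erase {n : ℕ} {F : Finset (Fin n → ℝ)}
    {x x' : Fin n → ℝ} (hx : x ∈ F) (hx' : x' ∈ F) (hne : x ≠ x') (hw : x + x' ∉ F)
    (c : (Fin n → ℝ) → ℝ) :
    ∑ v ∈ insert (x + x') (F.erase x),
      (if v = x + x' then c x else if v = x' then c v - c x else c v) • v = ∑ v ∈ F, c v • v := by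
  have hw' : x + x' ∉ F.erase x := fun h => hw (Finset.mem_of_mem_erase h)
  have hx'e : x' ∈ F.erase x := Finset.mem_erase.2 ⟨hne.symm, hx'⟩
  rw [Finset.sum_insert hw', if_pos rfl, ← Finset.add_sum_erase F _ hx,
    ← Finset.add_sum_erase (F.erase x) (fun v => c v • v) hx'e,
    ← Finset.add_sum_erase (F.erase x) _ hx'e, if_neg (fun h : x' = x + x' => hw (h ▸ hx')), if_pos rfl]
  have : ∀ v ∈ (F.erase x).erase x', (if v = x + x' then c x else if v = x' then c v - c x else c v)
      • v = c v • v := fun v hv => by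
    rw [if_neg (fun h : v = x + x' => hw' (h ▸ Finset.mem_of_mem_erase hv)), if_neg (Finset.ne_of_mem_erase hv)]
  rw [Finset.sum_congr rfl this]
  module

open Classical in
theorem isUnimodularBasis_insert_add_erase {n : ℕ} {F : Finset (Fin n → ℝ)}
    (hF : IsUnimodularBasis (F : Set (Fin n → ℝ))) {x x' : Fin n → ℝ} (hx : x ∈ F) (hx' : x' ∈ F)
    (hne : x ≠ x') (hw : x + x' ∉ F) :
    IsUnimodularBasis ((insert (x + x') (F.erase x) : Finset (Fin n → ℝ)) : Set (Fin n → ℝ)) := by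
  rw [isUnimodularBasis_iff] at hF ⊢
  obtain ⟨h1, h2, h3⟩ := hF
  refine ⟨?_, ?_, fun p hp => ?_⟩
  · rw [Finset.card_insert_of_notMem (fun h => hw (Finset.mem_of_mem_erase h)),
      Finset.card_erase_of_mem hx, h1]
    have := Finset.card_pos.2 ⟨x, hx⟩
    omega
  · intro v hv
    rcases Finset.mem_insert.1 hv with rfl | hv
    · exact (h2 x hx).add (h2 x' hx')
    · exact h2 v (Finset.mem_of_mem_erase hv)
  · obtain ⟨c, hc⟩ := h3 p hp
    refine ⟨fun v => if v = x + x' then c x else if v = x' then c v - c x else c v, ?_⟩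
    rw [← hc, ← sum_insert_add_erase hx hx' hne hw (fun v => (c v : ℝ))]
    refine Finset.sum_congr rfl fun v _ => ?_
    congr 1
    by_cases e1 : v = x + x' <;> by_cases e2 : v = x' <;> simp [e1, e2]

open Classical in
/-- The facets of the stellar subdivision at the edge `{x, x'}`. -/
def starFacets {n : ℕ} (𝓕 : Set (Finset (Fin n → ℝ))) (x x' : Fin n → ℝ) :
    Set (Finset (Fin n → ℝ)) :=
  {G | (G ∈ 𝓕 ∧ ¬(x ∈ G ∧ x' ∈ G)) ∨ ∃ F ∈ 𝓕, x ∈ F ∧ x' ∈ F ∧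
    (G = insert (x + x') (F.erase x) ∨ G = insert (x + x') (F.erase x'))}

namespace FanData

variable {n : ℕ} {W : Finset (Fin n → ℝ)} {𝓕 : Set (Finset (Fin n → ℝ))}

theorem add_notMem (h : FanData W 𝓕) {x x' : Fin n → ℝ} {F : Finset (Fin n → ℝ)} (hF : F ∈ 𝓕)
    (hx : x ∈ F) (hx' : x' ∈ F) : x + x' ∉ W := by
  obtain ⟨u, hu1, hu2⟩ := h.supporting F hF
  intro hw
  by_cases hwF : x + x' ∈ F
  · have := hu1 _ hwF
    rw [map_add, hu1 x hx, hu1 x' hx'] at this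
    norm_num at this
  · have := hu2 _ hw hwF
    rw [map_add, hu1 x hx, hu1 x' hx'] at this
    norm_num at this

theorem le_zero_of_notMem (h : FanData W 𝓕) {x : Fin n → ℝ} {F : Finset (Fin n → ℝ)} (hF : F ∈ 𝓕)
    (hx : x ∈ W) (hxF : x ∉ F) {u : Module.Dual ℝ (Fin n → ℝ)} (hu1 : ∀ w ∈ F, u w = 1)
    (hu2 : ∀ w ∈ W, w ∉ F → u w < 1) : u x ≤ 0 := by
  obtain ⟨m, hm⟩ := exists_int_eq_of_isUnimodularBasis (h.unimodular F hF) hu1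
    (h.isLatticePoint hx)
  have := hu2 x hx hxF
  rw [hm] at this ⊢
  have h2 : m < 1 := by exact_mod_cast this
  exact_mod_cast (show m ≤ 0 by omega)

open Classical in
theorem exists_supporting_insert {x x' : Fin n → ℝ} (hne : x ≠ x')
    (hc : ∀ F ∈ 𝓕, x' ∈ F → ∃ g : Module.Dual ℝ (Fin n → ℝ),
      (∀ w ∈ F, g w + (if w = x then 1 else 0) = 1) ∧
      ∀ w ∈ W, w ∉ F → g w + (if w = x then 1 else 0) < 1)
    {F : Finset (Fin n → ℝ)} (hF : F ∈ 𝓕) (hx : x ∈ F) (hx' : x' ∈ F) :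
    ∃ g : Module.Dual ℝ (Fin n → ℝ), (∀ w ∈ insert (x + x') (F.erase x), g w = 1) ∧
      ∀ w ∈ insert (x + x') W, w ∉ insert (x + x') (F.erase x) → g w < 1 := by
  obtain ⟨g, hg1, hg2⟩ := hc F hF hx'
  have hgx : g x = 0 := by simpa using hg1 x hx
  have hgx' : g x' = 1 := by simpa [hne.symm] using hg1 x' hx'
  refine ⟨g, fun w hw => ?_, fun w hw hwF => ?_⟩
  · rcases Finset.mem_insert.1 hw with rfl | hw
    · rw [map_add, hgx, hgx', zero_add]
    · simpa [Finset.ne_of_mem_erase hw] using hg1 w (Finset.mem_of_mem_erase hw)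
  · rw [Finset.mem_insert, not_or, Finset.mem_erase, not_and] at hwF
    have hwW := (Finset.mem_insert.1 hw).resolve_left hwF.1
    by_cases hwx : w = x
    · rw [hwx, hgx]; norm_num
    · simpa [hwx] using hg2 w hwW (hwF.2 hwx)

open Classical in
theorem exists_cover_insert {x x' : Fin n → ℝ} {F : Finset (Fin n → ℝ)} (hx : x ∈ F)
    (hx' : x' ∈ F) (hne : x ≠ x') (hw : x + x' ∉ F) {c : (Fin n → ℝ) → ℝ}
    (hc : ∀ w ∈ F, 0 ≤ c w) (hle : c x ≤ c x') :
    ∃ d : (Fin n → ℝ) → ℝ, (∀ w ∈ insert (x + x') (F.erase x), 0 ≤ d w) ∧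
      ∑ w ∈ insert (x + x') (F.erase x), d w • w = ∑ w ∈ F, c w • w := by
  refine ⟨_, fun w hww => ?_, sum_insert_add_erase hx hx' hne hw c⟩
  split_ifs with h1 h2
  · exact hc x hx
  · rw [h2]; linarith
  · exact hc w (Finset.mem_of_mem_erase ((Finset.mem_insert.1 hww).resolve_left h1))

open Classical in
theorem insert_add (h : FanData W 𝓕) {x x' : Fin n → ℝ} (hx : x ∈ W) (hx' : x' ∈ W)
    (hne : x ≠ x') (hFF : ∃ F ∈ 𝓕, x ∈ F ∧ x' ∈ F)
    (hc : ∀ F ∈ 𝓕, x' ∈ F → ∃ g : Module.Dual ℝ (Fin n → ℝ),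
      (∀ w ∈ F, g w + (if w = x then 1 else 0) = 1) ∧
      ∀ w ∈ W, w ∉ F → g w + (if w = x then 1 else 0) < 1)
    (hc' : ∀ F ∈ 𝓕, x ∈ F → ∃ g : Module.Dual ℝ (Fin n → ℝ),
      (∀ w ∈ F, g w + (if w = x' then 1 else 0) = 1) ∧
      ∀ w ∈ W, w ∉ F → g w + (if w = x' then 1 else 0) < 1) :
    FanData (insert (x + x') W) (starFacets 𝓕 x x') := by
  have hwW : x + x' ∉ W := by
    obtain ⟨F, hF, hxF, hx'F⟩ := hFF
    exact h.add_notMem hF hxF hx'F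
  refine ⟨?_, ?_, ?_, ?_, ?_⟩
  · rintro G (⟨hG, -⟩ | ⟨F, hF, -, -, rfl | rfl⟩)
    · exact (h.subset G hG).trans (Finset.subset_insert _ _)
    all_goals
      exact Finset.insert_subset_insert _ ((Finset.erase_subset _ _).trans (h.subset F hF))
  · rintro G (⟨hG, -⟩ | ⟨F, hF, hxF, hx'F, rfl | rfl⟩)
    · exact h.unimodular G hG
    · exact isUnimodularBasis_insert_add_erase (h.unimodular F hF) hxF hx'F hne
        (fun hw => hwW (h.subset F hF hw))
    · rw [add_comm x x']
      exact isUnimodularBasis_insert_add_erase (h.unimodular F hF) hx'F hxF hne.symm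
        (fun hw => hwW (h.subset F hF (add_comm x x' ▸ hw)))
  · rintro G (⟨hG, hnot⟩ | ⟨F, hF, hxF, hx'F, rfl | rfl⟩)
    · obtain ⟨u, hu1, hu2⟩ := h.supporting G hG
      refine ⟨u, hu1, fun w hw hwG => ?_⟩
      rcases Finset.mem_insert.1 hw with rfl | hw
      · have key : ∀ g : Module.Dual ℝ (Fin n → ℝ), (∀ w ∈ G, g w = 1) → ∀ p, g p = u p :=
          fun g hg p => by
            have : g = u := LinearMap.ext_on (mem_span_of_isUnimodularBasis (h.unimodular G hG))
              fun w hw => by rw [hg w hw, hu1 w hw]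
            rw [this]
        rw [map_add]
        by_cases hxG : x ∈ G
        · have hx'G : x' ∉ G := fun h => hnot ⟨hxG, h⟩
          obtain ⟨g, hg1, hg2⟩ := hc' G hG hxG
          have h1 := hg2 x' hx' hx'G
          rw [if_pos rfl, key g (fun w hw => by
            simpa [show w ≠ x' from fun e => hx'G (e ▸ hw)] using hg1 w hw)] at h1
          rw [hu1 x hxG]; linarith
        · by_cases hx'G : x' ∈ G
          · obtain ⟨g, hg1, hg2⟩ := hc G hG hx'G
            have h1 := hg2 x hx hxG
            rw [if_pos rfl, key g (fun w hw => by
              simpa [show w ≠ x from fun e => hxG (e ▸ hw)] using hg1 w hw)] at h1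
            rw [hu1 x' hx'G]; linarith
          · have h1 := h.le_zero_of_notMem hG hx hxG hu1 hu2
            have h2 := h.le_zero_of_notMem hG hx' hx'G hu1 hu2
            linarith
      · exact hu2 w hw hwG
    · exact exists_supporting_insert hne hc hF hxF hx'F
    · rw [add_comm x x']
      exact exists_supporting_insert hne.symm hc' hF hx'F hxF
  · intro p
    obtain ⟨F, hF, c, hc0, rfl⟩ := h.cover p
    by_cases hb : x ∈ F ∧ x' ∈ F
    · obtain ⟨hxF, hx'F⟩ := hb
      have hwF : x + x' ∉ F := fun hw => hwW (h.subset F hF hw)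
      rcases le_total (c x) (c x') with hle | hle
      · exact ⟨_, Or.inr ⟨F, hF, hxF, hx'F, Or.inl rfl⟩,
          exists_cover_insert hxF hx'F hne hwF hc0 hle⟩
      · refine ⟨_, Or.inr ⟨F, hF, hxF, hx'F, Or.inr rfl⟩, ?_⟩
        rw [add_comm x x'] at hwF ⊢
        exact exists_cover_insert hx'F hxF hne.symm hwF hc0 hle
    · exact ⟨F, Or.inl ⟨hF, hb⟩, c, hc0, rfl⟩
  · intro v hv
    rcases Finset.mem_insert.1 hv with rfl | hv
    · obtain ⟨F, hF, hxF, hx'F⟩ := hFF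
      exact ⟨_, Or.inr ⟨F, hF, hxF, hx'F, Or.inl rfl⟩, Finset.mem_insert_self _ _⟩
    · obtain ⟨F, hF, hvF⟩ := h.exists_mem v hv
      by_cases hb : x ∈ F ∧ x' ∈ F
      · by_cases hvx : v = x
        · exact ⟨_, Or.inr ⟨F, hF, hb.1, hb.2, Or.inr rfl⟩,
            Finset.mem_insert_of_mem (Finset.mem_erase.2 ⟨hvx ▸ hne, hvF⟩)⟩
        · exact ⟨_, Or.inr ⟨F, hF, hb.1, hb.2, Or.inl rfl⟩,
            Finset.mem_insert_of_mem (Finset.mem_erase.2 ⟨hvx, hvF⟩)⟩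
      · exact ⟨F, Or.inl ⟨hF, hb⟩, hvF⟩

open Classical in
theorem fStep_of_starFacets (hn : 2 ≤ n) (h : FanData W 𝓕) {x x' : Fin n → ℝ}
    (hne : x ≠ x') (hFF : ∃ F ∈ 𝓕, x ∈ F ∧ x' ∈ F)
    (h' : FanData (insert (x + x') W) (starFacets 𝓕 x x')) :
    FStep (convexHull ℝ (W : Set (Fin n → ℝ)))
      (convexHull ℝ ((insert (x + x') W : Finset (Fin n → ℝ)) : Set (Fin n → ℝ))) := by
  obtain ⟨F, hF, hxF, hx'F⟩ := hFF
  have hwW := h.add_notMem hF hxF hx'F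
  have hx := h.subset F hF hxF
  have hx' := h.subset F hF hx'F
  have hpair : ({x, x'} : Finset (Fin n → ℝ)) ⊆ F := by
    intro v hv
    rcases Finset.mem_insert.1 hv with rfl | hv
    · exact hxF
    · rwa [Finset.mem_singleton.1 hv]
  have hpW := hpair.trans (h.subset F hF)
  refine Or.inl ⟨x + x', (h.isLatticePoint hx).add (h.isLatticePoint hx'), ?_, ?_,
    convexHull ℝ (({x, x'} : Finset (Fin n → ℝ)) : Set (Fin n → ℝ)),
    h.isFaceOf_of_subset hF hpair, ?_, ?_, ?_, ?_⟩
  · rw [h.vertexSet_eq]; exact_mod_cast hwW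
  · rw [h.vertexSet_eq, h'.vertexSet_eq, Finset.coe_insert, Set.union_singleton]
  · rw [convexHull_nonempty_iff]
    simp
  · intro he
    have h0 := h.zero_mem_convexHull (h.nonempty (by omega))
    rw [← he] at h0
    obtain ⟨u, hu, -⟩ := h.supporting F hF
    have := le_of_mem_convexHull (-u) (r := -1) (fun w hw => by simp [hu w (hpair hw)]) h0
    simp at this
    linarith
  · rw [h.vertexSet_inter_convexHull hpW, finsum_mem_coe_finset, Finset.sum_pair hne]
  · ext G
    simp only [Set.mem_ofPred_eq]
    constructor
    · rintro ⟨hG, hwG⟩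
      obtain ⟨G', hG', rfl⟩ := (h'.isFacetOf_iff hn).1 hG
      have hwG' : x + x' ∈ G' := h'.mem_of_mem_convexHull (by exact_mod_cast h'.subset G' hG')
        (Finset.mem_insert_self _ _) hwG
      rcases hG' with ⟨hG', -⟩ | ⟨F', hF', h1, h2, h3⟩
      · exact absurd (h.subset G' hG' hwG') hwW
      · have hsub : ({x, x'} : Finset (Fin n → ℝ)) ⊆ F' := by
          intro v hv
          rcases Finset.mem_insert.1 hv with rfl | hv
          · exact h1
          · rwa [Finset.mem_singleton.1 hv]
        refine ⟨convexHull ℝ (F' : Set (Fin n → ℝ)), if G' = insert (x + x') (F'.erase x) then x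
          else x', h.isFacetOf (by omega) hF', convexHull_mono (by exact_mod_cast hsub), ?_, ?_⟩
        · rw [h.vertexSet_inter_convexHull hpW]
          split_ifs <;> simp
        · rw [h.vertexSet_inter_convexHull (h.subset F' hF')]
          split_ifs with hif
          · rw [hif]; simp
          · rw [h3.resolve_left hif]; simp
    · rintro ⟨F', v, hF', hsub, hv, rfl⟩
      obtain ⟨F', hF'', rfl⟩ := (h.isFacetOf_iff hn).1 hF'
      rw [h.vertexSet_inter_convexHull hpW] at hv
      rw [h.vertexSet_inter_convexHull (h.subset F' hF'')]
      rw [h.convexHull_subset_iff hpW (h.subset F' hF'')] at hsub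
      have hx1 : x ∈ F' := hsub (by simp)
      have hx2 : x' ∈ F' := hsub (by simp)
      have heq : insert (x + x') ((F' : Set (Fin n → ℝ)) \ {v}) =
          ((insert (x + x') (F'.erase v) : Finset (Fin n → ℝ)) : Set (Fin n → ℝ)) := by simp
      rw [heq]
      refine ⟨(h'.isFacetOf_iff hn).2 ⟨_, Or.inr ⟨F', hF'', hx1, hx2, ?_⟩, rfl⟩,
        subset_convexHull ℝ _ (by simp)⟩
      have : v = x ∨ v = x' := by simpa using hv
      rcases this with rfl | rfl
      · exact Or.inl rfl
      · exact Or.inr rfl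

end FanData

theorem UnimodularEquiv.ncard_vertexSet {n : ℕ} {Q P : Set (Fin n → ℝ)}
    (h : UnimodularEquiv Q P) : (vertexSet Q).ncard = (vertexSet P).ncard := by
  obtain ⟨φ, hl, rfl⟩ := h
  have hlat : ∀ x, IsLatticePoint x → ∃ a, φ a = x := fun x hx => by
    have : x ∈ φ '' {x | IsLatticePoint x} := by rw [hl]; exact hx
    obtain ⟨a, -, ha⟩ := this
    exact ⟨a, ha⟩
  have hsurj : Function.Surjective φ.linear := by
    rw [← LinearMap.range_eq_top, eq_top_iff, ← (Pi.basisFun ℝ (Fin n)).span_eq,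
      Submodule.span_le]
    rintro _ ⟨j, rfl⟩
    obtain ⟨a, ha⟩ := hlat (Pi.basisFun ℝ (Fin n) j) fun i => by
      by_cases hij : i = j
      · exact ⟨1, by simp [hij]⟩
      · exact ⟨0, by simp [hij]⟩
    obtain ⟨b, hb⟩ := hlat 0 fun i => ⟨0, by simp⟩
    refine ⟨a - b, ?_⟩
    rw [← vsub_eq_sub, AffineMap.linearMap_vsub, ha, hb, vsub_eq_sub, sub_zero]
  have hinj : Function.Injective φ := by
    rw [← AffineMap.linear_injective_iff]
    exact LinearMap.injective_iff_surjective.2 hsurj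
  have : vertexSet (φ '' Q) = φ '' vertexSet Q := by
    ext y
    constructor
    · rintro ⟨⟨x, hx, rfl⟩, hy⟩
      refine ⟨x, ⟨hx, fun a ha b hb hab => hinj (hy ⟨a, ha, rfl⟩ ⟨b, hb, rfl⟩ ?_)⟩, rfl⟩
      rw [← image_openSegment]
      exact ⟨x, hab, rfl⟩
    · rintro ⟨x, hx, rfl⟩
      refine ⟨⟨x, hx.1, rfl⟩, ?_⟩
      rintro _ ⟨a, ha, rfl⟩ _ ⟨b, hb, rfl⟩ hab
      rw [← image_openSegment] at hab
      obtain ⟨x', hx', he⟩ := hab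
      rw [hx.2 ha hb (hinj he ▸ hx')]
  rw [this, Set.ncard_image_of_injective _ hinj]

theorem UnimodularEquiv.refl {n : ℕ} (P : Set (Fin n → ℝ)) : UnimodularEquiv P P :=
  ⟨AffineMap.id ℝ _, by simp, by simp⟩

theorem FStep.symm {n : ℕ} {P Q : Set (Fin n → ℝ)} (h : FStep P Q) : FStep Q P := Or.symm h

theorem FIsolated.ncard_eq_of_fStep {n : ℕ} {P Q : Set (Fin n → ℝ)} (h : FIsolated P)
    (hP : IsSmoothFano P) (hQ : IsSmoothFano Q) (hs : FStep Q P) :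
    (vertexSet Q).ncard = (vertexSet P).ncard := by
  refine (h Q hQ ⟨1, ![Q, P], ?_, UnimodularEquiv.refl Q, UnimodularEquiv.refl P, ?_⟩).ncard_vertexSet
  · intro i
    fin_cases i
    · exact hQ
    · exact hP
  · intro i
    fin_cases i
    exact hs

namespace FanData

variable {n : ℕ} {W : Finset (Fin n → ℝ)} {𝓕 : Set (Finset (Fin n → ℝ))}

open Classical in
theorem not_fIsolated_of_insert (hn : 2 ≤ n) (h : FanData W 𝓕) {x x' : Fin n → ℝ}
    (hne : x ≠ x') (hFF : ∃ F ∈ 𝓕, x ∈ F ∧ x' ∈ F)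
    (hc : ∀ F ∈ 𝓕, x' ∈ F → ∃ g : Module.Dual ℝ (Fin n → ℝ),
      (∀ w ∈ F, g w + (if w = x then 1 else 0) = 1) ∧
      ∀ w ∈ W, w ∉ F → g w + (if w = x then 1 else 0) < 1)
    (hc' : ∀ F ∈ 𝓕, x ∈ F → ∃ g : Module.Dual ℝ (Fin n → ℝ),
      (∀ w ∈ F, g w + (if w = x' then 1 else 0) = 1) ∧
      ∀ w ∈ W, w ∉ F → g w + (if w = x' then 1 else 0) < 1) :
    ¬ FIsolated (convexHull ℝ (W : Set (Fin n → ℝ))) := by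
  intro hiso
  obtain ⟨F, hF, hx, hx'⟩ := id hFF
  have h' := h.insert_add (h.subset F hF hx) (h.subset F hF hx') hne hFF hc hc'
  have := hiso.ncard_eq_of_fStep (h.isSmoothFano hn) (h'.isSmoothFano hn)
    (h.fStep_of_starFacets hn hne hFF h').symm
  rw [h.vertexSet_eq, h'.vertexSet_eq, Set.ncard_coe_finset, Set.ncard_coe_finset,
    Finset.card_insert_of_notMem (h.add_notMem hF hx hx')] at this
  omega

end FanData

open Classical in
theorem sum_insert_erase_add {n : ℕ} {F : Finset (Fin n → ℝ)}
    {y z : Fin n → ℝ} (hu : y + z ∈ F) (hy : y ∈ F) (hz : z ∉ F) (hne : y + z ≠ y)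
    (c : (Fin n → ℝ) → ℝ) :
    ∑ v ∈ insert z (F.erase (y + z)),
      (if v = z then c (y + z) else if v = y then c v + c (y + z) else c v) • v =
      ∑ v ∈ F, c v • v := by
  have hz' : z ∉ F.erase (y + z) := fun h => hz (Finset.mem_of_mem_erase h)
  have hye : y ∈ F.erase (y + z) := Finset.mem_erase.2 ⟨hne.symm, hy⟩
  rw [Finset.sum_insert hz', if_pos rfl, ← Finset.add_sum_erase F _ hu,
    ← Finset.add_sum_erase (F.erase (y + z)) (fun v => c v • v) hye,
    ← Finset.add_sum_erase (F.erase (y + z)) _ hye,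
    if_neg (fun h : y = z => hz (h ▸ hy)), if_pos rfl]
  have : ∀ v ∈ (F.erase (y + z)).erase y,
      (if v = z then c (y + z) else if v = y then c v + c (y + z) else c v) • v = c v • v :=
    fun v hv => by
    have hvz : v ≠ z := by
      rintro rfl
      exact hz' (Finset.mem_of_mem_erase hv)
    rw [if_neg hvz,
      if_neg (Finset.ne_of_mem_erase hv)]
  rw [Finset.sum_congr rfl this]
  module

open Classical in
theorem isUnimodularBasis_insert_erase_add {n : ℕ} {F : Finset (Fin n → ℝ)}
    (hF : IsUnimodularBasis (F : Set (Fin n → ℝ))) {y z : Fin n → ℝ} (hu : y + z ∈ F) (hy : y ∈ F)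
    (hz : z ∉ F) (hzl : IsLatticePoint z) (hne : y + z ≠ y) :
    IsUnimodularBasis ((insert z (F.erase (y + z)) : Finset (Fin n → ℝ)) : Set (Fin n → ℝ)) := by
  rw [isUnimodularBasis_iff] at hF ⊢
  obtain ⟨h1, h2, h3⟩ := hF
  refine ⟨?_, ?_, fun p hp => ?_⟩
  · rw [Finset.card_insert_of_notMem (fun h => hz (Finset.mem_of_mem_erase h)),
      Finset.card_erase_of_mem hu, h1]
    have := Finset.card_pos.2 ⟨y, hy⟩
    omega
  · intro v hv
    rcases Finset.mem_insert.1 hv with rfl | hv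
    · exact hzl
    · exact h2 v (Finset.mem_of_mem_erase hv)
  · obtain ⟨c, hc⟩ := h3 p hp
    refine ⟨fun v => if v = z then c (y + z) else if v = y then c v + c (y + z) else c v, ?_⟩
    rw [← hc, ← sum_insert_erase_add hu hy hz hne (fun v => (c v : ℝ))]
    refine Finset.sum_congr rfl fun v _ => ?_
    congr 1
    by_cases e1 : v = z <;> by_cases e2 : v = y <;> simp [e1, e2]

namespace FanData

variable {n : ℕ} {W : Finset (Fin n → ℝ)} {𝓕 : Set (Finset (Fin n → ℝ))}

theorem zero_notMem (h : FanData W 𝓕) : (0 : Fin n → ℝ) ∉ W := fun h0 => by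
  obtain ⟨F, hF, h0F⟩ := h.exists_mem 0 h0
  obtain ⟨u, hu, -⟩ := h.supporting F hF
  have := hu 0 h0F
  rw [map_zero] at this
  exact zero_ne_one this

open Classical in
/-- The facets obtained by contracting the vertex `y + z`, the inverse of `starFacets`. -/
def contractFacets (𝓕 : Set (Finset (Fin n → ℝ))) (y z : Fin n → ℝ) :
    Set (Finset (Fin n → ℝ)) :=
  {G | (G ∈ 𝓕 ∧ y + z ∉ G) ∨
    ∃ F ∈ 𝓕, y + z ∈ F ∧ G = insert y (insert z (F.erase (y + z)))}

open Classical in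
theorem erase_add (h : FanData W 𝓕) {y z : Fin n → ℝ} (hy : y ∈ W) (hz : z ∈ W)
    (h1 : ∀ F ∈ 𝓕, y + z ∈ F → y ∈ F ∧ z ∉ F ∨ z ∈ F ∧ y ∉ F)
    (h4 : ∀ F ∈ 𝓕, y + z ∈ F → ∃ g : Module.Dual ℝ (Fin n → ℝ),
      (∀ w ∈ insert y (insert z (F.erase (y + z))), g w = 1) ∧
      ∀ w ∈ W, w ≠ y + z → w ∉ insert y (insert z (F.erase (y + z))) → g w < 1) :
    FanData (W.erase (y + z)) (contractFacets 𝓕 y z) := by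
  have hy0 : y ≠ 0 := fun e => h.zero_notMem (e ▸ hy)
  have hz0 : z ≠ 0 := fun e => h.zero_notMem (e ▸ hz)
  have hney : y + z ≠ y := fun e => hz0 (by simpa using e)
  have hnez : y + z ≠ z := fun e => hy0 (by simpa using e)
  have hform : ∀ F ∈ 𝓕, y + z ∈ F →
      (y ∈ F ∧ z ∉ F ∧ insert y (insert z (F.erase (y + z))) = insert z (F.erase (y + z))) ∨
      (z ∈ F ∧ y ∉ F ∧ insert y (insert z (F.erase (y + z))) = insert y (F.erase (y + z))) := by
    intro F hF hu
    rcases h1 F hF hu with ⟨ha, hb⟩ | ⟨ha, hb⟩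
    · exact Or.inl ⟨ha, hb, Finset.insert_eq_of_mem (Finset.mem_insert_of_mem
        (Finset.mem_erase.2 ⟨hney.symm, ha⟩))⟩
    · refine Or.inr ⟨ha, hb, ?_⟩
      rw [Finset.insert_eq_of_mem (Finset.mem_erase.2 ⟨hnez.symm, ha⟩)]
  refine ⟨?_, ?_, ?_, ?_, ?_⟩
  · rintro G (⟨hG, hu⟩ | ⟨F, hF, hu, rfl⟩)
    · intro v hv
      exact Finset.mem_erase.2 ⟨fun e => hu (e ▸ hv), h.subset G hG hv⟩
    · intro v hv
      simp only [Finset.mem_insert] at hv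
      rcases hv with rfl | rfl | hv
      · exact Finset.mem_erase.2 ⟨hney.symm, hy⟩
      · exact Finset.mem_erase.2 ⟨hnez.symm, hz⟩
      · exact Finset.erase_subset_erase _ (h.subset F hF) hv
  · rintro G (⟨hG, hu⟩ | ⟨F, hF, hu, rfl⟩)
    · exact h.unimodular G hG
    · rcases hform F hF hu with ⟨ha, hb, e⟩ | ⟨ha, hb, e⟩
      · rw [e]
        exact isUnimodularBasis_insert_erase_add (h.unimodular F hF) hu ha hb
          (h.isLatticePoint hz) hney
      · rw [e]
        rw [add_comm y z] at hu hnez ⊢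
        exact isUnimodularBasis_insert_erase_add (h.unimodular F hF) hu ha hb
          (h.isLatticePoint hy) hnez
  · rintro G (⟨hG, hu⟩ | ⟨F, hF, hu, rfl⟩)
    · obtain ⟨g, hg1, hg2⟩ := h.supporting G hG
      exact ⟨g, hg1, fun w hw => hg2 w (Finset.mem_of_mem_erase hw)⟩
    · obtain ⟨g, hg1, hg2⟩ := h4 F hF hu
      exact ⟨g, hg1, fun w hw => hg2 w (Finset.mem_of_mem_erase hw) (Finset.ne_of_mem_erase hw)⟩
  · intro p
    obtain ⟨F, hF, c, hc, rfl⟩ := h.cover p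
    by_cases hu : y + z ∈ F
    · refine ⟨_, Or.inr ⟨F, hF, hu, rfl⟩, ?_⟩
      rcases hform F hF hu with ⟨ha, hb, e⟩ | ⟨ha, hb, e⟩
      · rw [e]
        refine ⟨_, fun w hw => ?_, sum_insert_erase_add hu ha hb hney c⟩
        split_ifs with e1 e2
        · exact hc _ hu
        · rw [e2]; exact add_nonneg (hc _ ha) (hc _ hu)
        · exact hc w (Finset.mem_of_mem_erase ((Finset.mem_insert.1 hw).resolve_left e1))
      · rw [e]
        rw [add_comm y z] at hu hnez ⊢
        refine ⟨_, fun w hw => ?_, sum_insert_erase_add hu ha hb hnez c⟩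
        split_ifs with e1 e2
        · exact hc _ hu
        · rw [e2]; exact add_nonneg (hc _ ha) (hc _ hu)
        · exact hc w (Finset.mem_of_mem_erase ((Finset.mem_insert.1 hw).resolve_left e1))
    · exact ⟨F, Or.inl ⟨hF, hu⟩, c, hc, rfl⟩
  · intro v hv
    obtain ⟨F, hF, hvF⟩ := h.exists_mem v (Finset.mem_of_mem_erase hv)
    by_cases hu : y + z ∈ F
    · exact ⟨_, Or.inr ⟨F, hF, hu, rfl⟩, by
        simp [Finset.ne_of_mem_erase hv, hvF]⟩
    · exact ⟨F, Or.inl ⟨hF, hu⟩, hvF⟩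

open Classical in
theorem not_fIsolated_of_erase (hn : 2 ≤ n) (h : FanData W 𝓕) {y z : Fin n → ℝ} (hy : y ∈ W)
    (hz : z ∈ W) (hyz : y ≠ z) (hu : y + z ∈ W)
    (h1 : ∀ F ∈ 𝓕, y + z ∈ F → y ∈ F ∧ z ∉ F ∨ z ∈ F ∧ y ∉ F)
    (h2 : ∀ F ∈ 𝓕, y + z ∈ F → y ∈ F → insert z (F.erase y) ∈ 𝓕)
    (h2' : ∀ F ∈ 𝓕, y + z ∈ F → z ∈ F → insert y (F.erase z) ∈ 𝓕)
    (h3 : ∀ F ∈ 𝓕, y + z ∉ F → ¬(y ∈ F ∧ z ∈ F))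
    (h4 : ∀ F ∈ 𝓕, y + z ∈ F → ∃ g : Module.Dual ℝ (Fin n → ℝ),
      (∀ w ∈ insert y (insert z (F.erase (y + z))), g w = 1) ∧
      ∀ w ∈ W, w ≠ y + z → w ∉ insert y (insert z (F.erase (y + z))) → g w < 1) :
    ¬ FIsolated (convexHull ℝ (W : Set (Fin n → ℝ))) := by
  intro hiso
  have hQ := h.erase_add hy hz h1 h4
  have hy0 : y ≠ 0 := fun e => h.zero_notMem (e ▸ hy)
  have hz0 : z ≠ 0 := fun e => h.zero_notMem (e ▸ hz)
  have hney : y + z ≠ y := fun e => hz0 (by simpa using e)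
  have hnez : y + z ≠ z := fun e => hy0 (by simpa using e)
  have hstar : starFacets (contractFacets 𝓕 y z) y z = 𝓕 := by
    ext G
    constructor
    · rintro (⟨⟨hG, -⟩ | ⟨F, hF, hu, rfl⟩, hnot⟩ | ⟨G', ⟨hG', hu'⟩ | ⟨F, hF, hu, rfl⟩, hyG, hzG, hG⟩)
      · exact hG
      · exact absurd ⟨by simp, by simp⟩ hnot
      · exact absurd ⟨hyG, hzG⟩ (h3 G' hG' hu')
      · rcases h1 F hF hu with ⟨ha, hb⟩ | ⟨ha, hb⟩
        · have e1 := h2 F hF hu ha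
          rcases hG with rfl | rfl
          · convert e1 using 1
            ext v; simp only [Finset.mem_insert, Finset.mem_erase]
            grind
          · convert hF using 1
            ext v; simp only [Finset.mem_insert, Finset.mem_erase]
            grind
        · have e1 := h2' F hF hu ha
          rcases hG with rfl | rfl
          · convert hF using 1
            ext v; simp only [Finset.mem_insert, Finset.mem_erase]
            grind
          · convert e1 using 1
            ext v; simp only [Finset.mem_insert, Finset.mem_erase]
            grind
    · intro hG
      by_cases hu : y + z ∈ G
      · refine Or.inr ⟨_, Or.inr ⟨G, hG, hu, rfl⟩, by simp, by simp, ?_⟩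
        rcases h1 G hG hu with ⟨ha, hb⟩ | ⟨ha, hb⟩
        · right
          ext v; simp only [Finset.mem_insert, Finset.mem_erase]
          grind
        · left
          ext v; simp only [Finset.mem_insert, Finset.mem_erase]
          grind
      · exact Or.inl ⟨Or.inl ⟨hG, hu⟩, h3 G hG hu⟩
  have hFF : ∃ F ∈ contractFacets 𝓕 y z, y ∈ F ∧ z ∈ F := by
    obtain ⟨F, hF, huF⟩ := h.exists_mem _ hu
    exact ⟨_, Or.inr ⟨F, hF, huF, rfl⟩, by simp, by simp⟩
  have hs := hQ.fStep_of_starFacets hn hyz hFF (by rwa [hstar, Finset.insert_erase hu])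
  rw [Finset.insert_erase hu] at hs
  have := hiso.ncard_eq_of_fStep (h.isSmoothFano hn) (hQ.isSmoothFano hn) hs
  rw [h.vertexSet_eq, hQ.vertexSet_eq, Set.ncard_coe_finset, Set.ncard_coe_finset,
    Finset.card_erase_of_mem hu] at this
  have := Finset.card_pos.2 ⟨_, hu⟩
  omega

end FanData

theorem IsLatticePoint.sum {n : ℕ} {S : Finset (Fin n → ℝ)} (hS : ∀ w ∈ S, IsLatticePoint w) :
    IsLatticePoint (∑ w ∈ S, w) := by
  classical
  induction S using Finset.induction_on with
  | empty => exact fun i => ⟨0, by simp⟩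
  | insert a s ha ih =>
    rw [Finset.sum_insert ha]
    exact (hS a (Finset.mem_insert_self _ _)).add
      (ih fun w hw => hS w (Finset.mem_insert_of_mem hw))

theorem IsLatticePoint.neg {n : ℕ} {x : Fin n → ℝ} (hx : IsLatticePoint x) :
    IsLatticePoint (-x) := fun i => by
  obtain ⟨a, ha⟩ := hx i
  exact ⟨-a, by simp [ha]⟩

namespace FanData

variable {n : ℕ} {W : Finset (Fin n → ℝ)} {𝓕 : Set (Finset (Fin n → ℝ))}

theorem exists_nat_cover (h : FanData W 𝓕) {p : Fin n → ℝ} (hp : IsLatticePoint p) :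
    ∃ F ∈ 𝓕, ∃ a : (Fin n → ℝ) → ℕ, (∀ w, w ∉ F → a w = 0) ∧ ∑ w ∈ W, (a w : ℝ) • w = p := by
  classical
  obtain ⟨F, hF, c, hc, hcp⟩ := h.cover p
  obtain ⟨d, hd⟩ := ((isUnimodularBasis_iff F).1 (h.unimodular F hF)).2.2 p hp
  have heq := sum_smul_inj_of_isUnimodularBasis (h.unimodular F hF) (hcp.trans hd.symm)
  refine ⟨F, hF, fun w => if w ∈ F then (d w).toNat else 0, fun w hw => if_neg hw, ?_⟩
  rw [← hd, ← Finset.sum_subset (h.subset F hF)]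
  · refine Finset.sum_congr rfl fun w hw => ?_
    simp only [if_pos hw]
    have h0 : 0 ≤ d w := by
      have := hc w hw
      rw [heq w hw] at this
      exact_mod_cast this
    congr 1
    exact_mod_cast Int.toNat_of_nonneg h0
  · intro w _ hw
    simp [hw]

theorem exists_nat_cover_sum (h : FanData W 𝓕) {S : Finset (Fin n → ℝ)} (hS : S ⊆ W)
    (hSF : ∀ F ∈ 𝓕, ¬ S ⊆ F) :
    ∃ a : (Fin n → ℝ) → ℕ, ∑ w ∈ W, (a w : ℝ) • w = ∑ w ∈ S, w ∧
      ∑ w ∈ W, a w < S.card := by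
  obtain ⟨F, hF, a, ha, hsum⟩ :=
    h.exists_nat_cover (IsLatticePoint.sum fun w hw => h.isLatticePoint (hS hw))
  refine ⟨a, hsum, ?_⟩
  obtain ⟨u, hu1, hu2⟩ := h.supporting F hF
  have e := congrArg u hsum
  simp only [map_sum, map_smul, smul_eq_mul] at e
  have e1 : ∑ w ∈ W, (a w : ℝ) * u w = ∑ w ∈ W, (a w : ℝ) := Finset.sum_congr rfl fun w hw => by
    by_cases hwF : w ∈ F
    · rw [hu1 w hwF, mul_one]
    · rw [ha w hwF]; simp
  obtain ⟨w₀, hw₀, hw₀F⟩ := Finset.not_subset.1 (hSF F hF)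
  have e2 : ∑ w ∈ S, u w < ∑ w ∈ S, (1 : ℝ) := by
    refine Finset.sum_lt_sum (fun v hv => ?_) ⟨w₀, hw₀, hu2 w₀ (hS hw₀) hw₀F⟩
    by_cases hvF : v ∈ F
    · exact (hu1 v hvF).le
    · exact (hu2 v (hS hv) hvF).le
  rw [← e, e1] at e2
  simp only [Finset.sum_const, nsmul_eq_mul, mul_one] at e2
  exact_mod_cast e2

/-- There is a set of vertices with sum zero all of whose proper subsets span faces. -/
theorem exists_sum_eq_zero (h : FanData W 𝓕) (hW : W.Nonempty) :
    ∃ A ⊆ W, A.Nonempty ∧ ∑ w ∈ A, w = 0 ∧ ∀ x ∈ A, ∃ F ∈ 𝓕, A.erase x ⊆ F := by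
  classical
  have hex : ∃ d : ℕ, ∃ c : (Fin n → ℝ) → ℕ, (∃ w ∈ W, c w ≠ 0) ∧
      ∑ w ∈ W, (c w : ℝ) • w = 0 ∧ ∑ w ∈ W, c w = d := by
    obtain ⟨F, hF, a, -, ha⟩ :=
      h.exists_nat_cover (IsLatticePoint.sum fun w hw => h.isLatticePoint (W := W) hw).neg
    obtain ⟨w₀, hw₀⟩ := hW
    refine ⟨_, fun w => a w + 1, ⟨w₀, hw₀, by simp⟩, ?_, rfl⟩
    simp only [Nat.cast_add, Nat.cast_one, add_smul, one_smul, Finset.sum_add_distrib]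
    rw [ha, neg_add_cancel]
  obtain ⟨c, hc0, hcs, hcd⟩ := Nat.find_spec hex
  have hmin : ∀ c' : (Fin n → ℝ) → ℕ, (∃ w ∈ W, c' w ≠ 0) → ∑ w ∈ W, (c' w : ℝ) • w = 0 →
      ∑ w ∈ W, c w ≤ ∑ w ∈ W, c' w := fun c' h1 h2 => by
    rw [hcd]; exact Nat.find_min' hex ⟨c', h1, h2, rfl⟩
  set A := W.filter (fun w => c w ≠ 0) with hA
  have hAW : A ⊆ W := Finset.filter_subset _ _
  have hAne : A.Nonempty := by
    obtain ⟨w, hw, hcw⟩ := hc0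
    exact ⟨w, Finset.mem_filter.2 ⟨hw, hcw⟩⟩
  have hAF : ∀ F ∈ 𝓕, ¬ A ⊆ F := by
    intro F hF hAF
    obtain ⟨u, hu1, -⟩ := h.supporting F hF
    have e := congrArg u hcs
    simp only [map_sum, map_smul, smul_eq_mul, map_zero] at e
    have e1 : ∑ w ∈ W, (c w : ℝ) * u w = ∑ w ∈ W, (c w : ℝ) :=
      Finset.sum_congr rfl fun w hw => by
        by_cases hwc : c w = 0
        · simp [hwc]
        · rw [hu1 w (hAF (Finset.mem_filter.2 ⟨hw, hwc⟩)), mul_one]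
    rw [e1, Finset.sum_eq_zero_iff_of_nonneg (fun _ _ => Nat.cast_nonneg _)] at e
    obtain ⟨w, hw, hcw⟩ := hc0
    exact hcw (by exact_mod_cast e w hw)
  obtain ⟨a, ha1, ha2⟩ := h.exists_nat_cover_sum hAW hAF
  have hind : ∀ f : (Fin n → ℝ) → Fin n → ℝ, ∑ w ∈ W, (if w ∈ A then (1 : ℝ) else 0) • f w =
      ∑ w ∈ A, f w := fun f => by
    simp only [ite_smul, one_smul, zero_smul, Finset.sum_ite_mem, Finset.inter_eq_right.2 hAW]
  have hone : ∀ w ∈ W, c w = if w ∈ A then 1 else 0 := by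
    by_contra hcon
    push Not at hcon
    obtain ⟨w₁, hw₁, hcw₁⟩ := hcon
    have hle : ∀ w ∈ W, (if w ∈ A then 1 else 0) ≤ c w := fun w hw => by
      split_ifs with hwA
      · exact Nat.one_le_iff_ne_zero.2 (Finset.mem_filter.1 hwA).2
      · exact Nat.zero_le _
    have hcast : ∀ w ∈ W, ((c w - (if w ∈ A then 1 else 0) + a w : ℕ) : ℝ) =
        c w - (if w ∈ A then (1 : ℝ) else 0) + a w := fun w hw => by
      rw [Nat.cast_add, Nat.cast_sub (hle w hw)]
      split_ifs <;> simp
    have := hmin (fun w => c w - (if w ∈ A then 1 else 0) + a w) ⟨w₁, hw₁, by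
        have := hle w₁ hw₁
        omega⟩ (by
      rw [Finset.sum_congr rfl (fun w hw => by rw [hcast w hw, add_smul, sub_smul]),
        Finset.sum_add_distrib, Finset.sum_sub_distrib, hcs, ha1, hind (fun w => w)]
      simp)
    have e2 : ∑ w ∈ W, (c w - (if w ∈ A then 1 else 0) + a w) + A.card =
        ∑ w ∈ W, c w + ∑ w ∈ W, a w := by
      have : A.card = ∑ w ∈ W, if w ∈ A then 1 else 0 := by
        rw [Finset.sum_ite_mem, Finset.inter_eq_right.2 hAW, Finset.card_eq_sum_ones]
      rw [this, ← Finset.sum_add_distrib, ← Finset.sum_add_distrib]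
      refine Finset.sum_congr rfl fun w hw => ?_
      have := hle w hw
      omega
    omega
  have hdeg : ∑ w ∈ W, c w = A.card := by
    rw [Finset.sum_congr rfl hone, Finset.sum_ite_mem, Finset.inter_eq_right.2 hAW,
      Finset.card_eq_sum_ones]
  refine ⟨A, hAW, hAne, ?_, fun x hx => ?_⟩
  · rw [← hind (fun w => w), ← hcs]
    refine Finset.sum_congr rfl fun w hw => ?_
    rw [hone w hw]
    split_ifs <;> simp
  · by_contra hcon
    push Not at hcon
    obtain ⟨b, hb1, hb2⟩ := h.exists_nat_cover_sum ((Finset.erase_subset x A).trans hAW) hcon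
    have hsumA : ∑ w ∈ A, w = 0 := by
      rw [← hind (fun w => w), ← hcs]
      refine Finset.sum_congr rfl fun w hw => ?_
      rw [hone w hw]
      split_ifs <;> simp
    have := hmin (fun w => (if w = x then 1 else 0) + b w) ⟨x, hAW hx, by simp⟩ (by
      simp only [Nat.cast_add, add_smul, Finset.sum_add_distrib, hb1, Nat.cast_ite, Nat.cast_one,
        Nat.cast_zero, ite_smul, one_smul, zero_smul]
      rw [Finset.sum_ite_eq' W x, if_pos (hAW hx), Finset.add_sum_erase A (fun w => w) hx, hsumA])
    rw [Finset.sum_add_distrib, Finset.sum_ite_eq' W x, if_pos (hAW hx), hdeg] at this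
    rw [Finset.card_erase_of_mem hx] at hb2
    omega

end FanData

/-- The complements in `W` of the members of `𝓕`. -/
def cofacets {n : ℕ} (W : Finset (Fin n → ℝ)) (𝓕 : Set (Finset (Fin n → ℝ))) :
    Set (Finset (Fin n → ℝ)) := {T | T ⊆ W ∧ W \ T ∈ 𝓕}

/-- The vector `(a, b, c)` is a combination with positive coefficients of the vectors
`(h w, X w, Y w)` for `w ∈ T`. -/
def PosComb {E : Type*} (T : Finset E) (h X Y : E → ℤ) (a b c : ℤ) : Prop :=
  ∃ m : E → ℝ, (∀ w ∈ T, 0 < m w) ∧ ∑ w ∈ T, m w * h w = a ∧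
    ∑ w ∈ T, m w * X w = b ∧ ∑ w ∈ T, m w * Y w = c

/-- Integral Gale transform `(h, X, Y)` of the vertex set `W`, where `h` is the indicator of a
primitive collection with sum zero and `𝓣` consists of the complements of the facets. -/
structure GaleData {n : ℕ} (W : Finset (Fin n → ℝ)) (𝓣 : Set (Finset (Fin n → ℝ)))
    (h X Y : (Fin n → ℝ) → ℤ) : Prop where
  subset : ∀ T ∈ 𝓣, T ⊆ W
  card : ∀ T ∈ 𝓣, T.card = 3
  pos : ∀ T ∈ 𝓣, PosComb T h X Y (∑ w ∈ W, h w) (∑ w ∈ W, X w) (∑ w ∈ W, Y w)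
  unim : ∀ T ∈ 𝓣, ∀ w₀ ∈ T, ∃ a b c : ℤ, a * h w₀ + b * X w₀ + c * Y w₀ = 1 ∧
    ∀ w ∈ T, w ≠ w₀ → a * h w + b * X w + c * Y w = 0
  of_pos : ∀ T ⊆ W, PosComb T h X Y (∑ w ∈ W, h w) (∑ w ∈ W, X w) (∑ w ∈ W, Y w) →
    ∃ T' ∈ 𝓣, T' ⊆ T
  pointed : ∃ a b c : ℝ, ∀ w ∈ W, 0 < a * h w + b * X w + c * Y w
  vert : ∀ w ∈ W, ∃ T ∈ 𝓣, w ∉ T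
  prim : ∀ x ∈ W, h x = 1 → ∃ T ∈ 𝓣, x ∈ T ∧ ∀ w ∈ T, h w = 1 → w = x
  h01 : ∀ w ∈ W, h w = 0 ∨ h w = 1
  nonempty : ∃ x ∈ W, h x = 1
  rel_h : ∑ w ∈ W, (h w : ℝ) • w = 0
  rel_X : ∑ w ∈ W, (X w : ℝ) • w = 0
  rel_Y : ∑ w ∈ W, (Y w : ℝ) • w = 0
  ext : ∀ f : (Fin n → ℝ) → ℝ, ∑ w ∈ W, f w * h w = 0 → ∑ w ∈ W, f w * X w = 0 →
    ∑ w ∈ W, f w * Y w = 0 → ∃ g : Module.Dual ℝ (Fin n → ℝ), ∀ w ∈ W, g w = f w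

namespace FanData

variable {n : ℕ} {W : Finset (Fin n → ℝ)} {𝓕 : Set (Finset (Fin n → ℝ))}

theorem sum_ne_zero (h : FanData W 𝓕) {A F : Finset (Fin n → ℝ)} (hF : F ∈ 𝓕) (hA : A ⊆ F)
    (hne : A.Nonempty) : ∑ w ∈ A, w ≠ 0 := fun h0 => by
  obtain ⟨u, hu, -⟩ := h.supporting F hF
  have e := congrArg u h0
  rw [map_sum, map_zero, Finset.sum_congr rfl (fun w hw => hu w (hA hw))] at e
  simp at e
  exact hne.ne_empty e

theorem exists_pos_relation (h : FanData W 𝓕) : ∃ c : (Fin n → ℝ) → ℝ, (∀ w ∈ W, 0 < c w) ∧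
    ∑ w ∈ W, c w • w = 0 := by
  obtain ⟨F, hF, c, hc, hx⟩ := h.cover (-∑ w ∈ W, w)
  refine ⟨fun w => 1 + if w ∈ F then c w else 0, fun w _ => ?_, ?_⟩
  · dsimp only
    split_ifs with hwF
    · linarith [hc w hwF]
    · norm_num
  · simp only [add_smul, one_smul, Finset.sum_add_distrib, ite_smul, zero_smul]
    rw [Finset.sum_ite_mem, Finset.inter_eq_right.2 (h.subset F hF), hx, add_neg_cancel]

/-- The integral relation expressing a vertex `q` through the vertices of a facet. -/
theorem exists_int_relation (h : FanData W 𝓕) {F : Finset (Fin n → ℝ)} (hF : F ∈ 𝓕)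
    {q : Fin n → ℝ} (hq : q ∈ W) (hqF : q ∉ F) : ∃ r : (Fin n → ℝ) → ℤ, r q = 1 ∧
      (∀ w, w ∉ F → w ≠ q → r w = 0) ∧ ∑ w ∈ W, (r w : ℝ) • w = 0 := by
  obtain ⟨c, hc⟩ := ((isUnimodularBasis_iff F).1 (h.unimodular F hF)).2.2 q (h.isLatticePoint hq)
  refine ⟨fun w => (if w = q then 1 else 0) - if w ∈ F then c w else 0, by simp [hqF],
    fun w hw hwq => by simp [hw, hwq], ?_⟩
  simp only [Int.cast_sub, sub_smul, Finset.sum_sub_distrib, Int.cast_ite, Int.cast_one,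
    Int.cast_zero, ite_smul, one_smul, zero_smul]
  rw [Finset.sum_ite_eq', if_pos hq, Finset.sum_ite_mem, Finset.inter_eq_right.2 (h.subset F hF),
    hc, sub_self]

theorem exists_galeData (h : FanData W 𝓕) (hcard : W.card = n + 3) :
    ∃ a X Y : (Fin n → ℝ) → ℤ, GaleData W (cofacets W 𝓕) a X Y := by
  obtain ⟨A, hAW, ⟨x, hxA⟩, hA0, hAF⟩ := h.exists_sum_eq_zero (Finset.card_pos.1 (by omega))
  have hAF' : ∀ y ∈ A, ∃ F ∈ 𝓕, A.erase y ⊆ F ∧ y ∉ F := fun y hy => by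
    obtain ⟨F, hF, hs⟩ := hAF y hy
    refine ⟨F, hF, hs, fun hyF => h.sum_ne_zero hF (A := A) (fun w hw => ?_) ⟨y, hy⟩ hA0⟩
    by_cases hwy : w = y
    · rwa [hwy]
    · exact hs (Finset.mem_erase.2 ⟨hwy, hw⟩)
  obtain ⟨F₀, hF₀, hAF₀, hxF₀⟩ := hAF' x hxA
  have hF₀W := h.subset F₀ hF₀
  have hT₀ : ((W \ F₀).erase x).card = 2 := by
    rw [Finset.card_erase_of_mem (Finset.mem_sdiff.2 ⟨hAW hxA, hxF₀⟩),
      Finset.card_sdiff_of_subset hF₀W, h.card_eq hF₀]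
    omega
  obtain ⟨q₁, q₂, hq, hqT⟩ := Finset.card_eq_two.1 hT₀
  have hmem : ∀ w, (w ≠ x ∧ w ∈ W ∧ w ∉ F₀) ↔ w = q₁ ∨ w = q₂ := fun w => by
    have : w ∈ (W \ F₀).erase x ↔ w ∈ ({q₁, q₂} : Finset _) := by rw [hqT]
    simpa using this
  obtain ⟨hq₁x, hq₁W, hq₁F⟩ := (hmem q₁).2 (Or.inl rfl)
  obtain ⟨hq₂x, hq₂W, hq₂F⟩ := (hmem q₂).2 (Or.inr rfl)
  have hout : ∀ w ∈ W, w ∉ F₀ → w = x ∨ w = q₁ ∨ w = q₂ := fun w hw hwF => by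
    by_cases hwx : w = x
    · exact Or.inl hwx
    · exact Or.inr ((hmem w).1 ⟨hwx, hw, hwF⟩)
  obtain ⟨X, hXq, hX0, hXr⟩ := h.exists_int_relation hF₀ hq₁W hq₁F
  obtain ⟨Y, hYq, hY0, hYr⟩ := h.exists_int_relation hF₀ hq₂W hq₂F
  set a : (Fin n → ℝ) → ℤ := fun w => if w ∈ A then 1 else 0 with ha
  have hax : a x = 1 := if_pos hxA
  have ha0 : ∀ w, w ∉ F₀ → w ≠ x → a w = 0 := fun w hw hwx =>
    if_neg fun hwA => hw (hAF₀ (Finset.mem_erase.2 ⟨hwx, hwA⟩))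
  have har : ∑ w ∈ W, (a w : ℝ) • w = 0 := by
    simp only [ha, Int.cast_ite, Int.cast_one, Int.cast_zero, ite_smul, one_smul, zero_smul]
    rw [Finset.sum_ite_mem, Finset.inter_eq_right.2 hAW, hA0]
  have key : ∀ r : (Fin n → ℝ) → ℝ, ∑ w ∈ W, r w • w = 0 →
      ∀ w ∈ W, r w = r x * a w + r q₁ * X w + r q₂ * Y w := by
    intro r hr
    set d : (Fin n → ℝ) → ℝ := fun w => r w - (r x * a w + r q₁ * X w + r q₂ * Y w) with hd
    have hd0 : ∀ w ∈ W, w ∉ F₀ → d w = 0 := fun w hw hwF => by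
      rcases hout w hw hwF with rfl | rfl | rfl
      · simp [hd, hax, hX0 w hwF hq₁x.symm, hY0 w hwF hq₂x.symm]
      · simp [hd, hXq, ha0 w hwF hq₁x, hY0 w hwF hq]
      · simp [hd, hYq, ha0 w hwF hq₂x, hX0 w hwF hq.symm]
    have hsum : ∑ w ∈ F₀, d w • w = ∑ w ∈ F₀, (0 : ℝ) • w := by
      rw [Finset.sum_subset hF₀W fun w hw hwF => by rw [hd0 w hw hwF, zero_smul]]
      simp only [hd, sub_smul, add_smul, mul_smul, Finset.sum_sub_distrib, Finset.sum_add_distrib,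
        ← Finset.smul_sum, hr, har, hXr, hYr]
      simp
    have hF := sum_smul_inj_of_isUnimodularBasis (h.unimodular F₀ hF₀) (c := d) (d := fun _ => 0)
      hsum
    intro w hw
    have : d w = 0 := by
      by_cases hwF : w ∈ F₀
      · exact hF w hwF
      · exact hd0 w hw hwF
    simp only [hd] at this
    linarith
  have hdual : ∀ (g : Module.Dual ℝ (Fin n → ℝ)) (r : (Fin n → ℝ) → ℤ),
      ∑ w ∈ W, (r w : ℝ) • w = 0 → ∑ w ∈ W, g w * r w = 0 := fun g r hr => by
    have := congrArg g hr
    simpa [mul_comm] using this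
  have hext : ∀ f : (Fin n → ℝ) → ℝ, ∑ w ∈ W, f w * a w = 0 → ∑ w ∈ W, f w * X w = 0 →
      ∑ w ∈ W, f w * Y w = 0 → ∃ g : Module.Dual ℝ (Fin n → ℝ), ∀ w ∈ W, g w = f w := by
    intro f hfa hfX hfY
    obtain ⟨g, hg⟩ := exists_dual_of_isUnimodularBasis (h.unimodular F₀ hF₀) f
    have aux : ∀ (r : (Fin n → ℝ) → ℤ) (q : Fin n → ℝ), q ∈ W → r q = 1 →
        (∀ w, w ∉ F₀ → w ≠ q → r w = 0) → ∑ w ∈ W, (r w : ℝ) • w = 0 →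
        ∑ w ∈ W, f w * r w = 0 → g q = f q := fun r q hqW hrq hr0 hr hf => by
      have h1 : ∑ w ∈ W, (g w - f w) * r w = 0 := by
        simp only [sub_mul, Finset.sum_sub_distrib, hdual g r hr, hf, sub_zero]
      rw [Finset.sum_eq_single q] at h1
      · rw [hrq] at h1
        push_cast at h1
        linarith
      · intro w hw hwq
        by_cases hwF : w ∈ F₀
        · rw [hg w hwF, sub_self, zero_mul]
        · rw [hr0 w hwF hwq]; simp
      · exact fun h => absurd hqW h
    refine ⟨g, fun w hw => ?_⟩
    by_cases hwF : w ∈ F₀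
    · exact hg w hwF
    · rcases hout w hw hwF with rfl | rfl | rfl
      · exact aux a w hw hax ha0 har hfa
      · exact aux X w hw hXq hX0 hXr hfX
      · exact aux Y w hw hYq hY0 hYr hfY
  have hcof : ∀ F ∈ 𝓕, W \ F ∈ cofacets W 𝓕 := fun F hF =>
    ⟨Finset.sdiff_subset, by rwa [Finset.sdiff_sdiff_eq_self (h.subset F hF)]⟩
  refine ⟨a, X, Y, ⟨fun T hT => hT.1, ?_, ?_, ?_, ?_, ?_, ?_, ?_, ?_, ?_, har, hXr, hYr, hext⟩⟩
  · rintro T ⟨hT, hTF⟩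
    have := Finset.card_sdiff_add_card_eq_card hT
    rw [h.card_eq hTF] at this
    omega
  · rintro T ⟨hT, hTF⟩
    obtain ⟨u, hu1, hu2⟩ := h.supporting _ hTF
    have aux : ∀ r : (Fin n → ℝ) → ℤ, ∑ w ∈ W, (r w : ℝ) • w = 0 →
        ∑ w ∈ T, (1 - u w) * r w = (∑ w ∈ W, r w : ℤ) := fun r hr => by
      rw [Finset.sum_subset hT fun w hw hwT => by
        rw [hu1 w (Finset.mem_sdiff.2 ⟨hw, hwT⟩), sub_self, zero_mul]]
      simp only [sub_mul, one_mul, Finset.sum_sub_distrib, hdual u r hr, sub_zero, Int.cast_sum]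
    exact ⟨fun w => 1 - u w, fun w hw => by
      linarith [hu2 w (hT hw) fun hh => (Finset.mem_sdiff.1 hh).2 hw], aux a har, aux X hXr,
      aux Y hYr⟩
  · rintro T ⟨hT, hTF⟩ w₀ hw₀
    obtain ⟨r, hr1, hr0, hr⟩ := h.exists_int_relation hTF (hT hw₀)
      (fun hh => (Finset.mem_sdiff.1 hh).2 hw₀)
    have hk := key (fun w => r w) hr
    refine ⟨r x, r q₁, r q₂, ?_, fun w hw hww => ?_⟩
    · rw [← hr1]; exact_mod_cast (hk w₀ (hT hw₀)).symm
    · rw [← hr0 w (fun hh => (Finset.mem_sdiff.1 hh).2 hw) hww]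
      exact_mod_cast (hk w (hT hw)).symm
  · rintro T hT ⟨c, hc, h1, h2, h3⟩
    have aux : ∀ r : (Fin n → ℝ) → ℤ, ∑ w ∈ T, c w * r w = (∑ w ∈ W, r w : ℤ) →
        ∑ w ∈ W, (1 - if w ∈ T then c w else 0) * r w = 0 := fun r hr => by
      simp only [sub_mul, one_mul, Finset.sum_sub_distrib, ite_mul, zero_mul]
      rw [Finset.sum_ite_mem, Finset.inter_eq_right.2 hT, hr, Int.cast_sum, sub_self]
    obtain ⟨g, hg⟩ := hext _ (aux a h1) (aux X h2) (aux Y h3)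
    obtain ⟨F', hF', hs⟩ := h.exists_subset (F := W \ T) Finset.sdiff_subset g
      (fun w hw => by
        rw [hg w (Finset.mem_sdiff.1 hw).1, if_neg (Finset.mem_sdiff.1 hw).2, sub_zero])
      (fun w hw => by
        rw [hg w hw]
        split_ifs with hwT
        · linarith [hc w hwT]
        · simp)
    refine ⟨W \ F', hcof F' hF', fun w hw => ?_⟩
    rw [Finset.mem_sdiff] at hw
    by_contra hwT
    exact hw.2 (hs (Finset.mem_sdiff.2 ⟨hw.1, hwT⟩))
  · obtain ⟨c, hc, hc0⟩ := h.exists_pos_relation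
    exact ⟨c x, c q₁, c q₂, fun w hw => by rw [← key c hc0 w hw]; exact hc w hw⟩
  · intro w hw
    obtain ⟨F, hF, hwF⟩ := h.exists_mem w hw
    exact ⟨W \ F, hcof F hF, fun hh => (Finset.mem_sdiff.1 hh).2 hwF⟩
  · intro y hyW hy
    have hyA : y ∈ A := by
      by_contra hyA
      simp [ha, hyA] at hy
    obtain ⟨F, hF, hs, hyF⟩ := hAF' y hyA
    refine ⟨W \ F, hcof F hF, Finset.mem_sdiff.2 ⟨hyW, hyF⟩, fun w hw hw1 => ?_⟩
    by_contra hwy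
    have hwA : w ∈ A := by
      by_contra hwA
      simp [ha, hwA] at hw1
    exact (Finset.mem_sdiff.1 hw).2 (hs (Finset.mem_erase.2 ⟨hwy, hwA⟩))
  · intro w _
    by_cases hwA : w ∈ A <;> simp [ha, hwA]
  · exact ⟨x, hAW hxA, hax⟩

end FanData

theorem posComb_triple {E : Type*} [DecidableEq E] {p q r : E} (hpq : p ≠ q) (hpr : p ≠ r)
    (hqr : q ≠ r) {h X Y : E → ℤ} {a b c : ℤ} :
    PosComb {p, q, r} h X Y a b c ↔ ∃ s t u : ℝ, 0 < s ∧ 0 < t ∧ 0 < u ∧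
      s * h p + t * h q + u * h r = a ∧ s * X p + t * X q + u * X r = b ∧
      s * Y p + t * Y q + u * Y r = c := by
  have hsum : ∀ f : E → ℝ, ∑ w ∈ ({p, q, r} : Finset E), f w = f p + f q + f r := fun f => by
    rw [Finset.sum_insert (by simp [hpq, hpr]), Finset.sum_pair hqr, add_assoc]
  constructor
  · rintro ⟨m, hm, h1, h2, h3⟩
    rw [hsum] at h1 h2 h3
    exact ⟨m p, m q, m r, hm p (by simp), hm q (by simp), hm r (by simp), h1, h2, h3⟩
  · rintro ⟨s, t, u, hs, ht, hu, h1, h2, h3⟩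
    refine ⟨fun w => if w = p then s else if w = q then t else u, fun w _ => ?_, ?_, ?_, ?_⟩
    · dsimp only
      split_ifs <;> assumption
    all_goals
      rw [hsum]
      simpa [hpq.symm, hpr.symm, hqr.symm]

theorem posComb_triple_of_int {E : Type*} [DecidableEq E] {p q r : E} (hpq : p ≠ q) (hpr : p ≠ r)
    (hqr : q ≠ r) {h X Y : E → ℤ} {a b c : ℤ} (s t u : ℤ) (hs : 0 < s) (ht : 0 < t) (hu : 0 < u)
    (h1 : s * h p + t * h q + u * h r = a) (h2 : s * X p + t * X q + u * X r = b)
    (h3 : s * Y p + t * Y q + u * Y r = c) : PosComb {p, q, r} h X Y a b c :=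
  (posComb_triple hpq hpr hqr).2 ⟨s, t, u, by exact_mod_cast hs, by exact_mod_cast ht,
    by exact_mod_cast hu, by exact_mod_cast h1, by exact_mod_cast h2, by exact_mod_cast h3⟩

namespace GaleData

variable {n : ℕ} {W : Finset (Fin n → ℝ)} {𝓣 : Set (Finset (Fin n → ℝ))}
  {h X Y : (Fin n → ℝ) → ℤ}

open Classical in
theorem mem_of_posComb (G : GaleData W 𝓣 h X Y) {p q r : Fin n → ℝ} (hp : p ∈ W) (hq : q ∈ W)
    (hr : r ∈ W) (hpq : p ≠ q) (hpr : p ≠ r) (hqr : q ≠ r)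
    (hc : PosComb {p, q, r} h X Y (∑ w ∈ W, h w) (∑ w ∈ W, X w) (∑ w ∈ W, Y w)) :
    {p, q, r} ∈ 𝓣 := by
  obtain ⟨T, hT, hs⟩ := G.of_pos _ (by
    intro w hw
    simp only [Finset.mem_insert, Finset.mem_singleton] at hw
    rcases hw with rfl | rfl | rfl <;> assumption) hc
  rwa [← Finset.eq_of_subset_of_card_le hs (by rw [G.card T hT]; exact Finset.card_le_three)]

open Classical in
theorem exists_eq_triple (G : GaleData W 𝓣 h X Y) {T : Finset (Fin n → ℝ)} (hT : T ∈ 𝓣)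
    {x : Fin n → ℝ} (hx : x ∈ T) :
    ∃ p q, p ∈ W ∧ q ∈ W ∧ x ≠ p ∧ x ≠ q ∧ p ≠ q ∧ T = {x, p, q} := by
  have h2 : (T.erase x).card = 2 := by
    rw [Finset.card_erase_of_mem hx, G.card T hT]
  obtain ⟨p, q, hpq, he⟩ := Finset.card_eq_two.1 h2
  have hp : p ∈ T.erase x := by rw [he]; simp
  have hq : q ∈ T.erase x := by rw [he]; simp
  rw [Finset.mem_erase] at hp hq
  refine ⟨p, q, G.subset T hT hp.2, G.subset T hT hq.2, hp.1.symm, hq.1.symm, hpq, ?_⟩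
  rw [← he, Finset.insert_erase hx]

open Classical in
theorem det_mul_self (G : GaleData W 𝓣 h X Y) {p q r : Fin n → ℝ}
    (hpq : p ≠ q) (hpr : p ≠ r) (hqr : q ≠ r) (hT : {p, q, r} ∈ 𝓣) :
    (!![h p, h q, h r; X p, X q, X r; Y p, Y q, Y r]).det *
      (!![h p, h q, h r; X p, X q, X r; Y p, Y q, Y r]).det = 1 := by
  obtain ⟨a, b, c, h1, h2⟩ := G.unim _ hT p (by simp)
  obtain ⟨a', b', c', h1', h2'⟩ := G.unim _ hT q (by simp)
  obtain ⟨a'', b'', c'', h1'', h2''⟩ := G.unim _ hT r (by simp)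
  have hM : !![a, b, c; a', b', c'; a'', b'', c''] *
      !![h p, h q, h r; X p, X q, X r; Y p, Y q, Y r] = 1 := by
    ext i j
    fin_cases i <;> fin_cases j <;> simp [Matrix.mul_apply, Fin.sum_univ_three, h1, h1', h1'',
      h2 q (by simp) hpq.symm, h2 r (by simp) hpr.symm, h2' p (by simp) hpq,
      h2' r (by simp) hqr.symm, h2'' p (by simp) hpr, h2'' q (by simp) hqr]
  have hd := congrArg Matrix.det hM
  rw [Matrix.det_mul, Matrix.det_one] at hd
  have := Int.isUnit_iff.1 (IsUnit.of_mul_eq_one_right _ hd)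
  rcases this with h | h <;> rw [h] <;> rfl

end GaleData

/-- The determinant deciding on which side of the ray spanned by the image of the total sum
modulo `x` the vector `(X q, Y q)` lies. -/
def side {E : Type*} (W : Finset E) (h X Y : E → ℤ) (x q : E) : ℤ :=
  (∑ w ∈ W, X w - (∑ w ∈ W, h w) * X x) * Y q - (∑ w ∈ W, Y w - (∑ w ∈ W, h w) * Y x) * X q

namespace GaleData

variable {n : ℕ} {W : Finset (Fin n → ℝ)} {𝓣 : Set (Finset (Fin n → ℝ))}
  {h X Y : (Fin n → ℝ) → ℤ}

theorem sum_pos (G : GaleData W 𝓣 h X Y) : 0 < ∑ w ∈ W, h w := by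
  obtain ⟨x, hx, hx1⟩ := G.nonempty
  refine Finset.sum_pos' (fun w hw => ?_) ⟨x, hx, by omega⟩
  rcases G.h01 w hw with h | h <;> omega

theorem ne_of_height {x q : Fin n → ℝ} (hx : h x = 1) (hq : h q = 0) : x ≠ q := by
  rintro rfl
  omega

theorem exists_prim_decomp (G : GaleData W 𝓣 h X Y) {x : Fin n → ℝ} (hx : x ∈ W)
    (hx1 : h x = 1) : ∃ p q : Fin n → ℝ, ∃ t u : ℝ, p ∈ W ∧ q ∈ W ∧ h p = 0 ∧ h q = 0 ∧
      0 < t ∧ 0 < u ∧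
      (∑ w ∈ W, X w : ℤ) - (∑ w ∈ W, h w : ℤ) * (X x : ℝ) = t * X p + u * X q ∧
      (∑ w ∈ W, Y w : ℤ) - (∑ w ∈ W, h w : ℤ) * (Y x : ℝ) = t * Y p + u * Y q ∧
      X p * Y q - X q * Y p ≠ 0 := by
  classical
  obtain ⟨T, hT, hxT, hT1⟩ := G.prim x hx hx1
  obtain ⟨p, q, hp, hq, hxp, hxq, hpq, rfl⟩ := G.exists_eq_triple hT hxT
  have hp0 : h p = 0 := (G.h01 p hp).resolve_right fun h1 => hxp (hT1 p (by simp) h1).symm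
  have hq0 : h q = 0 := (G.h01 q hq).resolve_right fun h1 => hxq (hT1 q (by simp) h1).symm
  obtain ⟨s, t, u, hs, ht, hu, h1, h2, h3⟩ := (posComb_triple hxp hxq hpq).1 (by
    convert G.pos _ hT)
  rw [hx1, hp0, hq0] at h1
  have hs : s = (∑ w ∈ W, h w : ℤ) := by rw [← h1]; simp
  refine ⟨p, q, t, u, hp, hq, hp0, hq0, ht, hu, ?_, ?_, fun h0 => ?_⟩
  · rw [← hs, ← h2]; ring
  · rw [← hs, ← h3]; ring
  · have hd := G.det_mul_self hxp hxq hpq (by convert hT)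
    rw [Matrix.det_fin_three] at hd
    simp [hx1, hp0, hq0] at hd
    have : X p * Y q - X q * Y p = 0 := h0
    rw [mul_comm (X p), mul_comm (X q)] at this
    simp_all

theorem exists_pos_form (G : GaleData W 𝓣 h X Y) : ∃ b c : ℝ,
    (∀ q ∈ W, h q = 0 → 0 < b * X q + c * Y q) ∧
    ∀ x ∈ W, h x = 1 →
      0 < b * ((∑ w ∈ W, X w : ℤ) - (∑ w ∈ W, h w : ℤ) * (X x : ℝ)) +
        c * ((∑ w ∈ W, Y w : ℤ) - (∑ w ∈ W, h w : ℤ) * (Y x : ℝ)) := by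
  obtain ⟨a, b, c, hpos⟩ := G.pointed
  have hQ : ∀ q ∈ W, h q = 0 → 0 < b * X q + c * Y q := fun q hq hq0 => by
    have := hpos q hq
    rw [hq0] at this
    push_cast at this
    linarith
  refine ⟨b, c, hQ, fun x hx hx1 => ?_⟩
  obtain ⟨p, q, t, u, hp, hq, hp0, hq0, ht, hu, h1, h2, -⟩ := G.exists_prim_decomp hx hx1
  rw [h1, h2]
  have e1 := mul_pos ht (hQ p hp hp0)
  have e2 := mul_pos hu (hQ q hq hq0)
  linarith

theorem side_ne_zero (G : GaleData W 𝓣 h X Y) {x q : Fin n → ℝ} (hx : x ∈ W)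
    (hx1 : h x = 1) (hq : q ∈ W) (hq0 : h q = 0) : side W h X Y x q ≠ 0 := by
  classical
  intro h0
  obtain ⟨b, c, hQ, hA⟩ := G.exists_pos_form
  have e1 := hQ q hq hq0
  have e2 := hA x hx hx1
  have h0' : ((∑ w ∈ W, X w : ℤ) - (∑ w ∈ W, h w : ℤ) * (X x : ℝ)) * Y q -
      ((∑ w ∈ W, Y w : ℤ) - (∑ w ∈ W, h w : ℤ) * (Y x : ℝ)) * X q = 0 := by
    exact_mod_cast h0
  have hk : (0 : ℝ) < (∑ w ∈ W, h w : ℤ) := by exact_mod_cast G.sum_pos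
  have hxq := ne_of_height hx1 hq0
  set k : ℝ := ((∑ w ∈ W, h w : ℤ) : ℝ)
  set S : ℝ := ((∑ w ∈ W, X w : ℤ) : ℝ) - k * X x with hS
  set R : ℝ := ((∑ w ∈ W, Y w : ℤ) : ℝ) - k * Y x with hR
  have hsum : ∀ f : (Fin n → ℝ) → ℝ, ∑ w ∈ ({x, q} : Finset (Fin n → ℝ)), f w = f x + f q :=
    fun f => Finset.sum_pair hxq
  obtain ⟨T, hT, hs⟩ := G.of_pos {x, q} (by
      intro w hw
      simp only [Finset.mem_insert, Finset.mem_singleton] at hw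
      rcases hw with rfl | rfl <;> assumption)
    ⟨fun w => if w = x then k else (b * S + c * R) / (b * X q + c * Y q), fun w _ => by
      dsimp only
      split_ifs
      · exact hk
      · exact div_pos e2 e1, by
      rw [hsum]; simp [hxq.symm, hx1, hq0, k], by
      rw [hsum]
      simp only [if_true, hxq.symm, if_false]
      have : (b * S + c * R) / (b * X q + c * Y q) * X q = S := by
        rw [div_mul_eq_mul_div, div_eq_iff e1.ne']
        linear_combination -c * h0'
      rw [this, hS]; ring, by
      rw [hsum]
      simp only [if_true, hxq.symm, if_false]
      have : (b * S + c * R) / (b * X q + c * Y q) * Y q = R := by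
        rw [div_mul_eq_mul_div, div_eq_iff e1.ne']
        linear_combination b * h0'
      rw [this, hR]; ring⟩
  have h3 := Finset.card_le_card hs
  rw [G.card T hT] at h3
  have := Finset.card_le_two (a := x) (b := q)
  omega

theorem exists_side (G : GaleData W 𝓣 h X Y) {x : Fin n → ℝ} (hx : x ∈ W) (hx1 : h x = 1) :
    (∃ l ∈ W, h l = 0 ∧ side W h X Y x l < 0) ∧ ∃ r ∈ W, h r = 0 ∧ 0 < side W h X Y x r := by
  obtain ⟨p, q, t, u, hp, hq, hp0, hq0, ht, hu, h1, h2, hd⟩ := G.exists_prim_decomp hx hx1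
  have e1 : (side W h X Y x p : ℝ) = -(u * (X p * Y q - X q * Y p : ℤ)) := by
    rw [side]
    push_cast at h1 h2 ⊢
    rw [h1, h2]; ring
  have e2 : (side W h X Y x q : ℝ) = t * (X p * Y q - X q * Y p : ℤ) := by
    rw [side]
    push_cast at h1 h2 ⊢
    rw [h1, h2]; ring
  rcases lt_or_gt_of_ne hd with hd | hd
  · have hd' : ((X p * Y q - X q * Y p : ℤ) : ℝ) < 0 := by exact_mod_cast hd
    refine ⟨⟨q, hq, hq0, ?_⟩, p, hp, hp0, ?_⟩
    · have : (side W h X Y x q : ℝ) < 0 := by rw [e2]; exact mul_neg_of_pos_of_neg ht hd'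
      exact_mod_cast this
    · have : (0 : ℝ) < side W h X Y x p := by
        rw [e1]; linarith [mul_neg_of_pos_of_neg hu hd']
      exact_mod_cast this
  · have hd' : (0 : ℝ) < (X p * Y q - X q * Y p : ℤ) := by exact_mod_cast hd
    refine ⟨⟨p, hp, hp0, ?_⟩, q, hq, hq0, ?_⟩
    · have : (side W h X Y x p : ℝ) < 0 := by
        rw [e1]; linarith [mul_pos hu hd']
      exact_mod_cast this
    · have : (0 : ℝ) < side W h X Y x q := by rw [e2]; exact mul_pos ht hd'
      exact_mod_cast this

theorem exists_side_or (G : GaleData W 𝓣 h X Y) {x q : Fin n → ℝ} (hx : x ∈ W)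
    (hx1 : h x = 1) (hq : q ∈ W) (hq0 : h q = 0) :
    side W h X Y x q < 0 ∨ 0 < side W h X Y x q :=
  lt_or_gt_of_ne (G.side_ne_zero hx hx1 hq hq0)

open Classical in
theorem triple_mem (G : GaleData W 𝓣 h X Y) {x l r : Fin n → ℝ} (hx : x ∈ W)
    (hx1 : h x = 1) (hl : l ∈ W) (hl0 : h l = 0) (hr : r ∈ W) (hr0 : h r = 0)
    (hsl : side W h X Y x l < 0) (hsr : 0 < side W h X Y x r) :
    {x, l, r} ∈ 𝓣 ∧ X l * Y r - X r * Y l = 1 := by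
  obtain ⟨b, c, hQ, hA⟩ := G.exists_pos_form
  have el := hQ l hl hl0
  have er := hQ r hr hr0
  have ex := hA x hx hx1
  have hk : (0 : ℝ) < (∑ w ∈ W, h w : ℤ) := by exact_mod_cast G.sum_pos
  have hlr : l ≠ r := by rintro rfl; omega
  have hxl := ne_of_height hx1 hl0
  have hxr := ne_of_height hx1 hr0
  have hsl' : (side W h X Y x l : ℝ) < 0 := by exact_mod_cast hsl
  have hsr' : (0 : ℝ) < side W h X Y x r := by exact_mod_cast hsr
  have hd : (0 : ℝ) < X l * Y r - X r * Y l := by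
    by_contra hd
    push Not at hd
    have e1 := mul_pos er (neg_pos.2 hsl')
    have e2 := mul_pos el hsr'
    have e3 := mul_nonpos_of_nonneg_of_nonpos ex.le hd
    simp only [side] at e1 e2
    push_cast at e1 e2 e3
    nlinarith
  have hmem : {x, l, r} ∈ 𝓣 := by
    refine G.mem_of_posComb hx hl hr hxl hxr hlr ((posComb_triple hxl hxr hlr).2
      ⟨(∑ w ∈ W, h w : ℤ), side W h X Y x r / (X l * Y r - X r * Y l),
        -side W h X Y x l / (X l * Y r - X r * Y l), hk, div_pos hsr' hd,
        div_pos (by linarith) hd, by simp [hx1, hl0, hr0], ?_, ?_⟩)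
    · rw [div_mul_eq_mul_div, div_mul_eq_mul_div, add_assoc, ← add_div, ← eq_sub_iff_add_eq',
        div_eq_iff hd.ne']
      simp only [side]
      push_cast
      ring
    · rw [div_mul_eq_mul_div, div_mul_eq_mul_div, add_assoc, ← add_div, ← eq_sub_iff_add_eq',
        div_eq_iff hd.ne']
      simp only [side]
      push_cast
      ring
  refine ⟨hmem, ?_⟩
  have hdet := G.det_mul_self hxl hxr hlr hmem
  rw [Matrix.det_fin_three] at hdet
  simp [hx1, hl0, hr0] at hdet
  have hd' : 0 < X l * Y r - X r * Y l := by exact_mod_cast hd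
  rcases Int.isUnit_iff.1 (IsUnit.of_mul_eq_one _ hdet) with h' | h' <;> linarith

open Classical in
theorem pair_mem (G : GaleData W 𝓣 h X Y) {x x' q : Fin n → ℝ} (hx : x ∈ W)
    (hx1 : h x = 1) (hx' : x' ∈ W) (hx1' : h x' = 1) (hq : q ∈ W) (hq0 : h q = 0)
    (hs : 0 < side W h X Y x q) (hs' : side W h X Y x' q < 0) :
    {x, x', q} ∈ 𝓣 ∧ (X x' - X x) * Y q - (Y x' - Y x) * X q = 1 := by
  obtain ⟨b, c, hQ, hA⟩ := G.exists_pos_form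
  have eq := hQ q hq hq0
  have ex := hA x hx hx1
  have ex' := hA x' hx' hx1'
  have hk' := G.sum_pos
  have hxx : x ≠ x' := by rintro rfl; omega
  have hxq := ne_of_height hx1 hq0
  have hxq' := ne_of_height hx1' hq0
  have hd' : (∑ w ∈ W, h w) * ((X x' - X x) * Y q - (Y x' - Y x) * X q) =
      side W h X Y x q - side W h X Y x' q := by
    simp only [side]; ring
  have hdpos : 0 < (X x' - X x) * Y q - (Y x' - Y x) * X q :=
    pos_of_mul_pos_right (by rw [hd']; linarith) hk'.le
  have hsr : (0 : ℝ) < side W h X Y x q := by exact_mod_cast hs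
  have hsr' : (side W h X Y x' q : ℝ) < 0 := by exact_mod_cast hs'
  have hdr : (0 : ℝ) < (X x' - X x) * Y q - (Y x' - Y x) * X q := by exact_mod_cast hdpos
  have hk : (0 : ℝ) < (∑ w ∈ W, h w : ℤ) := by exact_mod_cast hk'
  have hside : ∀ z, (side W h X Y z q : ℝ) =
      ((∑ w ∈ W, X w : ℤ) - (∑ w ∈ W, h w : ℤ) * X z) * Y q -
      ((∑ w ∈ W, Y w : ℤ) - (∑ w ∈ W, h w : ℤ) * Y z) * X q := fun z => by
    rw [side]; push_cast; ring
  have hmem : {x, x', q} ∈ 𝓣 := by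
    have hdr' : (∑ w ∈ W, h w : ℤ) * (((X x' : ℝ) - X x) * Y q - (Y x' - Y x) * X q) =
        side W h X Y x q - side W h X Y x' q := by exact_mod_cast hd'
    have e1 := hside x
    have e2 := hside x'
    generalize hk₀ : ((∑ w ∈ W, h w : ℤ) : ℝ) = k at *
    generalize hKX : ((∑ w ∈ W, X w : ℤ) : ℝ) = KX at *
    generalize hKY : ((∑ w ∈ W, Y w : ℤ) : ℝ) = KY at *
    generalize (side W h X Y x q : ℝ) = s at *
    generalize (side W h X Y x' q : ℝ) = s' at *
    set D := ((X x' : ℝ) - X x) * Y q - (Y x' - Y x) * X q with hD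
    set f := b * X q + c * Y q with hf
    set f1 := b * (KX - k * X x) + c * (KY - k * Y x) with hf1
    set f2 := b * (KX - k * X x') + c * (KY - k * Y x') with hf2
    have v1 : (-s' * f1 + s * f2) * X q =
        f * (-s' * (KX - k * X x) + s * (KX - k * X x')) := by
      rw [hf, hf1, hf2, e1, e2]; ring
    have v2 : (-s' * f1 + s * f2) * Y q =
        f * (-s' * (KY - k * Y x) + s * (KY - k * Y x')) := by
      rw [hf, hf1, hf2, e1, e2]; ring
    clear_value D f f1 f2
    refine G.mem_of_posComb hx hx' hq hxx hxq hxq' ((posComb_triple hxx hxq hxq').2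
      ⟨-s' / D, s / D, (-s' * f1 + s * f2) / (k * f * D), div_pos (by linarith) hdr,
        div_pos hsr hdr, div_pos ?_ (mul_pos (mul_pos hk eq) hdr), ?_, ?_, ?_⟩)
    · linarith [mul_pos hsr ex', mul_pos (neg_pos.2 hsr') ex]
    · rw [hx1, hx1', hq0, hk₀]
      field_simp
      push_cast
      linear_combination -(k * f) * hdr'
    · rw [hKX]
      field_simp
      linear_combination v1 - KX * f * hdr'
    · rw [hKY]
      field_simp
      linear_combination v2 - KY * f * hdr'
  refine ⟨hmem, ?_⟩
  have hdet := G.det_mul_self hxx hxq hxq' hmem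
  rw [Matrix.det_fin_three] at hdet
  simp [hx1, hx1', hq0] at hdet
  rcases Int.isUnit_iff.1 (IsUnit.of_mul_eq_one _ hdet) with h' | h' <;> linarith

theorem side_cast (x q : Fin n → ℝ) : (side W h X Y x q : ℝ) =
    ((∑ w ∈ W, X w : ℤ) - (∑ w ∈ W, h w : ℤ) * X x) * Y q -
      ((∑ w ∈ W, Y w : ℤ) - (∑ w ∈ W, h w : ℤ) * Y x) * X q := by
  rw [side]; push_cast; ring

open Classical in
theorem pair_sides (G : GaleData W 𝓣 h X Y) {x p q : Fin n → ℝ} (hx : x ∈ W) (hp : p ∈ W)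
    (hq : q ∈ W) (hx1 : h x = 1) (hp1 : h p = 1) (hq0 : h q = 0) (hxp : x ≠ p)
    (hT : {x, p, q} ∈ 𝓣) :
    (0 < side W h X Y x q ∧ side W h X Y p q < 0) ∨
      (0 < side W h X Y p q ∧ side W h X Y x q < 0) := by
  obtain ⟨s, t, u, hs, ht, hu, h1, h2, h3⟩ :=
    (posComb_triple hxp (ne_of_height hx1 hq0) (ne_of_height hp1 hq0)).1 (G.pos _ hT)
  rw [hx1, hp1, hq0] at h1
  have e : s * side W h X Y x q + t * side W h X Y p q = 0 := by
    rw [side_cast, side_cast, ← h1, ← h2, ← h3]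
    push_cast
    ring
  have aux : ∀ {a b : ℝ} {i j : ℤ}, 0 < a → 0 < b → a * i + b * j = 0 → i < 0 → 0 < j := by
    intro a b i j ha hb hab hi
    have hi' : (i : ℝ) < 0 := by exact_mod_cast hi
    have := mul_neg_of_pos_of_neg ha hi'
    have : (0 : ℝ) < j := pos_of_mul_pos_right (a := b) (by linarith) hb.le
    exact_mod_cast this
  rcases G.exists_side_or hx hx1 hq hq0 with h' | h'
  · exact Or.inr ⟨aux hs ht e h', h'⟩
  · rcases G.exists_side_or hp hp1 hq hq0 with h'' | h''
    · exact Or.inl ⟨h', h''⟩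
    · have i1 : (0 : ℝ) < side W h X Y x q := by exact_mod_cast h'
      have i2 : (0 : ℝ) < side W h X Y p q := by exact_mod_cast h''
      linarith [mul_pos hs i1, mul_pos ht i2]

open Classical in
theorem triple_cases (G : GaleData W 𝓣 h X Y) {T : Finset (Fin n → ℝ)} (hT : T ∈ 𝓣) :
    (∃ x ∈ W, ∃ l ∈ W, ∃ r ∈ W, T = {x, l, r} ∧ h x = 1 ∧ h l = 0 ∧ h r = 0 ∧
      side W h X Y x l < 0 ∧ 0 < side W h X Y x r) ∨
    ∃ x ∈ W, ∃ x' ∈ W, ∃ q ∈ W, T = {x, x', q} ∧ h x = 1 ∧ h x' = 1 ∧ h q = 0 ∧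
      0 < side W h X Y x q ∧ side W h X Y x' q < 0 := by
  have hTW := G.subset T hT
  obtain ⟨x, hxT, hx1⟩ : ∃ x ∈ T, h x = 1 := by
    by_contra hcon
    push Not at hcon
    obtain ⟨m, -, hm, -⟩ := G.pos T hT
    rw [Finset.sum_eq_zero fun w hw => by
      rw [(G.h01 w (hTW hw)).resolve_right (hcon w hw)]; simp] at hm
    have := G.sum_pos
    have : (0 : ℝ) < (∑ w ∈ W, h w : ℤ) := by exact_mod_cast this
    linarith
  have hx := hTW hxT
  obtain ⟨p, q, hp, hq, hxp, hxq, hpq, hTe⟩ := G.exists_eq_triple hT hxT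
  have hT' : ({x, p, q} : Finset (Fin n → ℝ)) ∈ 𝓣 := by convert hT; exact hTe.symm
  rcases G.h01 p hp with hp0 | hp1 <;> rcases G.h01 q hq with hq0 | hq1
  · left
    obtain ⟨s, t, u, hs, ht, hu, h1, h2, h3⟩ := (posComb_triple hxp hxq hpq).1 (G.pos _ hT')
    rw [hx1, hp0, hq0] at h1
    have e1 : (side W h X Y x p : ℝ) = u * (X q * Y p - Y q * X p : ℤ) := by
      rw [side_cast, ← h1, ← h2, ← h3]
      push_cast
      ring
    have e2 : (side W h X Y x q : ℝ) = -(t * (X q * Y p - Y q * X p : ℤ)) := by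
      rw [side_cast, ← h1, ← h2, ← h3]
      push_cast
      ring
    rcases G.exists_side_or hx hx1 hp hp0 with h' | h'
    · refine ⟨x, hx, p, hp, q, hq, hTe, hx1, hp0, hq0, h', ?_⟩
      have h'' : (side W h X Y x p : ℝ) < 0 := by exact_mod_cast h'
      rw [e1] at h''
      have : (0 : ℝ) < side W h X Y x q := by
        rw [e2]
        have := neg_of_mul_neg_right h'' hu.le
        linarith [mul_neg_of_pos_of_neg ht this]
      exact_mod_cast this
    · refine ⟨x, hx, q, hq, p, hp, by rw [hTe, Finset.pair_comm], hx1, hq0, hp0, ?_, h'⟩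
      have h'' : (0 : ℝ) < side W h X Y x p := by exact_mod_cast h'
      rw [e1] at h''
      have : (side W h X Y x q : ℝ) < 0 := by
        rw [e2]
        have := pos_of_mul_pos_right h'' hu.le
        linarith [mul_pos ht this]
      exact_mod_cast this
  · right
    have hT'' : ({x, q, p} : Finset (Fin n → ℝ)) ∈ 𝓣 := by rwa [Finset.pair_comm]
    rcases G.pair_sides hx hq hp hx1 hq1 hp0 hxq hT'' with ⟨i1, i2⟩ | ⟨i1, i2⟩
    · exact ⟨x, hx, q, hq, p, hp, by rw [hTe, Finset.pair_comm], hx1, hq1, hp0, i1, i2⟩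
    · exact ⟨q, hq, x, hx, p, hp, by rw [hTe, Finset.pair_comm, Finset.insert_comm], hq1, hx1,
        hp0, i1, i2⟩
  · right
    rcases G.pair_sides hx hp hq hx1 hp1 hq0 hxp hT' with ⟨i1, i2⟩ | ⟨i1, i2⟩
    · exact ⟨x, hx, p, hp, q, hq, hTe, hx1, hp1, hq0, i1, i2⟩
    · exact ⟨p, hp, x, hx, q, hq, by rw [hTe, Finset.insert_comm], hp1, hx1, hq0, i1, i2⟩
  · exfalso
    obtain ⟨s, t, u, hs, ht, hu, h1, h2, h3⟩ := (posComb_triple hxp hxq hpq).1 (G.pos _ hT')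
    rw [hx1, hp1, hq1] at h1
    obtain ⟨b, c, -, hA⟩ := G.exists_pos_form
    have i1 := mul_pos hs (hA x hx hx1)
    have i2 := mul_pos ht (hA p hp hp1)
    have i3 := mul_pos hu (hA q hq hq1)
    rw [← h1, ← h2, ← h3] at i1 i2 i3
    push_cast at i1 i2 i3
    nlinarith

end GaleData

/-- The vector of total sums minus the vector at `x` is a positive combination of the vectors
at the elements of `T`. -/
def Slack {E : Type*} (W T : Finset E) (h X Y : E → ℤ) (x : E) : Prop :=
  PosComb T h X Y (∑ w ∈ W, h w - h x) (∑ w ∈ W, X w - X x) (∑ w ∈ W, Y w - Y x)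

/-- No two elements of `W` can be summed to give a new vertex. -/
def NoUp {E : Type*} (W : Finset E) (𝓣 : Set (Finset E)) (h X Y : E → ℤ) : Prop :=
  ∀ x ∈ W, ∀ x' ∈ W, x ≠ x' → (∃ T ∈ 𝓣, x ∉ T ∧ x' ∉ T) →
    (∀ T ∈ 𝓣, x' ∉ T → Slack W T h X Y x) → (∀ T ∈ 𝓣, x ∉ T → Slack W T h X Y x') → False

theorem FanData.noUp {n : ℕ} {W : Finset (Fin n → ℝ)} {𝓕 : Set (Finset (Fin n → ℝ))}
    (hF : FanData W 𝓕) (hn : 2 ≤ n) (hI : FIsolated (convexHull ℝ (W : Set (Fin n → ℝ))))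
    {h X Y : (Fin n → ℝ) → ℤ} (G : GaleData W (cofacets W 𝓕) h X Y) :
    NoUp W (cofacets W 𝓕) h X Y := by
  intro x hx x' hx' hne hex hs hs'
  have hcof : ∀ F ∈ 𝓕, W \ F ∈ cofacets W 𝓕 := fun F hF' =>
    ⟨Finset.sdiff_subset, by rwa [Finset.sdiff_sdiff_eq_self (hF.subset F hF')]⟩
  have aux : ∀ y ∈ W, ∀ F ∈ 𝓕, Slack W (W \ F) h X Y y → ∃ g : Module.Dual ℝ (Fin n → ℝ),
      (∀ w ∈ F, g w + (if w = y then 1 else 0) = 1) ∧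
        ∀ w ∈ W, w ∉ F → g w + (if w = y then 1 else 0) < 1 := by
    rintro y hy F hFF ⟨m, hm, h1, h2, h3⟩
    have aux2 : ∀ r : (Fin n → ℝ) → ℤ, ∑ w ∈ W \ F, m w * r w = (∑ w ∈ W, r w - r y : ℤ) →
        ∑ w ∈ W, (1 - (if w = y then 1 else 0) - if w ∈ W \ F then m w else 0) * r w = 0 := by
      intro r hr
      simp only [sub_mul, one_mul, Finset.sum_sub_distrib, ite_mul, zero_mul]
      rw [Finset.sum_ite_mem, Finset.inter_eq_right.2 Finset.sdiff_subset, hr, Finset.sum_ite_eq',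
        if_pos hy]
      push_cast
      ring
    obtain ⟨g, hg⟩ := G.ext _ (aux2 h h1) (aux2 X h2) (aux2 Y h3)
    refine ⟨g, fun w hw => ?_, fun w hw hwF => ?_⟩
    · rw [hg w (hF.subset F hFF hw), if_neg fun hh => (Finset.mem_sdiff.1 hh).2 hw]
      ring
    · have hwT : w ∈ W \ F := Finset.mem_sdiff.2 ⟨hw, hwF⟩
      rw [hg w hw, if_pos hwT]
      linarith [hm w hwT]
  refine hF.not_fIsolated_of_insert hn hne ?_ (fun F hFF hxF => ?_) (fun F hFF hxF => ?_) hI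
  · obtain ⟨T, hT, hxT, hxT'⟩ := hex
    exact ⟨_, hT.2, Finset.mem_sdiff.2 ⟨hx, hxT⟩, Finset.mem_sdiff.2 ⟨hx', hxT'⟩⟩
  · exact aux x hx F hFF (hs _ (hcof F hFF) fun hh => (Finset.mem_sdiff.1 hh).2 hxF)
  · exact aux x' hx' F hFF (hs' _ (hcof F hFF) fun hh => (Finset.mem_sdiff.1 hh).2 hxF)

theorem posComb_of_det {E : Type*} [DecidableEq E] {x l r : E} {h X Y : E → ℤ} {a b c : ℤ}
    (hx1 : h x = 1) (hl0 : h l = 0) (hr0 : h r = 0) (hd : X l * Y r - X r * Y l = 1)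
    (ha : 0 < a) (hl : 0 < (b - a * X x) * Y r - (c - a * Y x) * X r)
    (hr : 0 < (c - a * Y x) * X l - (b - a * X x) * Y l) :
    PosComb {x, l, r} h X Y a b c := by
  have hxl : x ≠ l := by rintro rfl; omega
  have hxr : x ≠ r := by rintro rfl; omega
  have hlr : l ≠ r := by rintro rfl; linarith
  refine posComb_triple_of_int hxl hxr hlr a _ _ ha hl hr (by simp [hx1, hl0, hr0]) ?_ ?_
  · linear_combination (b - a * X x) * hd
  · linear_combination (c - a * Y x) * hd

theorem PosComb.swap {E : Type*} {T : Finset E} {h X Y : E → ℤ} {a b c : ℤ}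
    (H : PosComb T h X Y a b c) : PosComb T h Y X a c b := by
  obtain ⟨m, hm, h1, h2, h3⟩ := H
  exact ⟨m, hm, h1, h3, h2⟩

theorem NoUp.swap {E : Type*} {W : Finset E} {𝓣 : Set (Finset E)} {h X Y : E → ℤ}
    (H : NoUp W 𝓣 h X Y) : NoUp W 𝓣 h Y X := fun x hx x' hx' hne hex hs hs' =>
  H x hx x' hx' hne hex (fun T hT hxT => (hs T hT hxT).swap) fun T hT hxT => (hs' T hT hxT).swap

theorem side_swap {E : Type*} (W : Finset E) (h X Y : E → ℤ) (x q : E) :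
    side W h Y X x q = -side W h X Y x q := by
  simp only [side]; ring

namespace GaleData

variable {n : ℕ} {W : Finset (Fin n → ℝ)} {𝓣 : Set (Finset (Fin n → ℝ))}
  {h X Y : (Fin n → ℝ) → ℤ}

theorem swap (G : GaleData W 𝓣 h X Y) : GaleData W 𝓣 h Y X where
  subset := G.subset
  card := G.card
  pos T hT := (G.pos T hT).swap
  unim T hT w₀ hw₀ := by
    obtain ⟨a, b, c, h1, h2⟩ := G.unim T hT w₀ hw₀
    exact ⟨a, c, b, by rw [← h1]; ring, fun w hw hne => by rw [← h2 w hw hne]; ring⟩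
  of_pos T hT H := G.of_pos T hT H.swap
  pointed := by
    obtain ⟨a, b, c, H⟩ := G.pointed
    exact ⟨a, c, b, fun w hw => by linarith [H w hw]⟩
  vert := G.vert
  prim := G.prim
  h01 := G.h01
  nonempty := G.nonempty
  rel_h := G.rel_h
  rel_X := G.rel_Y
  rel_Y := G.rel_X
  ext f h1 h2 h3 := G.ext f h1 h3 h2

theorem sum_eq_card (G : GaleData W 𝓣 h X Y) :
    ∑ w ∈ W, h w = (W.filter (fun w => h w = 1)).card := by
  rw [Finset.card_filter]
  push_cast
  refine Finset.sum_congr rfl fun w hw => ?_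
  rcases G.h01 w hw with h | h <;> simp [h]

open Classical in
theorem slack_of_height (G : GaleData W 𝓣 h X Y) (hk : 2 ≤ ∑ w ∈ W, h w)
    {x y l r : Fin n → ℝ} (hx1 : h x = 1) (hy : y ∈ W) (hy1 : h y = 1)
    (hl : l ∈ W) (hl0 : h l = 0) (hr : r ∈ W) (hr0 : h r = 0)
    (hyl : side W h X Y y l < 0) (hyr : 0 < side W h X Y y r)
    (hxl : side W h X Y x l < 0) (hxr : 0 < side W h X Y x r) :
    Slack W {y, l, r} h X Y x := by
  have hd := (G.triple_mem hy hy1 hl hl0 hr hr0 hyl hyr).2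
  simp only [side] at hyl hyr hxl hxr
  unfold Slack
  rw [hx1]
  generalize ∑ w ∈ W, h w = k at *
  generalize ∑ w ∈ W, X w = KX at *
  generalize ∑ w ∈ W, Y w = KY at *
  have hk1 : 0 < k - 1 := by linarith
  refine posComb_of_det hy1 hl0 hr0 hd hk1 ?_ ?_
  · refine pos_of_mul_pos_right (a := k) ?_ (by linarith)
    linarith [mul_pos hk1 hyr]
  · refine pos_of_mul_pos_right (a := k) ?_ (by linarith)
    linarith [mul_pos hk1 (neg_pos.2 hyl)]

/-- If every base vector has the same sides and all right vectors coincide, then there is a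
possible insertion. -/
theorem false_of_parallel (G : GaleData W 𝓣 h X Y) (hN : NoUp W 𝓣 h X Y)
    (hk : ∑ w ∈ W, h w = 2)
    (hcon : ∀ x ∈ W, ∀ x' ∈ W, ∀ q ∈ W, h x = 1 → h x' = 1 → h q = 0 →
      0 < side W h X Y x q → 0 < side W h X Y x' q)
    (hpar : ∀ x ∈ W, ∀ r ∈ W, ∀ r' ∈ W, h x = 1 → h r = 0 → h r' = 0 →
      0 < side W h X Y x r → 0 < side W h X Y x r' → X r * Y r' = X r' * Y r) : False := by
  classical
  have hconl : ∀ x ∈ W, ∀ x' ∈ W, ∀ q ∈ W, h x = 1 → h x' = 1 → h q = 0 →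
      side W h X Y x q < 0 → side W h X Y x' q < 0 := by
    intro x hx x' hx' q hq hx1 hx1' hq0 hs
    rcases G.exists_side_or hx' hx1' hq hq0 with h' | h'
    · exact h'
    · have := hcon x' hx' x hx q hq hx1' hx1 hq0 h'
      omega
  obtain ⟨x₀, hx₀, hx₀1⟩ := G.nonempty
  obtain ⟨⟨l₀, hl₀, hl₀0, hl₀s⟩, r, hr, hr0, hrs⟩ := G.exists_side hx₀ hx₀1
  have hrr : ∀ r' ∈ W, h r' = 0 → 0 < side W h X Y x₀ r' → X r' = X r ∧ Y r' = Y r := by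
    intro r' hr' hr'0 hr's
    have d1 := (G.triple_mem hx₀ hx₀1 hl₀ hl₀0 hr hr0 hl₀s hrs).2
    have d2 := (G.triple_mem hx₀ hx₀1 hl₀ hl₀0 hr' hr'0 hl₀s hr's).2
    have d3 := hpar x₀ hx₀ r hr r' hr' hx₀1 hr0 hr'0 hrs hr's
    constructor
    · linear_combination -X r' * d1 + X r * d2 - X l₀ * d3
    · linear_combination -Y r' * d1 + Y r * d2 - Y l₀ * d3
  set L := W.filter (fun q => h q = 0 ∧ side W h X Y x₀ q < 0) with hL
  have hmemL : ∀ l, l ∈ L ↔ l ∈ W ∧ h l = 0 ∧ side W h X Y x₀ l < 0 := fun l =>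
    Finset.mem_filter
  have hLcard : 2 ≤ L.card := by
    obtain ⟨T, hT, hl₀T⟩ := G.vert l₀ hl₀
    refine Finset.one_lt_card.2 ⟨l₀, (hmemL _).2 ⟨hl₀, hl₀0, hl₀s⟩, ?_⟩
    rcases G.triple_cases hT with ⟨x, hx, l, hl, r', hr', rfl, hx1, hl0, hr'0, hsl, hsr⟩ |
      ⟨x, hx, x', hx', q, hq, rfl, hx1, hx1', hq0, hs, hs'⟩
    · exact ⟨l, (hmemL _).2 ⟨hl, hl0, hconl x hx x₀ hx₀ l hl hx1 hx₀1 hl0 hsl⟩, by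
        rintro rfl; simp at hl₀T⟩
    · have := hcon x hx x' hx' q hq hx1 hx1' hq0 hs
      omega
  have hdet : ∀ q ∈ W, (1 - h q) * (X q * Y r - X r * Y q) = if q ∈ L then 1 else 0 := by
    intro q hq
    rcases G.h01 q hq with hq0 | hq1
    · rw [hq0]
      rcases G.exists_side_or hx₀ hx₀1 hq hq0 with h' | h'
      · rw [if_pos ((hmemL q).2 ⟨hq, hq0, h'⟩),
          (G.triple_mem hx₀ hx₀1 hq hq0 hr hr0 h' hrs).2]
        rfl
      · rw [if_neg fun hh => by have := ((hmemL q).1 hh).2.2; omega, (hrr q hq hq0 h').1,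
          (hrr q hq hq0 h').2]
        ring
    · rw [hq1, if_neg fun hh => by have := ((hmemL q).1 hh).2.1; omega]
      ring
  have hsumside : ∑ x ∈ W, h x * side W h X Y x r = 2 * L.card := by
    have e1 : ∑ q ∈ W, (1 - h q) * (X q * Y r - X r * Y q) = L.card := by
      rw [Finset.sum_congr rfl hdet, Finset.sum_boole]
      congr 2
      ext q
      simp only [Finset.mem_filter, hmemL]
      tauto
    rw [← e1, ← hk]
    have e2 : ∀ x ∈ W, h x * side W h X Y x r =
        h x * ((∑ w ∈ W, X w) * Y r - (∑ w ∈ W, Y w) * X r) +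
        (∑ w ∈ W, h w) * ((1 - h x) * (X x * Y r - X r * Y x)) -
        (X x * ((∑ w ∈ W, h w) * Y r) - Y x * ((∑ w ∈ W, h w) * X r)) := fun x _ => by
      simp only [side]; ring
    rw [Finset.sum_congr rfl e2, Finset.sum_sub_distrib, Finset.sum_add_distrib,
      Finset.sum_sub_distrib, ← Finset.sum_mul, ← Finset.sum_mul, ← Finset.sum_mul,
      ← Finset.mul_sum]
    ring
  have hAcard : (W.filter (fun w => h w = 1)).card = 2 := by
    have := G.sum_eq_card
    rw [hk] at this
    exact_mod_cast this.symm
  obtain ⟨x₁, x₂, hne, hA⟩ := Finset.card_eq_two.1 hAcard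
  have hmemA : ∀ w, (w ∈ W ∧ h w = 1) ↔ w = x₁ ∨ w = x₂ := fun w => by
    have : w ∈ W.filter (fun w => h w = 1) ↔ w ∈ ({x₁, x₂} : Finset _) := by rw [hA]
    simpa using this
  have hsum2 : side W h X Y x₁ r + side W h X Y x₂ r = 2 * L.card := by
    rw [← hsumside, ← Finset.sum_pair (f := fun x => side W h X Y x r) hne, ← hA,
      Finset.sum_filter]
    refine Finset.sum_congr rfl fun w hw => ?_
    rcases G.h01 w hw with h | h <;> simp [h]
  have main : ∀ x y, x ∈ W → h x = 1 → y ∈ W → h y = 1 →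
      (∀ w, w ∈ W → h w = 1 → w = x ∨ w = y) → 2 ≤ side W h X Y x r → x ≠ y → False := by
    intro x y hx hx1 hy hy1 hxy hs2 hne
    obtain ⟨l', hl'L, hl'⟩ := Finset.exists_mem_ne hLcard l₀
    obtain ⟨hl'W, hl'0, hl's⟩ := (hmemL l').1 hl'L
    have hL' : ∀ z ∈ W, h z = 1 → ∀ l ∈ W, h l = 0 → side W h X Y z l < 0 →
        side W h X Y x l < 0 := fun z hz hz1 l hl hl0 => hconl z hz x hx l hl hz1 hx1 hl0
    have hR' : ∀ z ∈ W, h z = 1 → ∀ l ∈ W, h l = 0 → 0 < side W h X Y z l →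
        0 < side W h X Y x l := fun z hz hz1 l hl hl0 => hcon z hz x hx l hl hz1 hx1 hl0
    have hxr := hcon x₀ hx₀ x hx r hr hx₀1 hx1 hr0 hrs
    refine hN y hy l₀ hl₀ (ne_of_height hy1 hl₀0) ⟨_, (G.triple_mem hx hx1 hl'W hl'0 hr hr0
      (hL' x₀ hx₀ hx₀1 l' hl'W hl'0 hl's) hxr).1, ?_, ?_⟩ (fun T hT hlT => ?_)
      fun T hT hyT => ?_
    · have := ne_of_height hy1 hl'0
      have := ne_of_height hy1 hr0
      simp [hne.symm, *]
    · have := (ne_of_height hx1 hl₀0).symm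
      have : l₀ ≠ r := by rintro rfl; omega
      simp [hl'.symm, *]
    · rcases G.triple_cases hT with ⟨x, hx, l, hl, r', hr', rfl, hx1, hl0, hr'0, hsl, hsr⟩ |
        ⟨x, hx, x', hx', q, hq, rfl, hx1, hx1', hq0, hs, hs'⟩
      · have := G.slack_of_height (by omega) hy1 hx hx1 hl hl0 hr' hr'0 hsl hsr
          (hconl x hx y hy l hl hx1 hy1 hl0 hsl) (hcon x hx y hy r' hr' hx1 hy1 hr'0 hsr)
        convert this
      · have := hcon x hx x' hx' q hq hx1 hx1' hq0 hs
        omega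
    · rcases G.triple_cases hT with ⟨z, hz, l, hl, r', hr', rfl, hz1, hl0, hr'0, hsl, hsr⟩ |
        ⟨x, hx, x', hx', q, hq, rfl, hx1, hx1', hq0, hs, hs'⟩
      · obtain rfl : z = x := (hxy z hz hz1).resolve_right (by
          rintro rfl; simp at hyT)
        have d1 := (G.triple_mem hz hz1 hl hl0 hr' hr'0 hsl hsr).2
        have hl₀z := hconl x₀ hx₀ z hz l₀ hl₀ hx₀1 hz1 hl₀0 hl₀s
        have d2 := (G.triple_mem hz hz1 hl₀ hl₀0 hr' hr'0 hl₀z hsr).2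
        obtain ⟨e1, e2⟩ := hrr r' hr' hr'0 (hcon z hz x₀ hx₀ r' hr' hz1 hx₀1 hr'0 hsr)
        have hs2' : 2 ≤ side W h X Y z r' := by
          rw [side, e1, e2]; exact hs2
        unfold Slack
        rw [hl₀0]
        simp only [side] at hsl hl₀z hs2'
        generalize ∑ w ∈ W, h w = k at *
        generalize ∑ w ∈ W, X w = KX at *
        generalize ∑ w ∈ W, Y w = KY at *
        refine posComb_of_det hz1 hl0 hr'0 d1 (by omega) ?_ ?_
        · linarith
        · rcases le_or_gt 0 (X l * Y l₀ - X l₀ * Y l) with hd | hd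
          · have e : (KX - k * X z) * Y l - (KY - k * Y z) * X l =
                ((KX - k * X z) * Y l₀ - (KY - k * Y z) * X l₀) -
                (X l * Y l₀ - X l₀ * Y l) * ((KX - k * X z) * Y r' - (KY - k * Y z) * X r') := by
              linear_combination ((KY - k * Y z) * X l - (KX - k * X z) * Y l) * d2 -
                ((KY - k * Y z) * X l₀ - (KX - k * X z) * Y l₀) * d1
            nlinarith
          · linarith
      · have := hcon x hx x' hx' q hq hx1 hx1' hq0 hs
        omega
  have hx₁ := (hmemA x₁).2 (Or.inl rfl)
  have hx₂ := (hmemA x₂).2 (Or.inr rfl)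
  have : (2 : ℤ) ≤ L.card := by exact_mod_cast hLcard
  by_cases h2 : 2 ≤ side W h X Y x₁ r
  · exact main x₁ x₂ hx₁.1 hx₁.2 hx₂.1 hx₂.2 (fun w hw hw1 => (hmemA w).1 ⟨hw, hw1⟩) h2 hne
  · exact main x₂ x₁ hx₂.1 hx₂.2 hx₁.1 hx₁.2 (fun w hw hw1 => ((hmemA w).1 ⟨hw, hw1⟩).symm)
      (by omega) hne.symm

end GaleData

namespace GaleData

variable {n : ℕ} {W : Finset (Fin n → ℝ)} {𝓣 : Set (Finset (Fin n → ℝ))}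
  {h X Y : (Fin n → ℝ) → ℤ}

theorem two_le_sum (G : GaleData W 𝓣 h X Y)
    (hcon : ∀ x ∈ W, ∀ x' ∈ W, ∀ q ∈ W, h x = 1 → h x' = 1 → h q = 0 →
      0 < side W h X Y x q → 0 < side W h X Y x' q) : 2 ≤ ∑ w ∈ W, h w := by
  obtain ⟨x₀, hx₀, hx₀1⟩ := G.nonempty
  obtain ⟨T, hT, hxT⟩ := G.vert x₀ hx₀
  rw [G.sum_eq_card]
  have : 1 < (W.filter (fun w => h w = 1)).card := by
    refine Finset.one_lt_card.2 ⟨x₀, Finset.mem_filter.2 ⟨hx₀, hx₀1⟩, ?_⟩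
    rcases G.triple_cases hT with ⟨x, hx, l, hl, r', hr', rfl, hx1, hl0, hr'0, hsl, hsr⟩ |
      ⟨x, hx, x', hx', q, hq, rfl, hx1, hx1', hq0, hs, hs'⟩
    · exact ⟨x, Finset.mem_filter.2 ⟨hx, hx1⟩, by rintro rfl; simp at hxT⟩
    · have := hcon x hx x' hx' q hq hx1 hx1' hq0 hs
      omega
  exact_mod_cast this

theorem exists_middle (G : GaleData W 𝓣 h X Y) (hN : NoUp W 𝓣 h X Y) :
    ∃ x ∈ W, ∃ x' ∈ W, ∃ q ∈ W, h x = 1 ∧ h x' = 1 ∧ h q = 0 ∧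
      0 < side W h X Y x q ∧ side W h X Y x' q < 0 := by
  classical
  by_contra hc
  have hcon : ∀ x ∈ W, ∀ x' ∈ W, ∀ q ∈ W, h x = 1 → h x' = 1 → h q = 0 →
      0 < side W h X Y x q → 0 < side W h X Y x' q := by
    intro x hx x' hx' q hq hx1 hx1' hq0 hs
    rcases G.exists_side_or hx' hx1' hq hq0 with h' | h'
    · exact (hc ⟨x, hx, x', hx', q, hq, hx1, hx1', hq0, hs, h'⟩).elim
    · exact h'
  have hconl : ∀ x ∈ W, ∀ x' ∈ W, ∀ q ∈ W, h x = 1 → h x' = 1 → h q = 0 →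
      side W h X Y x q < 0 → side W h X Y x' q < 0 := by
    intro x hx x' hx' q hq hx1 hx1' hq0 hs
    rcases G.exists_side_or hx' hx1' hq hq0 with h' | h'
    · exact h'
    · have := hcon x' hx' x hx q hq hx1' hx1 hq0 h'
      omega
  have hk := G.two_le_sum hcon
  rcases hk.eq_or_lt with hk2 | hk3
  · have key : ∀ x ∈ W, ∀ l ∈ W, ∀ l' ∈ W, ∀ r ∈ W, ∀ r' ∈ W, h x = 1 → h l = 0 → h l' = 0 →
        h r = 0 → h r' = 0 → side W h X Y x l < 0 → side W h X Y x l' < 0 →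
        0 < side W h X Y x r → 0 < side W h X Y x r' →
        (X l * Y l' - X l' * Y l) * (X r * Y r' - X r' * Y r) = 0 := by
      intro x hx l hl l' hl' r hr r' hr' hx1 hl0 hl'0 hr0 hr'0 hls hl's hrs hr's
      have d1 := (G.triple_mem hx hx1 hl hl0 hr hr0 hls hrs).2
      have d2 := (G.triple_mem hx hx1 hl hl0 hr' hr'0 hls hr's).2
      have d3 := (G.triple_mem hx hx1 hl' hl'0 hr hr0 hl's hrs).2
      have d4 := (G.triple_mem hx hx1 hl' hl'0 hr' hr'0 hl's hr's).2
      have plu : (X l * Y l' - X l' * Y l) * (X r * Y r' - X r' * Y r) =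
          (X l * Y r - X r * Y l) * (X l' * Y r' - X r' * Y l') -
          (X l * Y r' - X r' * Y l) * (X l' * Y r - X r * Y l') := by ring
      rw [plu, d1, d2, d3, d4]
      norm_num
    by_cases hpar : ∀ x ∈ W, ∀ r ∈ W, ∀ r' ∈ W, h x = 1 → h r = 0 → h r' = 0 →
      0 < side W h X Y x r → 0 < side W h X Y x r' → X r * Y r' = X r' * Y r
    · exact G.false_of_parallel hN hk2.symm hcon hpar
    · push Not at hpar
      obtain ⟨x, hx, r, hr, r', hr', hx1, hr0, hr'0, hrs, hr's, hne⟩ := hpar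
      refine G.swap.false_of_parallel hN.swap hk2.symm ?_ ?_
      · simp only [side_swap W h X Y]
        intro x hx x' hx' q hq hx1 hx1' hq0 hs
        have := hconl x hx x' hx' q hq hx1 hx1' hq0 (by omega)
        omega
      · simp only [side_swap W h X Y]
        intro z hz l hl l' hl' hz1 hl0 hl'0 hs hs'
        have := key x hx l hl l' hl' r hr r' hr' hx1 hl0 hl'0 hr0 hr'0
          (hconl z hz x hx l hl hz1 hx1 hl0 (by omega))
          (hconl z hz x hx l' hl' hz1 hx1 hl'0 (by omega)) hrs hr's
        rcases mul_eq_zero.1 this with h' | h'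
        · linarith
        · exact (hne (by linarith)).elim
  · have hcard : 2 < (W.filter (fun w => h w = 1)).card := by
      have h3 := G.sum_eq_card
      rw [h3] at hk3
      exact_mod_cast hk3
    obtain ⟨x, hx, x', hx', y, hy, h1, h2, h3⟩ := Finset.two_lt_card.1 hcard
    rw [Finset.mem_filter] at hx hx' hy
    obtain ⟨⟨l, hl, hl0, hls⟩, r, hr, hr0, hrs⟩ := G.exists_side hy.1 hy.2
    have aux : ∀ z ∈ W, h z = 1 → ∀ T ∈ 𝓣, Slack W T h X Y z := fun z hz hz1 T hT => by
      rcases G.triple_cases hT with ⟨x, hx, l, hl, r', hr', rfl, hx1, hl0, hr'0, hsl, hsr⟩ |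
        ⟨x, hx, x', hx', q, hq, rfl, hx1, hx1', hq0, hs, hs'⟩
      · have := G.slack_of_height hk hz1 hx hx1 hl hl0 hr' hr'0 hsl hsr
          (hconl x hx z hz l hl hx1 hz1 hl0 hsl) (hcon x hx z hz r' hr' hx1 hz1 hr'0 hsr)
        convert this
      · have := hcon x hx x' hx' q hq hx1 hx1' hq0 hs
        omega
    refine hN x hx.1 x' hx'.1 h1 ⟨_, (G.triple_mem hy.1 hy.2 hl hl0 hr hr0 hls hrs).1, ?_, ?_⟩
      (fun T hT _ => aux x hx.1 hx.2 T hT) fun T hT _ => aux x' hx'.1 hx'.2 T hT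
    · have := ne_of_height hx.2 hl0
      have := ne_of_height hx.2 hr0
      simp [*]
    · have := ne_of_height hx'.2 hl0
      have := ne_of_height hx'.2 hr0
      simp [*]

end GaleData

section Transform

variable {E : Type*} {h X Y X' Y' : E → ℤ} {e a b f c d : ℤ}

theorem PosComb.transform {T : Finset E} {α β γ : ℤ}
    (hX : ∀ w, X w = e * h w + a * X' w + b * Y' w)
    (hY : ∀ w, Y w = f * h w + c * X' w + d * Y' w) (H : PosComb T h X' Y' α β γ) :
    PosComb T h X Y α (e * α + a * β + b * γ) (f * α + c * β + d * γ) := by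
  obtain ⟨m, hm, h1, h2, h3⟩ := H
  refine ⟨m, hm, h1, ?_, ?_⟩
  · push_cast
    rw [← h1, ← h2, ← h3]
    simp only [Finset.mul_sum, ← Finset.sum_add_distrib]
    exact Finset.sum_congr rfl fun w _ => by rw [hX]; push_cast; ring
  · push_cast
    rw [← h1, ← h2, ← h3]
    simp only [Finset.mul_sum, ← Finset.sum_add_distrib]
    exact Finset.sum_congr rfl fun w _ => by rw [hY]; push_cast; ring

theorem sum_transform (W : Finset E) (hX : ∀ w, X w = e * h w + a * X' w + b * Y' w) :
    ∑ w ∈ W, X w = e * ∑ w ∈ W, h w + a * ∑ w ∈ W, X' w + b * ∑ w ∈ W, Y' w := by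
  simp only [hX, Finset.mul_sum, ← Finset.sum_add_distrib]

theorem Slack.transform {W T : Finset E} {x : E}
    (hX : ∀ w, X w = e * h w + a * X' w + b * Y' w)
    (hY : ∀ w, Y w = f * h w + c * X' w + d * Y' w) (H : Slack W T h X' Y' x) :
    Slack W T h X Y x := by
  have := PosComb.transform hX hY H
  unfold Slack
  rw [sum_transform W hX, sum_transform W hY, hX x, hY x]
  convert this using 1 <;> ring

theorem NoUp.transform {W : Finset E} {𝓣 : Set (Finset E)}
    (hX : ∀ w, X w = e * h w + a * X' w + b * Y' w)
    (hY : ∀ w, Y w = f * h w + c * X' w + d * Y' w) (H : NoUp W 𝓣 h X Y) :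
    NoUp W 𝓣 h X' Y' := fun x hx x' hx' hne hex hs hs' =>
  H x hx x' hx' hne hex (fun T hT hxT => (hs T hT hxT).transform hX hY)
    fun T hT hxT => (hs' T hT hxT).transform hX hY

theorem side_transform (W : Finset E) {x q : E}
    (hX : ∀ w, X w = e * h w + a * X' w + b * Y' w)
    (hY : ∀ w, Y w = f * h w + c * X' w + d * Y' w) (hx : h x = 1) (hq : h q = 0) :
    side W h X Y x q = (a * d - b * c) * side W h X' Y' x q := by
  unfold side
  rw [sum_transform W hX, sum_transform W hY, hX x, hY x, hX q, hY q, hx, hq]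
  ring

end Transform

theorem GaleData.transform {n : ℕ} {W : Finset (Fin n → ℝ)} {𝓣 : Set (Finset (Fin n → ℝ))}
    {h X Y X' Y' : (Fin n → ℝ) → ℤ} {e a b f c d e' a' b' f' c' d' : ℤ}
    (G : GaleData W 𝓣 h X Y)
    (hX' : ∀ w, X' w = e * h w + a * X w + b * Y w)
    (hY' : ∀ w, Y' w = f * h w + c * X w + d * Y w)
    (hX : ∀ w, X w = e' * h w + a' * X' w + b' * Y' w)
    (hY : ∀ w, Y w = f' * h w + c' * X' w + d' * Y' w) : GaleData W 𝓣 h X' Y' where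
  subset := G.subset
  card := G.card
  pos T hT := by
    rw [sum_transform W hX', sum_transform W hY']
    exact (G.pos T hT).transform hX' hY'
  unim T hT w₀ hw₀ := by
    obtain ⟨i, j, k, h1, h2⟩ := G.unim T hT w₀ hw₀
    refine ⟨i + j * e' + k * f', j * a' + k * c', j * b' + k * d', ?_, fun w hw hne => ?_⟩
    · rw [hX, hY] at h1
      linear_combination h1
    · have := h2 w hw hne
      rw [hX, hY] at this
      linear_combination this
  of_pos T hT H := G.of_pos T hT (by
    rw [sum_transform W hX, sum_transform W hY]
    exact H.transform hX hY)
  pointed := by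
    obtain ⟨i, j, k, H⟩ := G.pointed
    refine ⟨i + j * e' + k * f', j * a' + k * c', j * b' + k * d', fun w hw => ?_⟩
    have := H w hw
    rw [hX, hY] at this
    push_cast at this
    linarith
  vert := G.vert
  prim := G.prim
  h01 := G.h01
  nonempty := G.nonempty
  rel_h := G.rel_h
  rel_X := by
    have : ∀ w ∈ W, (X' w : ℝ) • w = (e : ℝ) • ((h w : ℝ) • w) + (a : ℝ) • ((X w : ℝ) • w) +
        (b : ℝ) • ((Y w : ℝ) • w) := fun w _ => by
      rw [hX']
      push_cast
      module
    rw [Finset.sum_congr rfl this, Finset.sum_add_distrib, Finset.sum_add_distrib,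
      ← Finset.smul_sum, ← Finset.smul_sum, ← Finset.smul_sum, G.rel_h, G.rel_X, G.rel_Y]
    simp
  rel_Y := by
    have : ∀ w ∈ W, (Y' w : ℝ) • w = (f : ℝ) • ((h w : ℝ) • w) + (c : ℝ) • ((X w : ℝ) • w) +
        (d : ℝ) • ((Y w : ℝ) • w) := fun w _ => by
      rw [hY']
      push_cast
      module
    rw [Finset.sum_congr rfl this, Finset.sum_add_distrib, Finset.sum_add_distrib,
      ← Finset.smul_sum, ← Finset.smul_sum, ← Finset.smul_sum, G.rel_h, G.rel_X, G.rel_Y]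
    simp
  ext g h1 h2 h3 := by
    refine G.ext g h1 ?_ ?_
    · have : ∀ w ∈ W, g w * X w = e' * (g w * h w) + a' * (g w * X' w) + b' * (g w * Y' w) :=
        fun w _ => by rw [hX]; push_cast; ring
      rw [Finset.sum_congr rfl this, Finset.sum_add_distrib, Finset.sum_add_distrib,
        ← Finset.mul_sum, ← Finset.mul_sum, ← Finset.mul_sum, h1, h2, h3]
      simp
    · have : ∀ w ∈ W, g w * Y w = f' * (g w * h w) + c' * (g w * X' w) + d' * (g w * Y' w) :=
        fun w _ => by rw [hY]; push_cast; ring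
      rw [Finset.sum_congr rfl this, Finset.sum_add_distrib, Finset.sum_add_distrib,
        ← Finset.mul_sum, ← Finset.mul_sum, ← Finset.mul_sum, h1, h2, h3]
      simp

/-- Gale data whose vectors are `(0, 1, 0)`, `(0, 0, 1)`, `(0, -1, 1)`, `(1, 0, *)`, `(1, 1, *)`,
each form occurring, together with the position of the total sum. -/
structure PentData {n : ℕ} (W : Finset (Fin n → ℝ)) (𝓣 : Set (Finset (Fin n → ℝ)))
    (h X Y : (Fin n → ℝ) → ℤ) : Prop where
  gale : GaleData W 𝓣 h X Y
  cases : ∀ w ∈ W, (h w = 0 ∧ X w = 1 ∧ Y w = 0) ∨ (h w = 0 ∧ X w = 0 ∧ Y w = 1) ∨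
    (h w = 0 ∧ X w = -1 ∧ Y w = 1) ∨ (h w = 1 ∧ X w = 0) ∨ (h w = 1 ∧ X w = 1)
  ex_y : ∃ w ∈ W, h w = 0 ∧ X w = 1 ∧ Y w = 0
  ex_v : ∃ w ∈ W, h w = 0 ∧ X w = 0 ∧ Y w = 1
  ex_u : ∃ w ∈ W, h w = 0 ∧ X w = -1 ∧ Y w = 1
  ex_t : ∃ w ∈ W, h w = 1 ∧ X w = 0
  ex_z : ∃ w ∈ W, h w = 1 ∧ X w = 1
  tv : 0 < ∑ w ∈ W, X w
  ty : ∀ w ∈ W, h w = 1 → X w = 0 → 0 < ∑ w ∈ W, Y w - (∑ w ∈ W, h w) * Y w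
  zv : ∑ w ∈ W, X w < ∑ w ∈ W, h w
  zu : ∀ w ∈ W, h w = 1 → X w = 1 →
    ∑ w ∈ W, h w - ∑ w ∈ W, X w < ∑ w ∈ W, Y w - (∑ w ∈ W, h w) * Y w

namespace GaleData

variable {n : ℕ} {W : Finset (Fin n → ℝ)} {𝓣 : Set (Finset (Fin n → ℝ))}
  {h X Y : (Fin n → ℝ) → ℤ}

theorem exists_pentData (G : GaleData W 𝓣 h X Y) (hN : NoUp W 𝓣 h X Y) :
    ∃ X' Y', PentData W 𝓣 h X' Y' ∧ NoUp W 𝓣 h X' Y' := by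
  obtain ⟨x, hx, x', hx', q, hq, hx1, hx'1, hq0, hxq, hx'q⟩ := G.exists_middle hN
  have hdq := (G.pair_mem hx hx1 hx' hx'1 hq hq0 hxq hx'q).2
  have tri := fun {x} (hx : x ∈ W) (hx1 : h x = 1) {l} (hl : l ∈ W) (hl0 : h l = 0) {r}
    (hr : r ∈ W) (hr0 : h r = 0) hsl hsr => (G.triple_mem hx hx1 hl hl0 hr hr0 hsl hsr).2
  obtain ⟨⟨l, hl, hl0, hls⟩, -⟩ := G.exists_side hx hx1
  obtain ⟨-, r, hr, hr0, hrs⟩ := G.exists_side hx' hx'1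
  have nest : ∀ p ∈ W, h p = 0 → side W h X Y x p < 0 → side W h X Y x' p < 0 := by
    intro p hp hp0 hs
    rcases G.exists_side_or hx' hx'1 hp hp0 with h' | h'
    · exact h'
    · have := tri hx hx1 hp hp0 hq hq0 hs hxq
      have := tri hx' hx'1 hq hq0 hp hp0 hx'q h'
      linarith
  have nest' : ∀ p ∈ W, h p = 0 → 0 < side W h X Y x' p → 0 < side W h X Y x p := by
    intro p hp hp0 hs
    rcases G.exists_side_or hx hx1 hp hp0 with h' | h'
    · have := nest p hp hp0 h'
      omega
    · exact h'
  have dlq := tri hx hx1 hl hl0 hq hq0 hls hxq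
  have dqr := tri hx' hx'1 hq hq0 hr hr0 hx'q hrs
  have dlr := tri hx hx1 hl hl0 hr hr0 hls (nest' r hr hr0 hrs)
  have eX : X q = X l + X r := by
    linear_combination -X q * dlr + X l * dqr + X r * dlq
  have eY : Y q = Y l + Y r := by
    linear_combination -Y q * dlr + Y l * dqr + Y r * dlq
  have vec : ∀ p ∈ W, h p = 0 → (X p = X l ∧ Y p = Y l) ∨ (X p = X q ∧ Y p = Y q) ∨
      (X p = X r ∧ Y p = Y r) := by
    intro p hp hp0
    rcases G.exists_side_or hx hx1 hp hp0 with h1 | h1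
    · left
      have d1 := tri hx hx1 hp hp0 hq hq0 h1 hxq
      have d2 := tri hx hx1 hp hp0 hr hr0 h1 (nest' r hr hr0 hrs)
      constructor
      · linear_combination -X p * dqr + X q * d2 - X r * d1 + eX
      · linear_combination -Y p * dqr + Y q * d2 - Y r * d1 + eY
    · rcases G.exists_side_or hx' hx'1 hp hp0 with h2 | h2
      · right; left
        have d1 := tri hx hx1 hl hl0 hp hp0 hls h1
        have d2 := tri hx' hx'1 hp hp0 hr hr0 h2 hrs
        constructor
        · linear_combination -X p * dlr + X l * d2 + X r * d1 - eX
        · linear_combination -Y p * dlr + Y l * d2 + Y r * d1 - eY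
      · right; right
        have d1 := tri hx' hx'1 hq hq0 hp hp0 hx'q h2
        have d2 := tri hx hx1 hl hl0 hp hp0 hls h1
        constructor
        · linear_combination -X p * dlq - X l * d1 + X q * d2 + eX
        · linear_combination -Y p * dlq - Y l * d1 + Y q * d2 + eY
  have hleft : ∀ z ∈ W, h z = 1 → side W h X Y z l < 0 := by
    intro z hz hz1
    rcases G.exists_side_or hz hz1 hl hl0 with h1 | h1
    · exact h1
    · obtain ⟨⟨p, hp, hp0, hps⟩, -⟩ := G.exists_side hz hz1
      have d := tri hz hz1 hp hp0 hl hl0 hps h1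
      rcases vec p hp hp0 with ⟨h3, h4⟩ | ⟨h3, h4⟩ | ⟨h3, h4⟩ <;> rw [h3, h4] at d <;> linarith
  have hright : ∀ z ∈ W, h z = 1 → 0 < side W h X Y z r := by
    intro z hz hz1
    rcases G.exists_side_or hz hz1 hr hr0 with h1 | h1
    · obtain ⟨-, p, hp, hp0, hps⟩ := G.exists_side hz hz1
      have d := tri hz hz1 hr hr0 hp hp0 h1 hps
      rcases vec p hp hp0 with ⟨h3, h4⟩ | ⟨h3, h4⟩ | ⟨h3, h4⟩ <;> rw [h3, h4] at d <;> linarith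
    · exact h1
  set X' : (Fin n → ℝ) → ℤ := fun w => (X q * Y x - X x * Y q) * h w + Y q * X w + -X q * Y w
    with hX'
  set Y' : (Fin n → ℝ) → ℤ := fun w => 0 * h w + -Y l * X w + X l * Y w with hY'
  have hX : ∀ w, X w = (-X l * (X q * Y x - X x * Y q)) * h w + X l * X' w + X q * Y' w :=
    fun w => by simp only [hX', hY']; linear_combination -X w * dlq
  have hY : ∀ w, Y w = (-Y l * (X q * Y x - X x * Y q)) * h w + Y l * X' w + Y q * Y' w :=
    fun w => by simp only [hX', hY']; linear_combination -Y w * dlq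
  have hX'w : ∀ w, X' w = (X q * Y x - X x * Y q) * h w + Y q * X w + -X q * Y w := fun w => rfl
  have hY'w : ∀ w, Y' w = 0 * h w + -Y l * X w + X l * Y w := fun w => rfl
  have hs : ∀ z p, h z = 1 → h p = 0 → side W h X Y z p = side W h X' Y' z p := fun z p hz hp => by
    rw [side_transform W hX hY hz hp, dlq, one_mul]
  clear_value X' Y'
  have class1 : ∀ w ∈ W, h w = 1 →
      (X' w = 0 ∧ 0 < side W h X Y w q) ∨ (X' w = 1 ∧ side W h X Y w q < 0) := by
    intro w hw hw1
    rcases G.exists_side_or hw hw1 hq hq0 with h1 | h1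
    · right
      have := (G.pair_mem hx hx1 hw hw1 hq hq0 hxq h1).2
      exact ⟨by rw [hX'w, hw1]; linear_combination this, h1⟩
    · left
      have := (G.pair_mem hw hw1 hx' hx'1 hq hq0 h1 hx'q).2
      exact ⟨by rw [hX'w, hw1]; linear_combination hdq - this, h1⟩
  have cl : X' l = 1 ∧ Y' l = 0 :=
    ⟨by rw [hX'w, hl0]; linear_combination dlq, by rw [hY'w, hl0]; ring⟩
  have cq : X' q = 0 ∧ Y' q = 1 :=
    ⟨by rw [hX'w, hq0]; ring, by rw [hY'w, hq0]; linear_combination dlq⟩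
  have cr : X' r = -1 ∧ Y' r = 1 :=
    ⟨by rw [hX'w, hr0]; linear_combination -dqr, by rw [hY'w, hr0]; linear_combination dlr⟩
  have htx := class1 x hx hx1
  have hzx := class1 x' hx' hx'1
  refine ⟨X', Y', ⟨G.transform hX'w hY'w hX hY, fun w hw => ?_, ⟨l, hl, hl0, cl⟩, ⟨q, hq, hq0, cq⟩,
    ⟨r, hr, hr0, cr⟩, ⟨x, hx, hx1, ?_⟩, ⟨x', hx', hx'1, ?_⟩, ?_, fun w hw hw1 hw0 => ?_, ?_,
    fun w hw hw1 hw0 => ?_⟩, hN.transform hX hY⟩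
  · rcases G.h01 w hw with hw0 | hw1
    · rcases vec w hw hw0 with ⟨e1, e2⟩ | ⟨e1, e2⟩ | ⟨e1, e2⟩
      · exact Or.inl ⟨hw0, by rw [← cl.1, hX'w, hX'w, e1, e2, hw0, hl0],
          by rw [← cl.2, hY'w, hY'w, e1, e2, hw0, hl0]⟩
      · exact Or.inr (Or.inl ⟨hw0, by rw [← cq.1, hX'w, hX'w, e1, e2, hw0, hq0],
          by rw [← cq.2, hY'w, hY'w, e1, e2, hw0, hq0]⟩)
      · exact Or.inr (Or.inr (Or.inl ⟨hw0, by rw [← cr.1, hX'w, hX'w, e1, e2, hw0, hr0],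
          by rw [← cr.2, hY'w, hY'w, e1, e2, hw0, hr0]⟩))
    · rcases class1 w hw hw1 with h1 | h1
      · exact Or.inr (Or.inr (Or.inr (Or.inl ⟨hw1, h1.1⟩)))
      · exact Or.inr (Or.inr (Or.inr (Or.inr ⟨hw1, h1.1⟩)))
  · rcases htx with h1 | h1
    · exact h1.1
    · omega
  · rcases hzx with h1 | h1
    · omega
    · exact h1.1
  · rcases htx with h1 | h1
    · rw [hs x q hx1 hq0, side, h1.1, cq.1, cq.2] at hxq
      linarith
    · omega
  · have := hleft w hw hw1
    rw [hs w l hw1 hl0, side, hw0, cl.1, cl.2] at this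
    linarith
  · rcases hzx with h1 | h1
    · omega
    · rw [hs x' q hx'1 hq0, side, h1.1, cq.1, cq.2] at hx'q
      linarith
  · have := hright w hw hw1
    rw [hs w r hw1 hr0, side, hw0, cr.1, cr.2] at this
    linarith

end GaleData

/-- The members of `W` whose first two coordinates are `i` and `j`. -/
def cls {E : Type*} (W : Finset E) (h X : E → ℤ) (i j : ℤ) : Finset E :=
  W.filter fun w => h w = i ∧ X w = j

theorem mem_cls {E : Type*} {W : Finset E} {h X : E → ℤ} {i j : ℤ} {w : E} :
    w ∈ cls W h X i j ↔ w ∈ W ∧ h w = i ∧ X w = j := Finset.mem_filter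

theorem cls_sub {E : Type*} (W : Finset E) (h X : E → ℤ) (i j : ℤ) :
    cls W h (fun w => h w - X w) i j = cls W h X i (i - j) := by
  ext w
  simp only [mem_cls]
  constructor <;> rintro ⟨h1, h2, h3⟩ <;> exact ⟨h1, h2, by omega⟩

namespace PentData

variable {n : ℕ} {W : Finset (Fin n → ℝ)} {𝓣 : Set (Finset (Fin n → ℝ))}
  {h X Y : (Fin n → ℝ) → ℤ}

theorem Y_y (D : PentData W 𝓣 h X Y) {w : Fin n → ℝ} (hw : w ∈ cls W h X 0 1) : Y w = 0 := by
  obtain ⟨h1, h2, h3⟩ := mem_cls.1 hw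
  have := D.cases w h1
  omega

theorem Y_v (D : PentData W 𝓣 h X Y) {w : Fin n → ℝ} (hw : w ∈ cls W h X 0 0) : Y w = 1 := by
  obtain ⟨h1, h2, h3⟩ := mem_cls.1 hw
  have := D.cases w h1
  omega

theorem Y_u (D : PentData W 𝓣 h X Y) {w : Fin n → ℝ} (hw : w ∈ cls W h X 0 (-1)) : Y w = 1 := by
  obtain ⟨h1, h2, h3⟩ := mem_cls.1 hw
  have := D.cases w h1
  omega

theorem mem_cases (D : PentData W 𝓣 h X Y) {w : Fin n → ℝ} (hw : w ∈ W) :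
    w ∈ cls W h X 0 1 ∨ w ∈ cls W h X 0 0 ∨ w ∈ cls W h X 0 (-1) ∨ w ∈ cls W h X 1 0 ∨
      w ∈ cls W h X 1 1 := by
  have := D.cases w hw
  simp only [mem_cls]
  tauto

theorem sum_eq (D : PentData W 𝓣 h X Y) {M : Type*} [AddCommMonoid M] (f : (Fin n → ℝ) → M) :
    ∑ w ∈ W, f w = ∑ w ∈ cls W h X 0 1, f w + ∑ w ∈ cls W h X 0 0, f w +
      ∑ w ∈ cls W h X 0 (-1), f w + ∑ w ∈ cls W h X 1 0, f w + ∑ w ∈ cls W h X 1 1, f w := by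
  simp only [cls, Finset.sum_filter, ← Finset.sum_add_distrib]
  refine Finset.sum_congr rfl fun w hw => ?_
  rcases D.cases w hw with ⟨h1, h2, -⟩ | ⟨h1, h2, -⟩ | ⟨h1, h2, -⟩ | ⟨h1, h2⟩ | ⟨h1, h2⟩ <;>
    simp [h1, h2]

theorem side_tv (D : PentData W 𝓣 h X Y) {t v : Fin n → ℝ} (ht : t ∈ cls W h X 1 0)
    (hv : v ∈ cls W h X 0 0) : 0 < side W h X Y t v := by
  rw [side, (mem_cls.1 ht).2.2, (mem_cls.1 hv).2.2, D.Y_v hv]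
  linarith [D.tv]

theorem side_ty (D : PentData W 𝓣 h X Y) {t y : Fin n → ℝ} (ht : t ∈ cls W h X 1 0)
    (hy : y ∈ cls W h X 0 1) : side W h X Y t y < 0 := by
  obtain ⟨h1, h2, h3⟩ := mem_cls.1 ht
  rw [side, h3, (mem_cls.1 hy).2.2, D.Y_y hy]
  linarith [D.ty t h1 h2 h3]

theorem side_tu (D : PentData W 𝓣 h X Y) {t u : Fin n → ℝ} (ht : t ∈ cls W h X 1 0)
    (hu : u ∈ cls W h X 0 (-1)) : 0 < side W h X Y t u := by
  obtain ⟨h1, h2, h3⟩ := mem_cls.1 ht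
  rw [side, h3, (mem_cls.1 hu).2.2, D.Y_u hu]
  linarith [D.ty t h1 h2 h3, D.tv]

theorem side_zv (D : PentData W 𝓣 h X Y) {z v : Fin n → ℝ} (hz : z ∈ cls W h X 1 1)
    (hv : v ∈ cls W h X 0 0) : side W h X Y z v < 0 := by
  rw [side, (mem_cls.1 hz).2.2, (mem_cls.1 hv).2.2, D.Y_v hv]
  linarith [D.zv]

theorem side_zy (D : PentData W 𝓣 h X Y) {z y : Fin n → ℝ} (hz : z ∈ cls W h X 1 1)
    (hy : y ∈ cls W h X 0 1) : side W h X Y z y < 0 := by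
  obtain ⟨h1, h2, h3⟩ := mem_cls.1 hz
  rw [side, h3, (mem_cls.1 hy).2.2, D.Y_y hy]
  linarith [D.zu z h1 h2 h3, D.zv]

theorem side_zu (D : PentData W 𝓣 h X Y) {z u : Fin n → ℝ} (hz : z ∈ cls W h X 1 1)
    (hu : u ∈ cls W h X 0 (-1)) : 0 < side W h X Y z u := by
  obtain ⟨h1, h2, h3⟩ := mem_cls.1 hz
  rw [side, h3, (mem_cls.1 hu).2.2, D.Y_u hu]
  linarith [D.zu z h1 h2 h3]

open Classical in
theorem mem_iff (D : PentData W 𝓣 h X Y) {T : Finset (Fin n → ℝ)} : T ∈ 𝓣 ↔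
    (∃ t ∈ cls W h X 1 0, ∃ y ∈ cls W h X 0 1, ∃ v ∈ cls W h X 0 0, T = {t, y, v}) ∨
    (∃ t ∈ cls W h X 1 0, ∃ y ∈ cls W h X 0 1, ∃ u ∈ cls W h X 0 (-1), T = {t, y, u}) ∨
    (∃ z ∈ cls W h X 1 1, ∃ y ∈ cls W h X 0 1, ∃ u ∈ cls W h X 0 (-1), T = {z, y, u}) ∨
    (∃ z ∈ cls W h X 1 1, ∃ v ∈ cls W h X 0 0, ∃ u ∈ cls W h X 0 (-1), T = {z, v, u}) ∨
    (∃ t ∈ cls W h X 1 0, ∃ z ∈ cls W h X 1 1, ∃ v ∈ cls W h X 0 0, T = {t, z, v}) := by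
  have htri : ∀ {x l r}, x ∈ W ∧ h x = 1 → l ∈ W ∧ h l = 0 → r ∈ W ∧ h r = 0 →
      side W h X Y x l < 0 → 0 < side W h X Y x r → ({x, l, r} : Finset (Fin n → ℝ)) ∈ 𝓣 :=
    fun {x l r} hx hl hr hsl hsr => by
      convert (D.gale.triple_mem hx.1 hx.2 hl.1 hl.2 hr.1 hr.2 hsl hsr).1
  have hm : ∀ {w i j}, w ∈ cls W h X i j → w ∈ W ∧ h w = i := fun hw =>
    ⟨(mem_cls.1 hw).1, (mem_cls.1 hw).2.1⟩
  constructor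
  · intro hT
    rcases D.gale.triple_cases hT with ⟨x, hx, l, hl, r, hr, rfl, hx1, hl0, hr0, hsl, hsr⟩ |
      ⟨x, hx, x', hx', q, hq, rfl, hx1, hx1', hq0, hs, hs'⟩
    · rcases D.mem_cases hx with c | c | c | c | c <;>
      rcases D.mem_cases hl with c' | c' | c' | c' | c' <;>
      rcases D.mem_cases hr with c'' | c'' | c'' | c'' | c'' <;>
      first
      | (exfalso; have := mem_cls.1 c; omega)
      | (exfalso; have := mem_cls.1 c'; omega)
      | (exfalso; have := mem_cls.1 c''; omega)
      | (exfalso; have := D.side_tv c c'; omega)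
      | (exfalso; have := D.side_tu c c'; omega)
      | (exfalso; have := D.side_zu c c'; omega)
      | (exfalso; have := D.side_zv c c''; omega)
      | (exfalso; have := D.side_zy c c''; omega)
      | (exfalso; have := D.side_ty c c''; omega)
      | exact Or.inl ⟨x, c, l, c', r, c'', by congr⟩
      | exact Or.inr (Or.inl ⟨x, c, l, c', r, c'', by congr⟩)
      | exact Or.inr (Or.inr (Or.inl ⟨x, c, l, c', r, c'', by congr⟩))
      | exact Or.inr (Or.inr (Or.inr (Or.inl ⟨x, c, l, c', r, c'', by congr⟩)))
    · rcases D.mem_cases hx with c | c | c | c | c <;>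
      rcases D.mem_cases hx' with c' | c' | c' | c' | c' <;>
      rcases D.mem_cases hq with c'' | c'' | c'' | c'' | c'' <;>
      first
      | (exfalso; have := mem_cls.1 c; omega)
      | (exfalso; have := mem_cls.1 c'; omega)
      | (exfalso; have := mem_cls.1 c''; omega)
      | (exfalso; have := D.side_tv c' c''; omega)
      | (exfalso; have := D.side_tu c' c''; omega)
      | (exfalso; have := D.side_zu c' c''; omega)
      | (exfalso; have := D.side_zv c c''; omega)
      | (exfalso; have := D.side_zy c c''; omega)
      | (exfalso; have := D.side_ty c c''; omega)
      | exact Or.inr (Or.inr (Or.inr (Or.inr ⟨x, c, x', c', q, c'', by congr⟩)))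
  · rintro (⟨t, ht, y, hy, v, hv, rfl⟩ | ⟨t, ht, y, hy, u, hu, rfl⟩ | ⟨z, hz, y, hy, u, hu, rfl⟩ |
      ⟨z, hz, v, hv, u, hu, rfl⟩ | ⟨t, ht, z, hz, v, hv, rfl⟩)
    · exact htri (hm ht) (hm hy) (hm hv) (D.side_ty ht hy) (D.side_tv ht hv)
    · exact htri (hm ht) (hm hy) (hm hu) (D.side_ty ht hy) (D.side_tu ht hu)
    · exact htri (hm hz) (hm hy) (hm hu) (D.side_zy hz hy) (D.side_zu hz hu)
    · exact htri (hm hz) (hm hv) (hm hu) (D.side_zv hz hv) (D.side_zu hz hu)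
    · convert (D.gale.pair_mem (hm ht).1 (hm ht).2 (hm hz).1 (hm hz).2 (hm hv).1 (hm hv).2
        (D.side_tv ht hv) (D.side_zv hz hv)).1

theorem symm (D : PentData W 𝓣 h X Y) :
    PentData W 𝓣 h (fun w => h w - X w) (fun w => X w + Y w) where
  gale := D.gale.transform (e := 1) (a := -1) (b := 0) (f := 0) (c := 1) (d := 1)
    (e' := 1) (a' := -1) (b' := 0) (f' := -1) (c' := 1) (d' := 1)
    (fun w => by ring) (fun w => by ring) (fun w => by ring) (fun w => by ring)
  cases w hw := by
    have := D.cases w hw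
    omega
  ex_y := by
    obtain ⟨w, hw, h1, h2, h3⟩ := D.ex_u
    exact ⟨w, hw, h1, by omega, by omega⟩
  ex_v := by
    obtain ⟨w, hw, h1, h2, h3⟩ := D.ex_v
    exact ⟨w, hw, h1, by omega, by omega⟩
  ex_u := by
    obtain ⟨w, hw, h1, h2, h3⟩ := D.ex_y
    exact ⟨w, hw, h1, by omega, by omega⟩
  ex_t := by
    obtain ⟨w, hw, h1, h2⟩ := D.ex_z
    exact ⟨w, hw, h1, by omega⟩
  ex_z := by
    obtain ⟨w, hw, h1, h2⟩ := D.ex_t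
    exact ⟨w, hw, h1, by omega⟩
  tv := by
    rw [Finset.sum_sub_distrib]
    linarith [D.zv]
  ty w hw h1 h2 := by
    have h3 : X w = 1 := by omega
    rw [Finset.sum_add_distrib, h3]
    linarith [D.zu w hw h1 h3]
  zv := by
    rw [Finset.sum_sub_distrib]
    linarith [D.tv]
  zu w hw h1 h2 := by
    have h3 : X w = 0 := by omega
    rw [Finset.sum_add_distrib, Finset.sum_sub_distrib, h3]
    linarith [D.ty w hw h1 h3]

end PentData

theorem NoUp.pent_symm {n : ℕ} {W : Finset (Fin n → ℝ)} {𝓣 : Set (Finset (Fin n → ℝ))}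
    {h X Y : (Fin n → ℝ) → ℤ} (H : NoUp W 𝓣 h X Y) :
    NoUp W 𝓣 h (fun w => h w - X w) (fun w => X w + Y w) :=
  H.transform (e := 1) (a := -1) (b := 0) (f := -1) (c := 1) (d := 1)
    (fun w => by ring) (fun w => by ring)

namespace PentData

variable {n : ℕ} {W : Finset (Fin n → ℝ)} {𝓣 : Set (Finset (Fin n → ℝ))}
  {h X Y : (Fin n → ℝ) → ℤ}

theorem ne_of_cls {i j i' j' : ℤ} {w w' : Fin n → ℝ} (hw : w ∈ cls W h X i j)
    (hw' : w' ∈ cls W h X i' j') (hne : i ≠ i' ∨ j ≠ j') : w ≠ w' := by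
  rintro rfl
  have := mem_cls.1 hw
  have := mem_cls.1 hw'
  omega

open Classical in
theorem posComb (D : PentData W 𝓣 h X Y) {T : Finset (Fin n → ℝ)} (hT : T ∈ 𝓣) {a b c : ℤ}
    (ha : 0 < a)
    (h1 : ∀ t ∈ cls W h X 1 0, ∀ y ∈ cls W h X 0 1, ∀ v ∈ cls W h X 0 0, T = {t, y, v} →
      0 < b ∧ 0 < c - a * Y t)
    (h2 : ∀ t ∈ cls W h X 1 0, ∀ y ∈ cls W h X 0 1, ∀ u ∈ cls W h X 0 (-1), T = {t, y, u} →
      0 < c - a * Y t ∧ 0 < b + c - a * Y t)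
    (h3 : ∀ z ∈ cls W h X 1 1, ∀ y ∈ cls W h X 0 1, ∀ u ∈ cls W h X 0 (-1), T = {z, y, u} →
      0 < c - a * Y z ∧ 0 < b - a + c - a * Y z)
    (h4 : ∀ z ∈ cls W h X 1 1, ∀ v ∈ cls W h X 0 0, ∀ u ∈ cls W h X 0 (-1), T = {z, v, u} →
      0 < a - b ∧ 0 < b - a + c - a * Y z)
    (h5 : ∀ t ∈ cls W h X 1 0, ∀ z ∈ cls W h X 1 1, ∀ v ∈ cls W h X 0 0, T = {t, z, v} →
      0 < b ∧ 0 < a - b ∧ 0 < c - (a - b) * Y t - b * Y z) :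
    PosComb T h X Y a b c := by
  rcases D.mem_iff.1 hT with ⟨t, ht, y, hy, v, hv, e⟩ | ⟨t, ht, y, hy, u, hu, e⟩ |
    ⟨z, hz, y, hy, u, hu, e⟩ | ⟨z, hz, v, hv, u, hu, e⟩ | ⟨t, ht, z, hz, v, hv, e⟩
  · obtain ⟨p1, p2⟩ := h1 t ht y hy v hv e
    rw [e]
    refine posComb_triple_of_int (ne_of_cls ht hy (by simp)) (ne_of_cls ht hv (by simp))
      (ne_of_cls hy hv (by simp)) a b (c - a * Y t) ha p1 p2 ?_ ?_ ?_ <;>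
      simp only [(mem_cls.1 ht).2.1, (mem_cls.1 ht).2.2, (mem_cls.1 hy).2.1,
        (mem_cls.1 hy).2.2, (mem_cls.1 hv).2.1, (mem_cls.1 hv).2.2, D.Y_y hy, D.Y_v hv] <;> ring
  · obtain ⟨p1, p2⟩ := h2 t ht y hy u hu e
    rw [e]
    refine posComb_triple_of_int (ne_of_cls ht hy (by simp)) (ne_of_cls ht hu (by simp))
      (ne_of_cls hy hu (by simp)) a (b + c - a * Y t) (c - a * Y t) ha p2 p1 ?_ ?_ ?_ <;>
      simp only [(mem_cls.1 ht).2.1, (mem_cls.1 ht).2.2, (mem_cls.1 hy).2.1,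
        (mem_cls.1 hy).2.2, (mem_cls.1 hu).2.1, (mem_cls.1 hu).2.2, D.Y_y hy, D.Y_u hu] <;> ring
  · obtain ⟨p1, p2⟩ := h3 z hz y hy u hu e
    rw [e]
    refine posComb_triple_of_int (ne_of_cls hz hy (by simp)) (ne_of_cls hz hu (by simp))
      (ne_of_cls hy hu (by simp)) a (b - a + c - a * Y z) (c - a * Y z) ha p2 p1 ?_ ?_ ?_ <;>
      simp only [(mem_cls.1 hz).2.1, (mem_cls.1 hz).2.2, (mem_cls.1 hy).2.1,
        (mem_cls.1 hy).2.2, (mem_cls.1 hu).2.1, (mem_cls.1 hu).2.2, D.Y_y hy, D.Y_u hu] <;> ring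
  · obtain ⟨p1, p2⟩ := h4 z hz v hv u hu e
    rw [e]
    refine posComb_triple_of_int (ne_of_cls hz hv (by simp)) (ne_of_cls hz hu (by simp))
      (ne_of_cls hv hu (by simp)) a (b - a + c - a * Y z) (a - b) ha p2 p1 ?_ ?_ ?_ <;>
      simp only [(mem_cls.1 hz).2.1, (mem_cls.1 hz).2.2, (mem_cls.1 hv).2.1,
        (mem_cls.1 hv).2.2, (mem_cls.1 hu).2.1, (mem_cls.1 hu).2.2, D.Y_v hv, D.Y_u hu] <;> ring
  · obtain ⟨p1, p2, p3⟩ := h5 t ht z hz v hv e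
    rw [e]
    refine posComb_triple_of_int (ne_of_cls ht hz (by simp)) (ne_of_cls ht hv (by simp))
      (ne_of_cls hz hv (by simp)) (a - b) b (c - (a - b) * Y t - b * Y z) p2 p1 p3 ?_ ?_ ?_ <;>
      simp only [(mem_cls.1 ht).2.1, (mem_cls.1 ht).2.2, (mem_cls.1 hz).2.1,
        (mem_cls.1 hz).2.2, (mem_cls.1 hv).2.1, (mem_cls.1 hv).2.2, D.Y_v hv] <;> ring

theorem sum_h (D : PentData W 𝓣 h X Y) :
    ∑ w ∈ W, h w = (cls W h X 1 0).card + (cls W h X 1 1).card := by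
  rw [D.sum_eq]
  have e : ∀ i j, ∑ w ∈ cls W h X i j, h w = (cls W h X i j).card * i := fun i j => by
    rw [Finset.sum_congr rfl fun w hw => (mem_cls.1 hw).2.1]
    simp
  simp [e]

theorem sum_X (D : PentData W 𝓣 h X Y) : ∑ w ∈ W, X w =
    (cls W h X 0 1).card - (cls W h X 0 (-1)).card + (cls W h X 1 1).card := by
  rw [D.sum_eq]
  have e : ∀ i j, ∑ w ∈ cls W h X i j, X w = (cls W h X i j).card * j := fun i j => by
    rw [Finset.sum_congr rfl fun w hw => (mem_cls.1 hw).2.2]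
    simp
  simp only [e]
  ring

theorem sum_Y (D : PentData W 𝓣 h X Y) : ∑ w ∈ W, Y w =
    (cls W h X 0 0).card + (cls W h X 0 (-1)).card + ∑ w ∈ cls W h X 1 0, Y w +
      ∑ w ∈ cls W h X 1 1, Y w := by
  rw [D.sum_eq, Finset.sum_congr rfl fun w hw => D.Y_y hw,
    Finset.sum_congr rfl fun w hw => D.Y_v hw, Finset.sum_congr rfl fun w hw => D.Y_u hw]
  simp

theorem false_of_two_le (D : PentData W 𝓣 h X Y) (hN : NoUp W 𝓣 h X Y)
    (ht : 2 ≤ (cls W h X 1 0).card) (hk : 2 ≤ ∑ w ∈ W, h w - ∑ w ∈ W, X w) : False := by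
  classical
  obtain ⟨t, ht, t', ht', hne⟩ := Finset.one_lt_card.1 ht
  obtain ⟨z, hz, hz1, hz2⟩ := D.ex_z
  obtain ⟨y, hy, hy1, hy2, -⟩ := D.ex_y
  obtain ⟨u, hu, hu1, hu2, -⟩ := D.ex_u
  have aux : ∀ t ∈ cls W h X 1 0, ∀ T ∈ 𝓣, Slack W T h X Y t := by
    intro t₀ ht₀ T hT
    have := D.tv
    obtain ⟨m0, m1, m2⟩ := mem_cls.1 ht₀
    have b0 := D.ty t₀ m0 m1 m2
    have bt := fun t (ht : t ∈ cls W h X 1 0) =>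
      D.ty t (mem_cls.1 ht).1 (mem_cls.1 ht).2.1 (mem_cls.1 ht).2.2
    have bz := fun z (hz : z ∈ cls W h X 1 1) =>
      D.zu z (mem_cls.1 hz).1 (mem_cls.1 hz).2.1 (mem_cls.1 hz).2.2
    unfold Slack
    rw [m1, m2]
    generalize ∑ w ∈ W, h w = k at *
    generalize ∑ w ∈ W, X w = KX at *
    generalize ∑ w ∈ W, Y w = KY at *
    have hk0 : 0 < k := by omega
    have hk1 : 0 < k - 1 := by omega
    have hk2 : 0 < k - 1 - KX := by omega
    refine D.posComb hT hk1 (fun t ht y hy v hv _ => ⟨by omega, ?_⟩)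
      (fun t ht y hy u hu _ => ?_) (fun z hz y hy u hu _ => ⟨?_, ?_⟩)
      (fun z hz v hv u hu _ => ⟨by omega, ?_⟩) (fun t ht z hz v hv _ => ⟨by omega, by omega, ?_⟩)
    · refine pos_of_mul_pos_right (a := k) ?_ hk0.le
      linarith [mul_pos hk1 (bt t ht)]
    · have : 0 < KY - Y t₀ - (k - 1) * Y t := by
        refine pos_of_mul_pos_right (a := k) ?_ hk0.le
        linarith [mul_pos hk1 (bt t ht)]
      exact ⟨this, by linarith⟩
    · refine pos_of_mul_pos_right (a := k) ?_ hk0.le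
      linarith [mul_pos hk1 ((by omega : 0 < k - KX).trans (bz z hz))]
    · refine pos_of_mul_pos_right (a := k) ?_ hk0.le
      linarith [mul_pos hk1 (sub_pos.2 (bz z hz))]
    · refine pos_of_mul_pos_right (a := k) ?_ hk0.le
      linarith [mul_pos hk1 (sub_pos.2 (bz z hz))]
    · refine pos_of_mul_pos_right (a := k) ?_ hk0.le
      linarith [mul_pos hk2 (bt t ht), mul_pos this ((by omega : 0 < k - KX).trans (bz z hz))]
  have hz' : z ∈ cls W h X 1 1 := mem_cls.2 ⟨hz, hz1, hz2⟩
  have hy' : y ∈ cls W h X 0 1 := mem_cls.2 ⟨hy, hy1, hy2⟩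
  have hu' : u ∈ cls W h X 0 (-1) := mem_cls.2 ⟨hu, hu1, hu2⟩
  refine hN t (mem_cls.1 ht).1 t' (mem_cls.1 ht').1 hne ⟨_, D.mem_iff.2 (Or.inr (Or.inr (Or.inl
    ⟨z, hz', y, hy', u, hu', rfl⟩))), ?_, ?_⟩ (fun T hT _ => aux t ht T hT)
    fun T hT _ => aux t' ht' T hT
  · simp [ne_of_cls ht hz', ne_of_cls ht hy', ne_of_cls ht hu']
  · simp [ne_of_cls ht' hz', ne_of_cls ht' hy', ne_of_cls ht' hu']

theorem false_of_card_eq_one (D : PentData W 𝓣 h X Y) (hN : NoUp W 𝓣 h X Y)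
    (ht : 2 ≤ (cls W h X 1 0).card) (hz : (cls W h X 1 1).card = 1)
    (hk : 2 ≤ ∑ w ∈ W, X w) : False := by
  classical
  obtain ⟨t, ht, t', ht', hne⟩ := Finset.one_lt_card.1 ht
  obtain ⟨z, hz⟩ := Finset.card_eq_one.1 hz
  obtain ⟨y, hy, hy1, hy2, -⟩ := D.ex_y
  obtain ⟨v, hv, hv1, hv2, -⟩ := D.ex_v
  have hz' : z ∈ cls W h X 1 1 := by rw [hz]; exact Finset.mem_singleton_self z
  have hzz : ∀ w ∈ cls W h X 1 1, w = z := fun w hw => by rwa [hz, Finset.mem_singleton] at hw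
  have hy' : y ∈ cls W h X 0 1 := mem_cls.2 ⟨hy, hy1, hy2⟩
  have hv' : v ∈ cls W h X 0 0 := mem_cls.2 ⟨hv, hv1, hv2⟩
  have := D.tv
  have := D.zv
  have bt := fun t (ht : t ∈ cls W h X 1 0) =>
    D.ty t (mem_cls.1 ht).1 (mem_cls.1 ht).2.1 (mem_cls.1 ht).2.2
  obtain ⟨m0, m1, m2⟩ := mem_cls.1 hz'
  have bz := D.zu z m0 m1 m2
  refine hN t (mem_cls.1 ht).1 z m0 (ne_of_cls ht hz' (by simp)) ⟨_, D.mem_iff.2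
    (Or.inl ⟨t', ht', y, hy', v, hv', rfl⟩), ?_, ?_⟩ (fun T hT hzT => ?_) (fun T hT _ => ?_)
  · simp [ne_of_cls ht hv', ne_of_cls ht hy', hne]
  · simp [ne_of_cls hz' hv', ne_of_cls hz' hy', ne_of_cls hz' ht']
  · unfold Slack
    obtain ⟨-, n1, n2⟩ := mem_cls.1 ht
    rw [n1, n2]
    have b0 := bt t ht
    generalize ∑ w ∈ W, h w = k at *
    generalize ∑ w ∈ W, X w = KX at *
    generalize ∑ w ∈ W, Y w = KY at *
    have hk0 : 0 < k := by omega
    have hk1 : 0 < k - 1 := by omega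
    have b1 : ∀ t₀ ∈ cls W h X 1 0, 0 < KY - Y t - (k - 1) * Y t₀ := fun t₀ ht₀ => by
      refine pos_of_mul_pos_right (a := k) ?_ hk0.le
      linarith [mul_pos hk1 (bt t₀ ht₀)]
    refine D.posComb hT hk1 (fun t ht y hy v hv _ => ⟨by omega, b1 t ht⟩)
      (fun t ht y hy u hu _ => ⟨b1 t ht, by linarith [b1 t ht]⟩) (fun w hw y hy u hu e => ?_)
      (fun w hw v hv u hu e => ?_) (fun t ht w hw v hv e => ?_) <;>
    · rw [hzz w hw] at e
      exact absurd hzT (by simp [e])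
  · unfold Slack
    rw [m1, m2]
    generalize ∑ w ∈ W, h w = k at *
    generalize ∑ w ∈ W, X w = KX at *
    generalize ∑ w ∈ W, Y w = KY at *
    have hk0 : 0 < k := by omega
    have hk1 : 0 < k - 1 := by omega
    have hk2 : 0 < k - KX := by omega
    have b1 : ∀ t₀ ∈ cls W h X 1 0, 0 < KY - Y z - (k - 1) * Y t₀ := fun t₀ ht₀ => by
      refine pos_of_mul_pos_right (a := k) ?_ hk0.le
      linarith [mul_pos hk1 (bt t₀ ht₀)]
    refine D.posComb hT hk1 (fun t ht y hy v hv _ => ⟨by omega, b1 t ht⟩)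
      (fun t ht y hy u hu _ => ⟨b1 t ht, by linarith [b1 t ht]⟩)
      (fun w hw y hy u hu _ => ?_) (fun w hw v hv u hu _ => ?_)
      (fun t ht w hw v hv _ => ⟨by omega, by omega, ?_⟩)
    · rw [hzz w hw]
      exact ⟨by linarith, by linarith⟩
    · rw [hzz w hw]
      exact ⟨by linarith, by linarith⟩
    · rw [hzz w hw]
      refine pos_of_mul_pos_right (a := k) ?_ hk0.le
      linarith [mul_pos hk2 (bt t ht), mul_pos (by omega : 0 < KX) (hk2.trans bz)]

theorem sum_h_eq_two (D : PentData W 𝓣 h X Y) (hN : NoUp W 𝓣 h X Y) : ∑ w ∈ W, h w = 2 := by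
  have h1 := D.tv
  have h2 := D.zv
  by_contra hne
  have hs := D.sum_h
  have hs' := D.symm.sum_h
  have main : ∀ {X Y : (Fin n → ℝ) → ℤ}, PentData W 𝓣 h X Y → NoUp W 𝓣 h X Y →
      2 ≤ (cls W h X 1 0).card → False := by
    intro X Y D hN ht
    have h1 := D.tv
    have h2 := D.zv
    have hs := D.sum_h
    by_cases h3 : 2 ≤ ∑ w ∈ W, h w - ∑ w ∈ W, X w
    · exact D.false_of_two_le hN ht h3
    · by_cases hz : (cls W h X 1 1).card = 1
      · exact D.false_of_card_eq_one hN ht hz (by omega)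
      · have : 0 < (cls W h X 1 1).card := by
          obtain ⟨z, hz⟩ := D.ex_z
          exact Finset.card_pos.2 ⟨z, mem_cls.2 hz⟩
        refine D.symm.false_of_two_le hN.pent_symm ?_ ?_
        · rw [cls_sub, sub_zero]
          omega
        · rw [Finset.sum_sub_distrib]
          omega
  by_cases ht : 2 ≤ (cls W h X 1 0).card
  · exact main D hN ht
  · refine main D.symm hN.pent_symm ?_
    rw [cls_sub, sub_zero]
    omega

end PentData

theorem FanData.exists_cofacet {n : ℕ} {W : Finset (Fin n → ℝ)} {𝓕 : Set (Finset (Fin n → ℝ))}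
    (H : FanData W 𝓕) {F : Finset (Fin n → ℝ)} (hF : F ∈ 𝓕) :
    ∃ T ∈ cofacets W 𝓕, F = W \ T :=
  ⟨W \ F, ⟨Finset.sdiff_subset, by rwa [Finset.sdiff_sdiff_eq_self (H.subset F hF)]⟩,
    (Finset.sdiff_sdiff_eq_self (H.subset F hF)).symm⟩

namespace PentData

variable {n : ℕ} {W : Finset (Fin n → ℝ)} {𝓣 : Set (Finset (Fin n → ℝ))}
  {h X Y : (Fin n → ℝ) → ℤ}

/-- The total sum in the case of exactly one vertex of each of the two classes of height one. -/
theorem exists_unique_tz (D : PentData W 𝓣 h X Y) (hk : ∑ w ∈ W, h w = 2) :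
    ∃ t z, cls W h X 1 0 = {t} ∧ cls W h X 1 1 = {z} ∧ ∑ w ∈ W, X w = 1 ∧
      (cls W h X 0 1).card = (cls W h X 0 (-1)).card ∧
      ∑ w ∈ W, Y w = (cls W h X 0 0).card + (cls W h X 0 (-1)).card + Y t + Y z ∧
      0 < ∑ w ∈ W, Y w - 2 * Y t ∧ 1 < ∑ w ∈ W, Y w - 2 * Y z := by
  obtain ⟨t₀, ht₀⟩ := D.ex_t
  obtain ⟨z₀, hz₀⟩ := D.ex_z
  have c1 := Finset.card_pos.2 ⟨t₀, mem_cls.2 ht₀⟩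
  have c2 := Finset.card_pos.2 ⟨z₀, mem_cls.2 hz₀⟩
  have hs := D.sum_h
  have hX : ∑ w ∈ W, X w = 1 := by
    have := D.tv
    have := D.zv
    omega
  have hsX := D.sum_X
  obtain ⟨t, ht⟩ := Finset.card_eq_one.1 (by omega : (cls W h X 1 0).card = 1)
  obtain ⟨z, hz⟩ := Finset.card_eq_one.1 (by omega : (cls W h X 1 1).card = 1)
  have hsY := D.sum_Y
  rw [ht, hz, Finset.sum_singleton, Finset.sum_singleton] at hsY
  obtain ⟨m0, m1, m2⟩ := mem_cls.1 (ht ▸ Finset.mem_singleton_self t : t ∈ cls W h X 1 0)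
  obtain ⟨m0', m1', m2'⟩ := mem_cls.1 (hz ▸ Finset.mem_singleton_self z : z ∈ cls W h X 1 1)
  have b1 := D.ty t m0 m1 m2
  have b2 := D.zu z m0' m1' m2'
  rw [hk] at b1 b2
  have : (cls W h X 1 1).card = 1 := by rw [hz]; rfl
  exact ⟨t, z, ht, hz, hX, by omega, hsY, b1, by omega⟩

theorem slack_v (D : PentData W 𝓣 h X Y) (hk : ∑ w ∈ W, h w = 2) (hX : ∑ w ∈ W, X w = 1)
    {v : Fin n → ℝ} (hv : v ∈ cls W h X 0 0)
    (ht : ∀ t ∈ cls W h X 1 0, 2 ≤ ∑ w ∈ W, Y w - 2 * Y t) {T : Finset (Fin n → ℝ)} (hT : T ∈ 𝓣)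
    (hz : ∀ z ∈ cls W h X 1 1, z ∈ T → 3 ≤ ∑ w ∈ W, Y w - 2 * Y z) : Slack W T h X Y v := by
  classical
  unfold Slack
  obtain ⟨m0, m1, m2⟩ := mem_cls.1 hv
  rw [m1, m2, D.Y_v hv, hk, hX]
  refine D.posComb hT (by norm_num) (fun t ht' y hy v hv _ => ⟨by norm_num, ?_⟩)
    (fun t ht' y hy u hu _ => ?_) (fun z hz' y hy u hu e => ?_)
    (fun z hz' v hv u hu e => ⟨by norm_num, ?_⟩)
    (fun t ht' z hz' v hv e => ⟨by norm_num, by norm_num, ?_⟩)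
  · linarith [ht t ht']
  · constructor <;> linarith [ht t ht']
  · constructor <;> linarith [hz z hz' (by simp [e])]
  · linarith [hz z hz' (by simp [e])]
  · linarith [hz z hz' (by simp [e]), ht t ht']

theorem false_of_one_lt (D : PentData W 𝓣 h X Y) (hN : NoUp W 𝓣 h X Y)
    (hk : ∑ w ∈ W, h w = 2) (hv : 1 < (cls W h X 0 0).card)
    (ht : ∀ t ∈ cls W h X 1 0, 2 ≤ ∑ w ∈ W, Y w - 2 * Y t)
    (hz : ∀ z ∈ cls W h X 1 1, 3 ≤ ∑ w ∈ W, Y w - 2 * Y z) : False := by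
  classical
  obtain ⟨-, -, -, -, hX, -⟩ := D.exists_unique_tz hk
  obtain ⟨v, hv, v', hv', hne⟩ := Finset.one_lt_card.1 hv
  obtain ⟨t, ht'⟩ := D.ex_t
  obtain ⟨y, hy, hy1, hy2, -⟩ := D.ex_y
  obtain ⟨u, hu, hu1, hu2, -⟩ := D.ex_u
  rw [← mem_cls] at ht'
  have hy' : y ∈ cls W h X 0 1 := mem_cls.2 ⟨hy, hy1, hy2⟩
  have hu' : u ∈ cls W h X 0 (-1) := mem_cls.2 ⟨hu, hu1, hu2⟩
  refine hN v (mem_cls.1 hv).1 v' (mem_cls.1 hv').1 hne ⟨_, D.mem_iff.2 (Or.inr (Or.inl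
    ⟨t, ht', y, hy', u, hu', rfl⟩)), ?_, ?_⟩
    (fun T hT _ => D.slack_v hk hX hv ht hT fun z hz' _ => hz z hz')
    fun T hT _ => D.slack_v hk hX hv' ht hT fun z hz' _ => hz z hz'
  · simp [ne_of_cls hv ht', ne_of_cls hv hy', ne_of_cls hv hu']
  · simp [ne_of_cls hv' ht', ne_of_cls hv' hy', ne_of_cls hv' hu']

theorem false_of_card_v_eq_one (D : PentData W 𝓣 h X Y) (hN : NoUp W 𝓣 h X Y)
    (hk : ∑ w ∈ W, h w = 2) (hv : (cls W h X 0 0).card = 1)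
    (ht : ∀ t ∈ cls W h X 1 0, 2 ≤ ∑ w ∈ W, Y w - 2 * Y t) : False := by
  classical
  obtain ⟨t, z, et, ez, hX, -, hY, -, hz2⟩ := D.exists_unique_tz hk
  obtain ⟨v, ev⟩ := Finset.card_eq_one.1 hv
  obtain ⟨y, hy, hy1, hy2, -⟩ := D.ex_y
  obtain ⟨u, hu, hu1, hu2, -⟩ := D.ex_u
  have ht' : t ∈ cls W h X 1 0 := et ▸ Finset.mem_singleton_self t
  have hz' : z ∈ cls W h X 1 1 := ez ▸ Finset.mem_singleton_self z
  have hv' : v ∈ cls W h X 0 0 := ev ▸ Finset.mem_singleton_self v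
  have hy' : y ∈ cls W h X 0 1 := mem_cls.2 ⟨hy, hy1, hy2⟩
  have hu' : u ∈ cls W h X 0 (-1) := mem_cls.2 ⟨hu, hu1, hu2⟩
  have tt : ∀ w ∈ cls W h X 1 0, w = t := fun w hw => by rwa [et, Finset.mem_singleton] at hw
  have zz : ∀ w ∈ cls W h X 1 1, w = z := fun w hw => by rwa [ez, Finset.mem_singleton] at hw
  have vv : ∀ w ∈ cls W h X 0 0, w = v := fun w hw => by rwa [ev, Finset.mem_singleton] at hw
  refine hN v (mem_cls.1 hv').1 z (mem_cls.1 hz').1 (ne_of_cls hv' hz' (by simp)) ⟨_,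
    D.mem_iff.2 (Or.inr (Or.inl ⟨t, ht', y, hy', u, hu', rfl⟩)), ?_, ?_⟩
    (fun T hT hzT => D.slack_v hk hX hv' ht hT fun w hw hw' => ?_) fun T hT hvT => ?_
  · simp [ne_of_cls hv' ht', ne_of_cls hv' hy', ne_of_cls hv' hu']
  · simp [ne_of_cls hz' ht', ne_of_cls hz' hy', ne_of_cls hz' hu']
  · rw [zz w hw] at hw'
    exact absurd hw' hzT
  · unfold Slack
    rw [(mem_cls.1 hz').2.1, (mem_cls.1 hz').2.2, hk, hX]
    refine D.posComb hT (by norm_num) (fun t' ht' y hy w hw e => ?_)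
      (fun t' ht' y hy u hu _ => ?_) (fun z' hz' y hy u hu e => ?_)
      (fun z' hz' w hw u hu e => ?_) (fun t' ht' z' hz' w hw e => ?_)
    · rw [vv w hw] at e
      exact absurd (by simp [e]) hvT
    · rw [tt t' ht']
      have : 0 < (cls W h X 0 (-1)).card := Finset.card_pos.2 ⟨u, hu⟩
      constructor <;> linarith
    · rw [zz z' hz']
      constructor <;> linarith
    · rw [vv w hw] at e
      exact absurd (by simp [e]) hvT
    · rw [vv w hw] at e
      exact absurd (by simp [e]) hvT

end PentData

namespace PentData

variable {n : ℕ} {W : Finset (Fin n → ℝ)} {𝓕 : Set (Finset (Fin n → ℝ))}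
  {h X Y : (Fin n → ℝ) → ℤ}

theorem exists_dual {𝓣 : Set (Finset (Fin n → ℝ))} (D : PentData W 𝓣 h X Y)
    (hk : ∑ w ∈ W, h w = 2) {t u v : Fin n → ℝ} (ht : t ∈ cls W h X 1 0)
    (hu : u ∈ cls W h X 0 (-1)) (hv : v ∈ cls W h X 0 0) :
    ∃ g : Module.Dual ℝ (Fin n → ℝ), g t < 1 ∧ g v < 1 ∧
      ∀ w ∈ W, w ≠ t → w ≠ u → w ≠ v → g w = 1 := by
  classical
  obtain ⟨t', z, et, -, hX, -, hY, hβ, -⟩ := D.exists_unique_tz hk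
  obtain rfl : t = t' := by rwa [et, Finset.mem_singleton] at ht
  set β : ℤ := ∑ w ∈ W, Y w - 2 * Y t with hβ'
  set f : (Fin n → ℝ) → ℝ := fun w => 1 - (2 * (if w = t then 1 else 0) -
    (if w = u then 1 else 0) + (β + 1) * (if w = v then 1 else 0)) with hf
  obtain ⟨mt, t1, t2⟩ := mem_cls.1 ht
  obtain ⟨mu, u1, u2⟩ := mem_cls.1 hu
  obtain ⟨mv, v1, v2⟩ := mem_cls.1 hv
  have htu : t ≠ u := ne_of_cls ht hu (by simp)
  have htv : t ≠ v := ne_of_cls ht hv (by simp)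
  have huv : u ≠ v := ne_of_cls hu hv (by simp)
  have key : ∀ Z : (Fin n → ℝ) → ℤ, ∑ w ∈ W, f w * Z w =
      (∑ w ∈ W, Z w : ℤ) - (2 * Z t - Z u + (β + 1) * Z v) := fun Z => by
    have : ∀ w ∈ W, f w * Z w = (Z w : ℝ) - (2 * (if w = t then (Z w : ℝ) else 0) -
      (if w = u then (Z w : ℝ) else 0) + (β + 1) * (if w = v then (Z w : ℝ) else 0)) :=
      fun w _ => by simp only [hf]; split_ifs <;> ring
    rw [Finset.sum_congr rfl this]
    simp only [Finset.sum_sub_distrib, Finset.sum_add_distrib, ← Finset.mul_sum,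
      Finset.sum_ite_eq', if_pos mt, if_pos mu, if_pos mv]
    push_cast
    ring
  obtain ⟨g, hg⟩ := D.gale.ext f (by rw [key, hk, t1, u1, v1]; norm_num)
    (by rw [key, hX, t2, u2, v2]; norm_num)
    (by rw [key, D.Y_u hu, D.Y_v hv, hβ']; push_cast; ring)
  have hβ0 : (0 : ℝ) < β := by exact_mod_cast hβ
  refine ⟨g, ?_, ?_, fun w hw h1 h2 h3 => ?_⟩
  · rw [hg t mt]
    simp only [hf, if_pos, if_neg htu, if_neg htv]
    norm_num
  · rw [hg v mv]
    simp only [hf, if_pos, if_neg htv.symm, if_neg huv.symm]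
    linarith
  · rw [hg w hw]
    simp [hf, h1, h2, h3]

theorem not_fIsolated_of_card_eq_one (D : PentData W (cofacets W 𝓕) h X Y) (hn : 2 ≤ n)
    (hF : FanData W 𝓕) (hk : ∑ w ∈ W, h w = 2) (hy : (cls W h X 0 1).card = 1) :
    ¬ FIsolated (convexHull ℝ (W : Set (Fin n → ℝ))) := by
  classical
  obtain ⟨t, z, et, ez, hX, hyu, -⟩ := D.exists_unique_tz hk
  obtain ⟨y, ey⟩ := Finset.card_eq_one.1 hy
  obtain ⟨u, eu⟩ := Finset.card_eq_one.1 (hyu ▸ hy)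
  have ht' : t ∈ cls W h X 1 0 := et ▸ Finset.mem_singleton_self t
  have hz' : z ∈ cls W h X 1 1 := ez ▸ Finset.mem_singleton_self z
  have hy' : y ∈ cls W h X 0 1 := ey ▸ Finset.mem_singleton_self y
  have hu' : u ∈ cls W h X 0 (-1) := eu ▸ Finset.mem_singleton_self u
  have huyz : y + z = u := by
    have := D.gale.rel_X
    rw [D.sum_eq, et, ez, ey, eu, Finset.sum_singleton, Finset.sum_singleton,
      Finset.sum_singleton, Finset.sum_singleton, Finset.sum_eq_zero (s := cls W h X 0 0)
      fun w hw => by simp [(mem_cls.1 hw).2.2], (mem_cls.1 hy').2.2, (mem_cls.1 hu').2.2,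
      (mem_cls.1 ht').2.2, (mem_cls.1 hz').2.2] at this
    push_cast at this
    rw [← sub_eq_zero, ← this]
    module
  have hyz : y ≠ z := ne_of_cls hy' hz' (by simp)
  have hyt : y ≠ t := ne_of_cls hy' ht' (by simp)
  have hzt : z ≠ t := ne_of_cls hz' ht' (by simp)
  have hut : u ≠ t := ne_of_cls hu' ht' (by simp)
  have huy : u ≠ y := ne_of_cls hu' hy' (by simp)
  have huz : u ≠ z := ne_of_cls hu' hz' (by simp)
  have mW : ∀ {w i j}, w ∈ cls W h X i j → w ∈ W := fun hw => (mem_cls.1 hw).1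
  have types : ∀ T ∈ cofacets W 𝓕,
      (∃ v ∈ cls W h X 0 0, T = {t, y, v}) ∨ T = {t, y, u} ∨ T = {z, y, u} ∨
      (∃ v ∈ cls W h X 0 0, T = {z, v, u}) ∨ (∃ v ∈ cls W h X 0 0, T = {t, z, v}) := by
    intro T hT
    have := D.mem_iff.1 hT
    simp only [et, ez, ey, eu, Finset.mem_singleton, exists_eq_left] at this
    convert this using 5
  have hu_facets : ∀ F ∈ 𝓕, u ∈ F → ∃ v ∈ cls W h X 0 0, F = W \ {t, y, v} ∨ F = W \ {t, z, v} := by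
    intro F hF' huF
    obtain ⟨T, hT, rfl⟩ := hF.exists_cofacet hF'
    rcases types T hT with ⟨v, hv, rfl⟩ | rfl | rfl | ⟨v, hv, rfl⟩ | ⟨v, hv, rfl⟩
    · exact ⟨v, hv, Or.inl (by congr)⟩
    · simp at huF
    · simp at huF
    · simp at huF
    · exact ⟨v, hv, Or.inr (by congr)⟩
  have f1 : ∀ v ∈ cls W h X 0 0, W \ {t, y, v} ∈ 𝓕 := fun v hv => by
    have := (D.mem_iff.2 (Or.inl ⟨t, ht', y, hy', v, hv, rfl⟩)).2
    convert this
  have f2 : ∀ v ∈ cls W h X 0 0, W \ {t, z, v} ∈ 𝓕 := fun v hv => by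
    have := (D.mem_iff.2 (Or.inr (Or.inr (Or.inr (Or.inr ⟨t, ht', z, hz', v, hv, rfl⟩))))).2
    convert this
  have nv : ∀ v ∈ cls W h X 0 0, y ≠ v ∧ z ≠ v ∧ u ≠ v := fun v hv =>
    ⟨ne_of_cls hy' hv (by simp), ne_of_cls hz' hv (by simp), ne_of_cls hu' hv (by simp)⟩
  refine hF.not_fIsolated_of_erase hn (mW hy') (mW hz') hyz (huyz ▸ mW hu') ?_ ?_ ?_ ?_ ?_ <;>
    rw [huyz]
  · intro F hF' huF
    obtain ⟨v, hv, rfl | rfl⟩ := hu_facets F hF' huF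
    · right; simp [mW hz', hyz.symm, hzt, nv v hv]
    · left; simp [mW hy', hyz, hyt, nv v hv]
  · intro F hF' huF hyF
    obtain ⟨v, hv, rfl | rfl⟩ := hu_facets F hF' huF
    · simp at hyF
    · convert f1 v hv using 1
      ext w
      have := nv v hv
      have := mW hz'
      simp only [Finset.mem_insert, Finset.mem_erase, Finset.mem_sdiff, Finset.mem_singleton]
      grind
  · intro F hF' huF hyF
    obtain ⟨v, hv, rfl | rfl⟩ := hu_facets F hF' huF
    · convert f2 v hv using 1
      ext w
      have := nv v hv
      have := mW hy'
      simp only [Finset.mem_insert, Finset.mem_erase, Finset.mem_sdiff, Finset.mem_singleton]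
      grind
    · simp at hyF
  · intro F hF' huF hyz'
    obtain ⟨T, hT, rfl⟩ := hF.exists_cofacet hF'
    have := mW hu'
    rcases types T hT with ⟨v, hv, rfl⟩ | rfl | rfl | ⟨v, hv, rfl⟩ | ⟨v, hv, rfl⟩
    · simp at hyz'
    · simp at hyz'
    · simp at hyz'
    · simp at hyz'
    · simp at hyz'
  · intro F hF' huF
    obtain ⟨v, hv, hv'⟩ := hu_facets F hF' huF
    obtain ⟨g, g1, g2, g3⟩ := D.exists_dual hk ht' hu' hv
    have e : ∀ w, w ∈ insert y (insert z (F.erase u)) ↔ w ∈ W ∧ w ≠ t ∧ w ≠ u ∧ w ≠ v := by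
      intro w
      have := nv v hv
      have := mW hy'
      have := mW hz'
      rcases hv' with rfl | rfl <;>
      simp only [Finset.mem_insert, Finset.mem_erase, Finset.mem_sdiff, Finset.mem_singleton] <;>
      grind
    refine ⟨g, fun w hw => ?_, fun w hw hwu hw' => ?_⟩
    · have hw := (e w).1 (by convert hw)
      exact g3 w hw.1 hw.2.1 hw.2.2.1 hw.2.2.2
    · have hw' : ¬ (w ∈ W ∧ w ≠ t ∧ w ≠ u ∧ w ≠ v) := fun hh => hw' (by convert (e w).2 hh)
      by_cases hwt : w = t
      · rwa [hwt]
      · have : w = v := by tauto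
        rwa [this]

end PentData

theorem FanData.exists_pentData {n : ℕ} {W : Finset (Fin n → ℝ)}
    {𝓕 : Set (Finset (Fin n → ℝ))} (hF : FanData W 𝓕) (hn : 2 ≤ n) (hcard : W.card = n + 3)
    (hI : FIsolated (convexHull ℝ (W : Set (Fin n → ℝ)))) :
    ∃ h X Y, PentData W (cofacets W 𝓕) h X Y ∧ ∑ w ∈ W, h w = 2 ∧ 2 ≤ (cls W h X 0 0).card ∧
      2 ≤ (cls W h X 0 1).card ∧ ∀ z ∈ cls W h X 1 1, ∑ w ∈ W, Y w - 2 * Y z = 2 := by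
  obtain ⟨h, X, Y, G⟩ := hF.exists_galeData hcard
  obtain ⟨X, Y, D, hN⟩ := G.exists_pentData (hF.noUp hn hI G)
  have hk := D.sum_h_eq_two hN
  have hyne : (cls W h X 0 1).card ≠ 1 := fun h1 => D.not_fIsolated_of_card_eq_one hn hF hk h1 hI
  have hy0 : 0 < (cls W h X 0 1).card := by
    obtain ⟨y, hy, h1, h2, -⟩ := D.ex_y
    exact Finset.card_pos.2 ⟨y, mem_cls.2 ⟨hy, h1, h2⟩⟩
  have hv0 : 0 < (cls W h X 0 0).card := by
    obtain ⟨y, hy, h1, h2, -⟩ := D.ex_v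
    exact Finset.card_pos.2 ⟨y, mem_cls.2 ⟨hy, h1, h2⟩⟩
  obtain ⟨t, z, et, ez, hX, hyu, hY, ht, hz⟩ := D.exists_unique_tz hk
  have symm_t : ∀ w ∈ cls W h (fun w => h w - X w) 1 0,
      ∑ w ∈ W, (X w + Y w) - 2 * (X w + Y w) = ∑ w ∈ W, Y w - 2 * Y z - 1 := fun w hw => by
    rw [cls_sub, sub_zero] at hw
    rw [Finset.sum_add_distrib, hX, (mem_cls.1 hw).2.2]
    rw [ez, Finset.mem_singleton] at hw
    rw [hw]
    ring
  have symm_z : ∀ w ∈ cls W h (fun w => h w - X w) 1 1,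
      ∑ w ∈ W, (X w + Y w) - 2 * (X w + Y w) = ∑ w ∈ W, Y w - 2 * Y t + 1 := fun w hw => by
    rw [cls_sub, sub_self] at hw
    rw [Finset.sum_add_distrib, hX, (mem_cls.1 hw).2.2]
    rw [et, Finset.mem_singleton] at hw
    rw [hw]
    ring
  have hvne : (cls W h X 0 0).card ≠ 1 := fun h1 => by
    by_cases hβ : 2 ≤ ∑ w ∈ W, Y w - 2 * Y t
    · refine D.false_of_card_v_eq_one hN hk h1 fun w hw => ?_
      rw [et, Finset.mem_singleton] at hw
      rwa [hw]
    · refine D.symm.false_of_card_v_eq_one hN.pent_symm hk (by rwa [cls_sub, sub_zero])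
        fun w hw => ?_
      rw [symm_t w hw]
      omega
  by_cases hγ : ∑ w ∈ W, Y w - 2 * Y z = 2
  · refine ⟨h, X, Y, D, hk, by omega, by omega, fun w hw => ?_⟩
    rw [ez, Finset.mem_singleton] at hw
    rwa [hw]
  · by_cases hβ : 2 ≤ ∑ w ∈ W, Y w - 2 * Y t
    · refine (D.false_of_one_lt hN hk (by omega) (fun w hw => ?_) fun w hw => ?_).elim
      · rw [et, Finset.mem_singleton] at hw
        rwa [hw]
      · rw [ez, Finset.mem_singleton] at hw
        rw [hw]
        omega
    · refine ⟨h, _, _, D.symm, hk, ?_, ?_, fun w hw => ?_⟩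
      · rw [cls_sub, sub_zero]
        omega
      · rw [cls_sub, zero_sub]
        omega
      · rw [symm_z w hw]
        omega

theorem exists_triple_of_pentagon (g : Fin 5 → Prop) (good : ∀ i, g i ∨ g (i + 1)) :
    ∃ i, g i ∧ g (i + 1) ∧ g (i + 3) := by
  have h0 : g 0 ∨ g 1 := good 0
  have h1 : g 1 ∨ g 2 := good 1
  have h2 : g 2 ∨ g 3 := good 2
  have h3 : g 3 ∨ g 4 := good 3
  have h4 : g 4 ∨ g 0 := good 4
  by_contra hne
  push Not at hne
  have k0 : g 0 → g 1 → ¬ g 3 := hne 0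
  have k1 : g 1 → g 2 → ¬ g 4 := hne 1
  have k2 : g 2 → g 3 → ¬ g 0 := hne 2
  have k3 : g 3 → g 4 → ¬ g 1 := hne 3
  have k4 : g 4 → g 0 → ¬ g 2 := hne 4
  tauto

section Pentagon

variable {n : ℕ} {W : Finset (Fin n → ℝ)} {𝓕 : Set (Finset (Fin n → ℝ))}
  {c : Fin 5 → Finset (Fin n → ℝ)}

open Classical in
theorem isFaceOf_iff_of_pentagon (H : FanData W 𝓕) (hn : 1 ≤ n)
    (hT : ∀ T, T ∈ cofacets W 𝓕 ↔ ∃ i, ∃ p ∈ c i, ∃ q ∈ c (i + 1), ∃ r ∈ c (i + 3), T = {p, q, r})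
    {A : Set (Fin n → ℝ)} (hA : A ⊆ W) (hAW : A ≠ W) :
    IsFaceOf (convexHull ℝ A) (convexHull ℝ (W : Set (Fin n → ℝ))) ↔
      ∀ i, ¬ ((c i : Set (Fin n → ℝ)) ∪ c (i + 1) ⊆ A) := by
  lift A to Finset (Fin n → ℝ) using W.finite_toSet.subset hA
  rw [H.isFaceOf_iff hn (by exact_mod_cast hA) (by exact_mod_cast hAW)]
  constructor
  · rintro ⟨F, hF, hAF⟩ i hi
    obtain ⟨T, hT', rfl⟩ := H.exists_cofacet hF
    obtain ⟨j, p, hp, q, hq, r, hr, rfl⟩ := (hT T).1 hT'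
    have key : ∀ i j : Fin 5, j = i ∨ j = i + 1 ∨ j + 1 = i ∨ j + 1 = i + 1 ∨ j + 3 = i ∨
      j + 3 = i + 1 := by decide
    have out : ∀ w, w = p ∨ w = q ∨ w = r → w ∉ c i ∧ w ∉ c (i + 1) := fun w hw => by
      have : w ∉ A := fun h => by
        have := hAF h
        simp only [Finset.mem_sdiff, Finset.mem_insert, Finset.mem_singleton] at this
        exact this.2 hw
      exact ⟨fun h => this (hi (Or.inl h)), fun h => this (hi (Or.inr h))⟩
    have hp' := out p (by simp)
    have hq' := out q (by simp)
    have hr' := out r (by simp)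
    rcases key i j with e | e | e | e | e | e
    · exact hp'.1 (e ▸ hp)
    · exact hp'.2 (e ▸ hp)
    · exact hq'.1 (e ▸ hq)
    · exact hq'.2 (e ▸ hq)
    · exact hr'.1 (e ▸ hr)
    · exact hr'.2 (e ▸ hr)
  · intro hA'
    have good : ∀ i, (∃ w ∈ c i, w ∉ A) ∨ ∃ w ∈ c (i + 1), w ∉ A := fun i => by
      by_contra hne
      push Not at hne
      exact hA' i (Set.union_subset hne.1 hne.2)
    obtain ⟨i, ⟨p, hp, hpA⟩, ⟨q, hq, hqA⟩, r, hr, hrA⟩ : ∃ i, (∃ w ∈ c i, w ∉ A) ∧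
        (∃ w ∈ c (i + 1), w ∉ A) ∧ ∃ w ∈ c (i + 3), w ∉ A := by
      exact exists_triple_of_pentagon (fun i => ∃ w ∈ c i, w ∉ A) good
    have hm := ((hT {p, q, r}).2 ⟨i, p, hp, q, hq, r, hr, rfl⟩).2
    refine ⟨_, hm, fun w hw => ?_⟩
    simp only [Finset.mem_sdiff, Finset.mem_insert, Finset.mem_singleton, not_or]
    exact ⟨hA hw, fun e => hpA (e ▸ hw), fun e => hqA (e ▸ hw), fun e => hrA (e ▸ hw)⟩

open Classical in
theorem isPrimitiveCollection_iff_of_pentagon (H : FanData W 𝓕) (hn : 1 ≤ n)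
    (hne : ∀ i, (c i).Nonempty) (hcW : ∀ i, c i ⊆ W)
    (hc : ∀ i j w, w ∈ c i → w ∈ c j → i = j)
    (hT : ∀ T, T ∈ cofacets W 𝓕 ↔ ∃ i, ∃ p ∈ c i, ∃ q ∈ c (i + 1), ∃ r ∈ c (i + 3), T = {p, q, r})
    {A : Set (Fin n → ℝ)} :
    IsPrimitiveCollection (convexHull ℝ (W : Set (Fin n → ℝ))) A ↔
      ∃ i, A = (c i : Set (Fin n → ℝ)) ∪ c (i + 1) := by
  have face := fun {A : Set (Fin n → ℝ)} (hA : A ⊆ W) (hAW : A ≠ W) =>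
    isFaceOf_iff_of_pentagon H hn hT hA hAW
  have hS : ∀ i, (c i : Set (Fin n → ℝ)) ∪ c (i + 1) ⊆ W := fun i =>
    Set.union_subset (by exact_mod_cast hcW i) (by exact_mod_cast hcW (i + 1))
  have hout : ∀ i, ∃ x ∈ W, x ∉ (c i : Set (Fin n → ℝ)) ∪ c (i + 1) := fun i => by
    obtain ⟨x, hx⟩ := hne (i + 2)
    have key : ∀ i : Fin 5, i + 2 ≠ i ∧ i + 2 ≠ i + 1 := by decide
    refine ⟨x, hcW _ hx, ?_⟩
    rintro (h | h)
    · exact (key i).1 (hc _ _ _ hx h)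
    · exact (key i).2 (hc _ _ _ hx h)
  have hSne : ∀ i, (c i : Set (Fin n → ℝ)) ∪ c (i + 1) ≠ W := fun i e => by
    obtain ⟨x, hx, hx'⟩ := hout i
    exact hx' (e ▸ hx)
  have anti : ∀ i j, (c j : Set (Fin n → ℝ)) ∪ c (j + 1) ⊆ c i ∪ c (i + 1) → j = i := by
    intro i j hs
    have key : ∀ i j : Fin 5, (j = i ∨ j = i + 1) → (j + 1 = i ∨ j + 1 = i + 1) → j = i := by
      decide
    have aux : ∀ k, (c k : Set (Fin n → ℝ)) ⊆ c i ∪ c (i + 1) → k = i ∨ k = i + 1 := fun k hk => by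
      obtain ⟨x, hx⟩ := hne k
      exact (hk hx).imp (hc _ _ _ hx) (hc _ _ _ hx)
    exact key i j (aux _ (Set.subset_union_left.trans hs)) (aux _ (Set.subset_union_right.trans hs))
  unfold IsPrimitiveCollection
  rw [H.vertexSet_eq]
  constructor
  · rintro ⟨-, hA, hnf, hf⟩
    have hsub : ∀ x ∈ A, A \ {x} ⊆ W := fun x _ => Set.sdiff_subset.trans hA
    have hsubne : ∀ x ∈ A, A \ {x} ≠ W := fun x hx e => (e ▸ hA hx : x ∈ A \ {x}).2 rfl
    have hAW : A ≠ W := by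
      rintro rfl
      obtain ⟨x, hx, hx'⟩ := hout 0
      exact (face (hsub x hx) (hsubne x hx)).1 (hf x hx) 0 (Set.subset_sdiff_singleton (hS 0) hx')
    rw [face hA hAW] at hnf
    push Not at hnf
    obtain ⟨i, hi⟩ := hnf
    refine ⟨i, Set.Subset.antisymm (fun x hx => ?_) hi⟩
    by_contra hx'
    exact (face (hsub x hx) (hsubne x hx)).1 (hf x hx) i (Set.subset_sdiff_singleton hi hx')
  · rintro ⟨i, rfl⟩
    refine ⟨(Finset.coe_nonempty.2 (hne i)).mono Set.subset_union_left, hS i, fun h => ?_, fun x hx => ?_⟩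
    · exact (face (hS i) (hSne i)).1 h i subset_rfl
    · refine (face (Set.sdiff_subset.trans (hS i)) fun e => ?_).2 fun j hj => ?_
      · have hxW := hS i hx
        rw [← e] at hxW
        exact hxW.2 rfl
      · have := anti i j (hj.trans Set.sdiff_subset)
        subst this
        exact (hj hx).2 rfl

end Pentagon

namespace PentData

variable {n : ℕ} {W : Finset (Fin n → ℝ)} {𝓕 : Set (Finset (Fin n → ℝ))}
  {h X Y : (Fin n → ℝ) → ℤ}

theorem isPrimitiveCollection_iff (H : FanData W 𝓕) (hn : 1 ≤ n)
    (D : PentData W (cofacets W 𝓕) h X Y) {A : Set (Fin n → ℝ)} :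
    IsPrimitiveCollection (convexHull ℝ (W : Set (Fin n → ℝ))) A ↔
      A = (cls W h X 0 0 : Set (Fin n → ℝ)) ∪ cls W h X 0 1 ∨
      A = (cls W h X 0 1 : Set (Fin n → ℝ)) ∪ cls W h X 1 1 ∨
      A = (cls W h X 1 1 : Set (Fin n → ℝ)) ∪ cls W h X 1 0 ∨
      A = (cls W h X 1 0 : Set (Fin n → ℝ)) ∪ cls W h X 0 (-1) ∨
      A = (cls W h X 0 (-1) : Set (Fin n → ℝ)) ∪ cls W h X 0 0 := by
  classical
  let e : Fin 5 → ℤ × ℤ := ![(0, 0), (0, 1), (1, 1), (1, 0), (0, -1)]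
  have he : ∀ i j, e i = e j → i = j := by decide
  obtain ⟨y, hy, hy1, hy2, -⟩ := D.ex_y
  obtain ⟨v, hv, hv1, hv2, -⟩ := D.ex_v
  obtain ⟨u, hu, hu1, hu2, -⟩ := D.ex_u
  obtain ⟨t, ht⟩ := D.ex_t
  obtain ⟨z, hz⟩ := D.ex_z
  have := isPrimitiveCollection_iff_of_pentagon (c := fun i => cls W h X (e i).1 (e i).2) H hn
    (A := A) ?_ ?_ ?_ ?_
  · rw [this]
    simp only [Fin.exists_fin_succ]
    simp [e, Fin.succ]
  · intro i
    fin_cases i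
    · exact ⟨v, mem_cls.2 ⟨hv, hv1, hv2⟩⟩
    · exact ⟨y, mem_cls.2 ⟨hy, hy1, hy2⟩⟩
    · exact ⟨z, mem_cls.2 hz⟩
    · exact ⟨t, mem_cls.2 ht⟩
    · exact ⟨u, mem_cls.2 ⟨hu, hu1, hu2⟩⟩
  · exact fun i => Finset.filter_subset _ _
  · intro i j w hi hj
    have h1 := (mem_cls.1 hi).2
    have h2 := (mem_cls.1 hj).2
    exact he i j (Prod.ext (h1.1.symm.trans h2.1) (h1.2.symm.trans h2.2))
  · intro T
    rw [D.mem_iff]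
    constructor
    · rintro (⟨t, ht, y, hy, v, hv, rfl⟩ | ⟨t, ht, y, hy, u, hu, rfl⟩ | ⟨z, hz, y, hy, u, hu, rfl⟩ |
        ⟨z, hz, v, hv, u, hu, rfl⟩ | ⟨t, ht, z, hz, v, hv, rfl⟩)
      · exact ⟨0, v, hv, y, hy, t, ht, by grind⟩
      · exact ⟨3, t, ht, u, hu, y, hy, by grind⟩
      · exact ⟨1, y, hy, z, hz, u, hu, by grind⟩
      · exact ⟨4, u, hu, v, hv, z, hz, by grind⟩
      · exact ⟨2, z, hz, t, ht, v, hv, by grind⟩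
    · rintro ⟨i, p, hp, q, hq, r, hr, rfl⟩
      fin_cases i
      · exact Or.inl ⟨r, hr, q, hq, p, hp, by grind⟩
      · exact Or.inr (Or.inr (Or.inl ⟨q, hq, p, hp, r, hr, by grind⟩))
      · exact Or.inr (Or.inr (Or.inr (Or.inr ⟨q, hq, p, hp, r, hr, by grind⟩)))
      · exact Or.inr (Or.inl ⟨p, hp, r, hr, q, hq, by grind⟩)
      · exact Or.inr (Or.inr (Or.inr (Or.inl ⟨r, hr, q, hq, p, hp, by grind⟩)))

end PentData

theorem Finset.exists_enum {E : Type*} [AddCommMonoid E] (S : Finset E) {a : ℕ} (h : S.card = a) :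
    ∃ v : Fin a → E, Set.range v = S ∧ ∑ i, v i = ∑ w ∈ S, w := by
  subst h
  refine ⟨fun i => S.equivFin.symm i, ?_, ?_⟩
  · ext w
    constructor
    · rintro ⟨i, rfl⟩
      exact (S.equivFin.symm i).2
    · exact fun hw => ⟨S.equivFin ⟨w, hw⟩, by simp⟩
  · rw [Equiv.sum_comp S.equivFin.symm (fun w : S => (w : E))]
    exact Finset.sum_coe_sort S id

theorem not_isSmoothFano_one (P : Set (Fin 1 → ℝ)) : ¬ IsSmoothFano P := by
  rintro ⟨-, -, h⟩
  obtain ⟨b, -, hb, -⟩ := h ∅ ⟨isExposed_empty, by simp⟩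
  have : b 0 ∈ vertexSet P ∩ ∅ := hb ▸ ⟨0, rfl⟩
  exact this.2

theorem FanData.exists_hasIsolatedStructure {n : ℕ} {W : Finset (Fin n → ℝ)}
    {𝓕 : Set (Finset (Fin n → ℝ))} (H : FanData W 𝓕) (hn : 2 ≤ n) (hcard : W.card = n + 3)
    (hI : FIsolated (convexHull ℝ (W : Set (Fin n → ℝ)))) :
    ∃ a b : ℕ, 2 ≤ a ∧ 2 ≤ b ∧ n = a + 2 * b - 1 ∧
      ∃ (v : Fin a → Fin n → ℝ) (y : Fin b → Fin n → ℝ) (z t : Fin n → ℝ)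
        (u : Fin b → Fin n → ℝ),
        HasIsolatedStructure (convexHull ℝ (W : Set (Fin n → ℝ))) a b v y z t u := by
  obtain ⟨h, X, Y, D, hk, ha, hb, hγ⟩ := H.exists_pentData hn hcard hI
  obtain ⟨t, z, et, ez, -, hyu, hY, -, -⟩ := D.exists_unique_tz hk
  have hγ := hγ z (ez ▸ Finset.mem_singleton_self z)
  have hc := D.sum_eq fun _ => 1
  simp only [← Finset.card_eq_sum_ones, et, ez, Finset.card_singleton] at hc
  obtain ⟨v, rv, sv⟩ := (cls W h X 0 0).exists_enum rfl
  obtain ⟨y, ry, sy⟩ := (cls W h X 0 1).exists_enum rfl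
  obtain ⟨u, ru, su⟩ := (cls W h X 0 (-1)).exists_enum hyu.symm
  have mt := mem_cls.1 (et ▸ Finset.mem_singleton_self t : t ∈ cls W h X 1 0)
  have mz := mem_cls.1 (ez ▸ Finset.mem_singleton_self z : z ∈ cls W h X 1 1)
  have e : ∀ f : (Fin n → ℝ) → ℤ, ∀ S : Finset (Fin n → ℝ), ∀ m : ℤ, (∀ w ∈ S, f w = m) →
      ∑ w ∈ S, (f w : ℝ) • w = (m : ℝ) • ∑ w ∈ S, w := fun f S m hm => by
    rw [Finset.smul_sum]
    exact Finset.sum_congr rfl fun w hw => by rw [hm w hw]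
  have r1 := D.gale.rel_h
  have r2 := D.gale.rel_X
  have r3 := D.gale.rel_Y
  rw [D.sum_eq, et, ez, Finset.sum_singleton, Finset.sum_singleton] at r1 r2 r3
  rw [e h _ 0 fun w hw => (mem_cls.1 hw).2.1, e h _ 0 fun w hw => (mem_cls.1 hw).2.1,
    e h _ 0 fun w hw => (mem_cls.1 hw).2.1, mt.2.1, mz.2.1] at r1
  rw [e X _ 1 fun w hw => (mem_cls.1 hw).2.2, e X _ 0 fun w hw => (mem_cls.1 hw).2.2,
    e X _ (-1) fun w hw => (mem_cls.1 hw).2.2, mt.2.2, mz.2.2, ← sy, ← su] at r2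
  rw [e Y _ 0 fun w hw => D.Y_y hw, e Y _ 1 fun w hw => D.Y_v hw,
    e Y _ 1 fun w hw => D.Y_u hw, ← sv, ← su] at r3
  simp only [Int.cast_zero, Int.cast_one, Int.cast_neg, zero_smul, one_smul, neg_smul, zero_add,
    add_zero] at r1 r2 r3
  have hzt : z = -t := eq_neg_of_add_eq_zero_right r1
  have hYz : (Y z : ℝ) = Y t + ((cls W h X 0 0).card + (cls W h X 0 1).card - 2) := by
    have : Y z = Y t + ((cls W h X 0 0).card + (cls W h X 0 1).card - 2) := by omega
    exact_mod_cast this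
  have hyz : ∑ j, y j + z = ∑ j, u j := by
    rw [← sub_eq_zero, ← r2]
    abel
  have huv : ∑ j, u j + ∑ i, v i =
      (((cls W h X 0 0).card : ℝ) + (cls W h X 0 1).card - 2) • t := by
    rw [hYz, hzt] at r3
    rw [← sub_eq_zero, ← r3]
    module
  refine ⟨_, _, ha, hb, by omega, v, y, z, t, u, ?_, fun A => ?_, ?_, hyz, ?_, ?_, huv⟩
  · rw [H.vertexSet_eq, rv, ry, ru]
    ext w
    have hz : w = z ↔ w ∈ cls W h X 1 1 := by rw [ez, Finset.mem_singleton]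
    have ht : w = t ↔ w ∈ cls W h X 1 0 := by rw [et, Finset.mem_singleton]
    have := D.mem_cases (w := w)
    simp only [Set.mem_union, Set.mem_insert_iff, Set.mem_singleton_iff, hz, ht, Finset.mem_coe]
    constructor
    · tauto
    · simp only [mem_cls]
      tauto
  · rw [D.isPrimitiveCollection_iff H (by omega), et, ez, rv, ry, ru, Finset.coe_singleton,
      Finset.coe_singleton]
    rfl
  · have : ∑ j, y j = ∑ j, u j + t := by rw [← hyz, hzt]; abel
    rw [this, add_comm, add_right_comm, huv]
    module
  · rw [add_comm]
    exact r1
  · rw [← hyz, hzt]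
    abel

/-- If a smooth Fano `n`-polytope with `n+3` vertices is
F-isolated then there are `a ≥ 2`, `b ≥ 2` with `n = a + 2b - 1` and a
labeling of the vertices so that the primitive relations are exactly the five
relations of Theorem `pic3cha`. -/
theorem F_isolated_of_picard_three_structure {n : ℕ} (P : Set (Fin n → ℝ))
    (hP : IsSmoothFano P) (hcard : (vertexSet P).ncard = n + 3)
    (hiso : FIsolated P) :
    ∃ a b : ℕ, 2 ≤ a ∧ 2 ≤ b ∧ n = a + 2 * b - 1 ∧
      ∃ (v : Fin a → Fin n → ℝ) (y : Fin b → Fin n → ℝ) (z t : Fin n → ℝ)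
        (u : Fin b → Fin n → ℝ), HasIsolatedStructure P a b v y z t u := by
  obtain rfl | rfl | hn : n = 0 ∨ n = 1 ∨ 2 ≤ n := by omega
  · have := Set.ncard_le_one_of_subsingleton (vertexSet P)
    omega
  · exact (not_isSmoothFano_one P hP).elim
  · obtain ⟨W, 𝓕, H, rfl⟩ := hP.exists_fanData (by omega)
    rw [H.vertexSet_eq, Set.ncard_coe_finset] at hcard
    exact H.exists_hasIsolatedStructure hn hcard hiso
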